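/- arXiv:1710.06045 — 6 statements merged into one kernel-verified Lean document; each statement's English description precedes it below -/
import Mathlib

section
/- Let p ∈ ℂ[z] be a polynomial of degree at least 2 without multiple roots. Let Ĩ ⊆ V be a nonzero ℂ-linear subspace such that {g, f} ∈ Ĩ for all g ∈ V and f ∈ Ĩ. Then for every r ∈ ℂ[z] and every n ≥ 1, the class of r(z)xⁿ lies in Ĩ. -/
open Polynomial

set_option synthInstance.maxHeartbeats 400000
set_option maxHeartbeats 800000

noncomputable section

/-- The polynomial ring `ℂ[x,y,z]` (variables indexed by `Fin 3`). -/
abbrev P3 : Type := MvPolynomial (Fin 3) ℂ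

/-- The variable `x`. -/
def xP : P3 := MvPolynomial.X 0
/-- The variable `y`. -/
def yP : P3 := MvPolynomial.X 1
/-- The variable `z`. -/
def zP : P3 := MvPolynomial.X 2

/-- The ideal `(xy - p(z)) ⊆ ℂ[x,y,z]`. -/
def relIdeal (p : ℂ[X]) : Ideal P3 := Ideal.span {xP * yP - Polynomial.aeval zP p}

/-- The coordinate ring `O(D_p) = ℂ[x,y,z]/(xy - p(z))` of the Danielewski surface `D_p`. -/
abbrev ODan (p : ℂ[X]) : Type := P3 ⧸ relIdeal p

open MvPolynomial in
/-- The Poisson-type bracket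
`{f,g} = p'(z)(f_y g_x - f_x g_y) + x(f_z g_x - f_x g_z) - y(f_z g_y - f_y g_z)`
on `ℂ[x,y,z]`. -/
def pb (p : ℂ[X]) (f g : P3) : P3 :=
  Polynomial.aeval zP (Polynomial.derivative p) *
      (pderiv (1 : Fin 3) f * pderiv (0 : Fin 3) g - pderiv (0 : Fin 3) f * pderiv (1 : Fin 3) g)
    + xP * (pderiv (2 : Fin 3) f * pderiv (0 : Fin 3) g -
        pderiv (0 : Fin 3) f * pderiv (2 : Fin 3) g)
    - yP * (pderiv (2 : Fin 3) f * pderiv (1 : Fin 3) g -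
        pderiv (1 : Fin 3) f * pderiv (2 : Fin 3) g)

/-- The line of constants `ℂ·1 ⊆ O(D_p)`. -/
def constSub (p : ℂ[X]) : Submodule ℂ (ODan p) := Submodule.span ℂ {(1 : ODan p)}

/-- The quotient space `O(D_p)/ℂ·1`. -/
abbrev QDan (p : ℂ[X]) : Type := ODan p ⧸ constSub p

/-- The class in `O(D_p)/ℂ·1` of a polynomial `f ∈ ℂ[x,y,z]`. -/
def cls (p : ℂ[X]) (f : P3) : QDan p :=
  Submodule.Quotient.mk (Ideal.Quotient.mk (relIdeal p) f)

/-- The generating set of `S`: the classes of `xⁱzʲ` (`i ≥ 1`), `yⁱzʲ` (`i ≥ 1`) and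
`(p(z)r(z))'` for `r ∈ ℂ[z]`. -/
def Sgen (p : ℂ[X]) : Set (ODan p) :=
  {w | (∃ i j : ℕ, 1 ≤ i ∧ w = Ideal.Quotient.mk (relIdeal p) (xP ^ i * zP ^ j)) ∨
       (∃ i j : ℕ, 1 ≤ i ∧ w = Ideal.Quotient.mk (relIdeal p) (yP ^ i * zP ^ j)) ∨
       (∃ r : ℂ[X], w = Ideal.Quotient.mk (relIdeal p)
          (Polynomial.aeval zP (Polynomial.derivative (p * r))))}

/-- `V`: the image in `O(D_p)/ℂ·1` of the span `S` of the classes of `xⁱzʲ`, `yⁱzʲ`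
(`i ≥ 1`) and `(p(z)r(z))'`. -/
def Vsub (p : ℂ[X]) : Submodule ℂ (QDan p) :=
  (Submodule.span ℂ (Sgen p)).map (constSub p).mkQ

namespace Dan

/-- shorthand for `r(z)` -/
abbrev zz (r : ℂ[X]) : P3 := Polynomial.aeval zP r

lemma d0z (r : ℂ[X]) : MvPolynomial.pderiv (0 : Fin 3) (zz r) = 0 := by
  rw [zz, Derivation.map_aeval]; simp [zP, MvPolynomial.pderiv_X]

lemma d1z (r : ℂ[X]) : MvPolynomial.pderiv (1 : Fin 3) (zz r) = 0 := by
  rw [zz, Derivation.map_aeval]; simp [zP, MvPolynomial.pderiv_X]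

lemma d2z (r : ℂ[X]) : MvPolynomial.pderiv (2 : Fin 3) (zz r) = zz (derivative r) := by
  rw [zz, Derivation.map_aeval]; simp [zz, zP, MvPolynomial.pderiv_X]

lemma d0x : MvPolynomial.pderiv (0 : Fin 3) xP = 1 := by simp [xP, MvPolynomial.pderiv_X]
lemma d1x : MvPolynomial.pderiv (1 : Fin 3) xP = 0 := by simp [xP, MvPolynomial.pderiv_X]
lemma d2x : MvPolynomial.pderiv (2 : Fin 3) xP = 0 := by simp [xP, MvPolynomial.pderiv_X]
lemma d0y : MvPolynomial.pderiv (0 : Fin 3) yP = 0 := by simp [yP, MvPolynomial.pderiv_X]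
lemma d1y : MvPolynomial.pderiv (1 : Fin 3) yP = 1 := by simp [yP, MvPolynomial.pderiv_X]
lemma d2y : MvPolynomial.pderiv (2 : Fin 3) yP = 0 := by simp [yP, MvPolynomial.pderiv_X]

lemma pb_sum (p : ℂ[X]) (f : P3) {ι : Type*} (T : Finset ι) (g : ι → P3) :
    pb p f (∑ i ∈ T, g i) = ∑ i ∈ T, pb p f (g i) := by
  classical
  induction T using Finset.induction_on with
  | empty => simp [pb]
  | insert a s ha ih =>
    rw [Finset.sum_insert ha, Finset.sum_insert ha, ← ih]
    simp only [pb, map_add]; ring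

/-- bracket of two polynomials in x, z -/
lemma pb_xx (p r s : ℂ[X]) (i k : ℕ) :
    pb p (zz r * xP ^ (i+1)) (zz s * xP ^ k) =
      xP ^ (i+1+k) * ((k : P3) * zz (derivative r) * zz s
        - ((i+1 : ℕ) : P3) * zz r * zz (derivative s)) := by
  simp only [pb, Derivation.leibniz, Derivation.leibniz_pow, d0z, d1z, d2z, d0x, d1x, d2x,
    smul_eq_mul, nsmul_eq_mul]
  rcases k with _ | k
  · simp; ring
  · simp only [Nat.add_sub_cancel]; push_cast; ring

lemma pb_x_poly (p r c : ℂ[X]) (i : ℕ) :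
    pb p (zz r * xP ^ (i+1)) (Polynomial.aeval xP c) =
      zz (derivative r) * Polynomial.aeval xP (Polynomial.X ^ (i+2) * derivative c) := by
  simp only [pb, Derivation.leibniz, Derivation.leibniz_pow, Derivation.map_aeval _ c, d0z, d1z,
    d2z, d0x, d1x, d2x, smul_eq_mul, nsmul_eq_mul, map_mul, map_pow, Polynomial.aeval_X,
    Nat.add_sub_cancel]
  ring

lemma pb_yx (p r s : ℂ[X]) (k : ℕ) :
    pb p (zz r * yP) (zz s * xP ^ (k+1)) =
      xP ^ k * (((k+1 : ℕ) : P3) * zz (derivative p) * zz r * zz s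
       + xP * yP * (((k+1 : ℕ) : P3) * zz (derivative r) * zz s + zz r * zz (derivative s))) := by
  simp only [pb, Derivation.leibniz, Derivation.leibniz_pow, d0z, d1z, d2z, d0x, d1x, d2x,
    d0y, d1y, d2y, smul_eq_mul, nsmul_eq_mul, Nat.add_sub_cancel]
  push_cast; ring

lemma rel_mk (p : ℂ[X]) : Ideal.Quotient.mk (relIdeal p) (xP * yP) =
    Ideal.Quotient.mk (relIdeal p) (zz p) := by
  rw [Ideal.Quotient.eq]; exact Ideal.subset_span rfl

/-- bracket of `x^K` with a monomial, modulo the relation -/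
lemma pb_x_mono (p a : ℂ[X]) (K u v w : ℕ) (h : K + 1 + u = w + v) :
    Ideal.Quotient.mk (relIdeal p) (pb p (xP ^ (K+1)) (zz a * xP ^ u * yP ^ v)) =
    Ideal.Quotient.mk (relIdeal p)
      (((-((K+1 : ℕ) : ℂ)) • (zz (derivative (a * p ^ v)) * xP ^ w))) := by
  have hr := rel_mk p
  have e1 : pb p (xP ^ (K+1)) (zz a * xP ^ u * yP ^ v) =
      -((K+1 : ℕ) : P3) * xP ^ K * (zz (derivative p) * (zz a * xP ^ u * ((v : P3) * yP ^ (v-1)))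
        + xP * (zz (derivative a) * xP ^ u * yP ^ v)) := by
    simp only [pb, Derivation.leibniz, Derivation.leibniz_pow, d0z, d1z, d2z, d0x, d1x, d2x,
      d0y, d1y, d2y, smul_eq_mul, nsmul_eq_mul, Nat.add_sub_cancel]
    push_cast; ring
  rw [e1]
  have e2 : (((-((K+1 : ℕ) : ℂ)) • (zz (derivative (a * p ^ v)) * xP ^ w))) =
      -((K+1 : ℕ) : P3) * ((zz (derivative a) * zz p ^ v
        + zz a * ((v : P3) * zz p ^ (v-1) * zz (derivative p))) * xP ^ w) := by
    rw [MvPolynomial.smul_eq_C_mul, zz, derivative_mul, derivative_pow]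
    simp only [map_add, map_mul, map_pow, map_neg, map_natCast]
  rw [e2]
  rcases v with _ | v
  · obtain rfl : w = K + 1 + u := by omega
    congr 1; simp; ring
  · have h' : K + u = w + v := by omega
    simp only [Nat.add_sub_cancel, map_mul, map_add, map_pow, map_neg] at hr ⊢
    rw [← hr]
    generalize Ideal.Quotient.mk (relIdeal p) xP = x
    generalize Ideal.Quotient.mk (relIdeal p) yP = y
    have h1 : x ^ K * x ^ u = x ^ w * x ^ v := by rw [← pow_add, ← pow_add, h']
    simp only [mul_pow, pow_succ]
    linear_combination (-(Ideal.Quotient.mk (relIdeal p)) ((K+1 : ℕ) : P3) *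
      ((Ideal.Quotient.mk (relIdeal p)) (zz (derivative p)) * (Ideal.Quotient.mk (relIdeal p)) (zz a)
       * (Ideal.Quotient.mk (relIdeal p)) ((v+1 : ℕ) : P3) * y ^ v +
        x * (Ideal.Quotient.mk (relIdeal p)) (zz (derivative a)) * y ^ v * y)) * h1

section
variable (p : ℂ[X]) (J : Submodule ℂ P3)

/-- Lemma B, homogeneous extraction -/
lemma lemB (hJ : ∀ (r : ℂ[X]) (i : ℕ), ∀ f ∈ J, pb p (zz r * xP ^ (i+1)) f ∈ J) :
    ∀ (N : ℕ) (c : ℂ[X]), c.support.card ≤ N → c ≠ 0 → c.coeff 0 = 0 →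
      Polynomial.aeval xP c ∈ J → ∃ M, 1 ≤ M ∧ xP ^ M ∈ J := by
  have hU : ∀ (c : ℂ[X]) (i : ℕ), Polynomial.aeval xP c ∈ J →
      Polynomial.aeval xP (Polynomial.X ^ (i+2) * derivative c) ∈ J := by
    intro c i hc
    have := hJ X i _ hc
    rw [pb_x_poly] at this
    simpa [zz] using this
  intro N
  induction N with
  | zero =>
    intro c hc h0
    simp at hc; exact absurd hc h0
  | succ N ih =>
    intro c hc h0 hc0 hJc
    set n0 := c.natDegree with hn0
    set c2 : ℂ[X] := X ^ 2 * derivative (X ^ 2 * derivative c)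
      - ((n0 : ℂ) + 1) • (X ^ 3 * derivative c) with hc2
    have hc2J : Polynomial.aeval xP c2 ∈ J := by
      rw [hc2, map_sub, map_smul]
      exact J.sub_mem (hU _ 0 (hU _ 0 hJc)) (J.smul_mem _ (hU _ 1 hJc))
    have hform : c2 = X ^ 2 * (X * derivative (X * derivative c) - (n0 : ℂ) • (X * derivative c)) := by
      rw [hc2]
      simp only [derivative_mul, derivative_X_pow, derivative_X, smul_eq_C_mul, map_add, map_natCast,
        map_one]
      simp
      ring
    have hcoe : ∀ n, c2.coeff (n+2) = n * (n - n0) * c.coeff n := by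
      intro n
      rw [hform, coeff_X_pow_mul]
      rcases n with _ | n
      · simp
      · rw [coeff_sub, coeff_smul, coeff_X_mul, coeff_X_mul, coeff_derivative, coeff_X_mul,
          coeff_derivative]
        simp only [smul_eq_mul]; push_cast; ring
    have hlow : ∀ n, n < 2 → c2.coeff n = 0 := by
      intro n hn
      rw [hform, coeff_X_pow_mul']
      simp [hn]
    have hcn : c.coeff n0 ≠ 0 := by rw [hn0]; simpa using h0
    have hn1 : 1 ≤ n0 := by
      rcases Nat.eq_zero_or_pos n0 with h | h
      · rw [h] at hcn; exact absurd hc0 hcn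
      · exact h
    by_cases hz : c2 = 0
    · refine ⟨n0, hn1, ?_⟩
      have hm : c = monomial n0 (c.coeff n0) := by
        ext n
        rw [coeff_monomial]
        split_ifs with h
        · rw [h]
        · have := hcoe n
          rw [hz, coeff_zero] at this
          rcases Nat.eq_zero_or_pos n with h' | h'
          · rw [h', hc0]
          · have a1 : (n : ℂ) ≠ 0 := by exact_mod_cast h'.ne'
            have a2 : (n : ℂ) - n0 ≠ 0 := by
              rw [sub_ne_zero]; exact_mod_cast (Ne.symm h)
            simpa [a1, a2] using this.symm
      rw [hm, aeval_monomial, ← Algebra.smul_def] at hJc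
      have := J.smul_mem (c.coeff n0)⁻¹ hJc
      rwa [smul_smul, inv_mul_cancel₀ hcn, one_smul] at this
    · refine ih c2 ?_ hz (hlow 0 (by norm_num)) hc2J
      have hsub : c2.support ⊆ (c.support.erase n0).image (· + 2) := by
        intro m hm
        rw [mem_support_iff] at hm
        have hm2 : 2 ≤ m := by
          by_contra h
          exact hm (hlow m (by omega))
        obtain ⟨n, rfl⟩ : ∃ n, m = n + 2 := ⟨m - 2, by omega⟩
        rw [hcoe] at hm
        refine Finset.mem_image.2 ⟨n, ?_, rfl⟩
        rw [Finset.mem_erase, mem_support_iff]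
        refine ⟨?_, fun h => hm (by rw [h, mul_zero])⟩
        rintro rfl
        exact hm (by simp)
      have h1 := Finset.card_le_card hsub
      have h2 := Finset.card_image_le (s := c.support.erase n0) (f := (· + 2))
      have h3 := Finset.card_erase_of_mem (mem_support_iff.2 hcn)
      omega

lemma lemB' (hJ : ∀ (r : ℂ[X]) (i : ℕ), ∀ f ∈ J, pb p (zz r * xP ^ (i+1)) f ∈ J)
    (c : ℂ[X]) (n : ℕ) (hn : 1 ≤ n) (hc : c.coeff n ≠ 0) (hcJ : Polynomial.aeval xP c ∈ J) :
    ∃ M, 1 ≤ M ∧ xP ^ M ∈ J := by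
  have h1 := hJ X 0 _ hcJ
  rw [pb_x_poly] at h1
  refine lemB p J hJ _ (X ^ 2 * derivative c) le_rfl ?_ ?_ (by simpa [zz] using h1)
  · intro h
    have h2 : (X ^ 2 * derivative c).coeff ((n-1) + 2) = 0 := by rw [h]; simp
    obtain ⟨m, rfl⟩ : ∃ m, n = m + 1 := ⟨n-1, by omega⟩
    rw [coeff_X_pow_mul, Nat.add_sub_cancel, coeff_derivative] at h2
    have : ((m : ℂ) + 1) ≠ 0 := by exact_mod_cast Nat.succ_ne_zero m
    exact (mul_ne_zero hc this) h2
  · rw [coeff_X_pow_mul']; simp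

lemma const_of_der {g : ℂ[X]} (h : derivative g = 0) : g = C (g.coeff 0) :=
  eq_C_of_natDegree_eq_zero (derivative_eq_zero.1 h)

lemma sum_const {ι : Type*} (T : Finset ι) (e : ι → ℕ) (g : ι → ℂ[X])
    (h : ∀ i ∈ T, g i = C ((g i).coeff 0)) :
    ∑ i ∈ T, zz (g i) * xP ^ e i =
      Polynomial.aeval xP (∑ i ∈ T, C ((g i).coeff 0) * X ^ e i) := by
  rw [map_sum]
  refine Finset.sum_congr rfl fun i hi => ?_
  rw [h i hi]
  simp [zz]

lemma sum_coeff {ι : Type*} (T : Finset ι) (e : ι → ℕ) (he : Set.InjOn e T) (c : ι → ℂ)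
    (i : ι) (hi : i ∈ T) :
    (∑ j ∈ T, C (c j) * X ^ e j).coeff (e i) = c i := by
  classical
  rw [finsetSum_coeff, Finset.sum_eq_single i]
  · simp
  · intro b hb hbi
    rw [coeff_C_mul_X_pow, if_neg]
    intro h; exact hbi (he hb hi h.symm)
  · intro h; exact absurd hi h

lemma lemA (hJ : ∀ (r : ℂ[X]) (i : ℕ), ∀ f ∈ J, pb p (zz r * xP ^ (i+1)) f ∈ J)
    {ι : Type*} (T : Finset ι) :
    ∀ (N : ℕ) (e : ι → ℕ) (g : ι → ℂ[X]), Set.InjOn e T → (∀ i ∈ T, 1 ≤ e i) →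
      (∀ i ∈ T, (g i).natDegree ≤ N) → (∃ i ∈ T, g i ≠ 0) →
      ∑ i ∈ T, zz (g i) * xP ^ e i ∈ J → ∃ M, 1 ≤ M ∧ xP ^ M ∈ J := by
  intro N
  have base : ∀ (e : ι → ℕ) (g : ι → ℂ[X]), Set.InjOn e T → (∀ i ∈ T, 1 ≤ e i) →
      (∀ i ∈ T, derivative (g i) = 0) → (∃ i ∈ T, g i ≠ 0) →
      ∑ i ∈ T, zz (g i) * xP ^ e i ∈ J → ∃ M, 1 ≤ M ∧ xP ^ M ∈ J := by
    rintro e g he he1 hd ⟨i, hi, hg⟩ hm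
    have hcst : ∀ i ∈ T, g i = C ((g i).coeff 0) := fun i hi => const_of_der (hd i hi)
    rw [sum_const T e g hcst] at hm
    refine lemB' p J hJ _ (e i) (he1 i hi) ?_ hm
    rw [sum_coeff T e he _ i hi]
    intro h
    have := hcst i hi
    rw [h, C_0] at this
    exact hg this
  induction N with
  | zero =>
    intro e g he he1 hd
    refine base e g he he1 fun i hi => ?_
    exact derivative_of_natDegree_zero (Nat.le_zero.1 (hd i hi))
  | succ N ih =>
    intro e g he he1 hd hne hm
    by_cases hall : ∀ i ∈ T, derivative (g i) = 0
    · exact base e g he he1 hall hne hm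
    · push Not at hall
      refine ih (fun i => e i + 1) (fun i => derivative (g i)) ?_ ?_ ?_ hall ?_
      · intro a ha b hb hab
        exact he ha hb (by simpa using hab)
      · intro i _; simp
      · intro i hi
        have := natDegree_derivative_le (g i)
        have := hd i hi
        omega
      · have h1 := J.neg_mem (hJ 1 0 _ hm)
        rw [pb_sum, ← Finset.sum_neg_distrib] at h1
        convert h1 using 2 with i hi
        rw [pb_xx]
        simp [zz]
        ring

/-- final descent -/
lemma lemC (hsp : Squarefree p)
    (hJ : ∀ (r : ℂ[X]) (i : ℕ), ∀ f ∈ J, pb p (zz r * xP ^ (i+1)) f ∈ J)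
    (hJy : ∀ (r : ℂ[X]), ∀ f ∈ J, pb p (zz r * yP) f ∈ J)
    (hrel : ∀ f g : P3, Ideal.Quotient.mk (relIdeal p) f = Ideal.Quotient.mk (relIdeal p) g →
      f ∈ J → g ∈ J)
    (M : ℕ) (hM : 1 ≤ M) (hx : xP ^ M ∈ J) (r : ℂ[X]) (n : ℕ) (hn : 1 ≤ n) :
    zz r * xP ^ n ∈ J := by
  -- large exponents
  have hbig : ∀ n, M + 1 ≤ n → ∀ r, zz r * xP ^ n ∈ J := by
    intro n hn r
    obtain ⟨i, rfl⟩ : ∃ i, n = i + 1 + M := ⟨n - 1 - M, by omega⟩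
    obtain ⟨R, rfl⟩ : ∃ R : ℂ[X], derivative R = r := by
      refine ⟨r.sum fun n a => monomial (n+1) (a / (n+1)), ?_⟩
      rw [Polynomial.sum_def, derivative_sum]
      conv_rhs => rw [r.as_sum_support]
      refine Finset.sum_congr rfl fun n _ => ?_
      rw [derivative_monomial]
      have : ((n : ℂ) + 1) ≠ 0 := by exact_mod_cast Nat.succ_ne_zero n
      simp [this]
    have h1 := hJ R i (zz 1 * xP ^ M) (by simpa [zz] using hx)
    rw [pb_xx] at h1
    have hM0 : (M : ℂ) ≠ 0 := by exact_mod_cast (by omega : M ≠ 0)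
    have h2 := J.smul_mem (M : ℂ)⁻¹ h1
    convert h2 using 1
    have : (M : P3) = MvPolynomial.C (M : ℂ) := by simp
    simp only [zz, derivative_one, map_one, map_zero, mul_zero, sub_zero, mul_one]
    rw [this, MvPolynomial.smul_eq_C_mul]
    have h3 : (MvPolynomial.C (M : ℂ)⁻¹ : P3) * MvPolynomial.C (M : ℂ) = 1 := by
      rw [← MvPolynomial.C_mul, inv_mul_cancel₀ hM0, MvPolynomial.C_1]
    linear_combination (-(aeval zP (derivative R) * xP ^ (i+1+M))) * h3
  have hcop : IsCoprime p (derivative p) := by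
    have := (PerfectField.separable_iff_squarefree (g := p)).2 hsp
    exact this
  have hstep : ∀ k, 1 ≤ k → (∀ r, zz r * xP ^ (k+1) ∈ J) → ∀ r, zz r * xP ^ k ∈ J := by
    intro k hk H
    have key : ∀ r s : ℂ[X], zz (((k : ℂ[X])+1) * derivative p * r * s + p * (((k : ℂ[X])+1) *
        derivative r * s + r * derivative s)) * xP ^ k ∈ J := by
      intro r s
      refine hrel _ _ ?_ (hJy r _ (H s))
      rw [pb_yx]
      have hr := rel_mk p
      simp only [zz, map_mul, map_add, map_pow, map_natCast, map_one] at hr ⊢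
      rw [hr]; push_cast; ring
    have hpder : ∀ t, zz (p * derivative t) * xP ^ k ∈ J := by
      intro t
      have h1 := J.sub_mem (key t 1) (key 1 t)
      have hk0 : (k : ℂ) ≠ 0 := by exact_mod_cast (by omega : k ≠ 0)
      have h2 := J.smul_mem (k : ℂ)⁻¹ h1
      convert h2 using 1
      rw [← sub_mul, ← smul_mul_assoc, ← map_sub, ← map_smul]
      congr 2
      have : (k : ℂ[X]) = C (k : ℂ) := by simp
      have h3 : (C (k : ℂ)⁻¹ : ℂ[X]) * C (k : ℂ) = 1 := by
        rw [← C_mul, inv_mul_cancel₀ hk0, C_1]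
      rw [this, smul_eq_C_mul]
      simp only [derivative_one]
      linear_combination (-(p * derivative t)) * h3
    have hder : ∀ r : ℂ[X], ∃ R : ℂ[X], derivative R = r := by
      intro r
      refine ⟨r.sum fun n a => monomial (n+1) (a / (n+1)), ?_⟩
      rw [Polynomial.sum_def, derivative_sum]
      conv_rhs => rw [r.as_sum_support]
      refine Finset.sum_congr rfl fun n _ => ?_
      rw [derivative_monomial]
      have : ((n : ℂ) + 1) ≠ 0 := by exact_mod_cast Nat.succ_ne_zero n
      simp [this]
    have hp : ∀ t, zz (p * t) * xP ^ k ∈ J := by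
      intro t
      obtain ⟨R, rfl⟩ := hder t
      exact hpder R
    have hp' : ∀ t, zz (derivative p * t) * xP ^ k ∈ J := by
      intro t
      have h1 := J.sub_mem (key 1 t) (hp (derivative t))
      have hk0 : ((k : ℂ) + 1) ≠ 0 := by exact_mod_cast Nat.succ_ne_zero k
      have h2 := J.smul_mem ((k : ℂ)+1)⁻¹ h1
      convert h2 using 1
      rw [← sub_mul, ← smul_mul_assoc, ← map_sub, ← map_smul]
      congr 2
      have : (k : ℂ[X]) + 1 = C ((k : ℂ)+1) := by simp
      have h3 : (C ((k : ℂ)+1)⁻¹ : ℂ[X]) * C ((k : ℂ)+1) = 1 := by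
        rw [← C_mul, inv_mul_cancel₀ hk0, C_1]
      rw [this, smul_eq_C_mul]
      simp only [derivative_one]
      linear_combination (-derivative p * t) * h3
    intro r
    obtain ⟨a, b, hab⟩ := hcop
    have : r = p * (a * r) + derivative p * (b * r) := by linear_combination (-r) * hab
    rw [this, zz, map_add, add_mul]
    exact J.add_mem (hp _) (hp' _)
  have hall : ∀ d n, 1 ≤ n → M + 1 ≤ n + d → ∀ r, zz r * xP ^ n ∈ J := by
    intro d
    induction d with
    | zero => intro n _ h; exact hbig n h
    | succ d ih => intro n hn h; exact hstep n hn (ih (n+1) (by omega) (by omega))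
  exact hall (M+1) n hn (by omega) r

/-- normal form attached to a finitely supported family -/
def rep (a : ℤ →₀ ℂ[X]) : P3 := a.sum fun n r => zz r * xP ^ n.toNat * yP ^ (-n).toNat

lemma rep_add (a b : ℤ →₀ ℂ[X]) : rep (a + b) = rep a + rep b := by
  unfold rep
  rw [Finsupp.sum_add_index']
  · intro n; simp [zz]
  · intro n r s; simp [zz]; ring

lemma rep_single (n : ℤ) (r : ℂ[X]) : rep (Finsupp.single n r) =
    zz r * xP ^ n.toNat * yP ^ (-n).toNat := by
  unfold rep; rw [Finsupp.sum_single_index]; simp [zz]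

lemma rep_smul (c : ℂ) (a : ℤ →₀ ℂ[X]) : rep (c • a) = c • rep a := by
  unfold rep
  rw [Finsupp.sum_smul_index', Finsupp.smul_sum]
  · simp [zz]
  · intro n; simp [zz]

lemma exists_rep (w : ODan p) (hw : w ∈ Submodule.span ℂ (Sgen p)) :
    ∃ a, w = Ideal.Quotient.mk (relIdeal p) (rep a) := by
  induction hw using Submodule.span_induction with
  | mem w hw =>
    rcases hw with ⟨i, j, _, rfl⟩ | ⟨i, j, _, rfl⟩ | ⟨r, rfl⟩
    · refine ⟨Finsupp.single (i : ℤ) (X ^ j), ?_⟩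
      rw [rep_single]; congr 1; simp [zz]; ring
    · refine ⟨Finsupp.single (-(i : ℤ)) (X ^ j), ?_⟩
      rw [rep_single]; congr 1; simp [zz]; ring
    · refine ⟨Finsupp.single 0 (derivative (p * r)), ?_⟩
      rw [rep_single]; congr 1; simp [zz]
  | zero => exact ⟨0, by simp [rep]⟩
  | add x y _ _ hx hy =>
    obtain ⟨a, rfl⟩ := hx
    obtain ⟨b, rfl⟩ := hy
    exact ⟨a + b, by rw [rep_add, map_add]⟩
  | smul c x _ hx =>
    obtain ⟨a, rfl⟩ := hx
    exact ⟨c • a, by rw [rep_smul]; rfl⟩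

lemma lemD (hp2 : 2 ≤ p.natDegree)
    (hJ : ∀ (r : ℂ[X]) (i : ℕ), ∀ f ∈ J, pb p (zz r * xP ^ (i+1)) f ∈ J)
    (hrel : ∀ f g : P3, Ideal.Quotient.mk (relIdeal p) f = Ideal.Quotient.mk (relIdeal p) g →
      f ∈ J → g ∈ J)
    (a : ℤ →₀ ℂ[X]) (ha : ∃ n, a n ≠ 0 ∧ (n = 0 → derivative (a n) ≠ 0)) (haJ : rep a ∈ J) :
    ∃ M, 1 ≤ M ∧ xP ^ M ∈ J := by
  by_cases hall : ∀ n ∈ a.support, derivative (a n * p ^ (-n).toNat) = 0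
  · have hneg : ∀ n ∈ a.support, 0 ≤ n := by
      intro n hn
      by_contra hlt
      have hd := derivative_eq_zero.1 (hall n hn)
      have hp0 : p ≠ 0 := by rintro rfl; simp at hp2
      rw [natDegree_mul (Finsupp.mem_support_iff.1 hn) (pow_ne_zero _ hp0), natDegree_pow] at hd
      have h1 : 1 ≤ (-n).toNat := by omega
      have : 1 * 2 ≤ (-n).toNat * p.natDegree := Nat.mul_le_mul h1 hp2
      omega
    have hder : ∀ n ∈ a.support, derivative (a n) = 0 := by
      intro n hn
      have := hall n hn
      have h0 := hneg n hn
      rwa [show (-n).toNat = 0 by omega, pow_zero, mul_one] at this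
    have hcst : ∀ n ∈ a.support, a n = C ((a n).coeff 0) := fun n hn => const_of_der (hder n hn)
    have hrep : rep a = ∑ n ∈ a.support, zz (a n) * xP ^ n.toNat := by
      unfold rep Finsupp.sum
      refine Finset.sum_congr rfl fun n hn => ?_
      have h0 := hneg n hn
      beta_reduce
      rw [show (-n).toNat = 0 by omega, pow_zero, mul_one]
    rw [hrep, sum_const _ (fun n : ℤ => n.toNat) _ hcst] at haJ
    obtain ⟨n, hn, hn0⟩ := ha
    have hns := Finsupp.mem_support_iff.2 hn
    have hpos : 1 ≤ n.toNat := by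
      have h0 := hneg n hns
      rcases eq_or_ne n 0 with h | h
      · exact absurd (hder n hns) (hn0 h)
      · omega
    refine lemB' p J hJ _ n.toNat hpos ?_ haJ
    rw [sum_coeff a.support (fun n : ℤ => n.toNat) ?_ _ n hns]
    · intro h
      have := hcst n hns
      rw [h, C_0] at this
      exact hn this
    · intro b hb c hc hbc
      have := hneg b hb
      have := hneg c hc
      simp only at hbc
      omega
  · push Not at hall
    obtain ⟨K, hK⟩ : ∃ K : ℕ, ∀ n ∈ a.support, n.natAbs ≤ K :=
      ⟨a.support.sup Int.natAbs, fun n hn => Finset.le_sup (f := Int.natAbs) hn⟩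
    have h1 := hJ 1 K _ haJ
    have h2 : ∑ n ∈ a.support, zz (derivative (a n * p ^ (-n).toNat)) * xP ^ (K + 1 + n).toNat ∈ J := by
      have hK0 : (-((K + 1 : ℕ) : ℂ)) ≠ 0 := by
        rw [neg_ne_zero]; exact_mod_cast Nat.succ_ne_zero K
      have h3 : (-((K + 1 : ℕ) : ℂ)) • ∑ n ∈ a.support,
          zz (derivative (a n * p ^ (-n).toNat)) * xP ^ (K + 1 + n).toNat ∈ J := by
        refine hrel _ _ ?_ h1
        unfold rep Finsupp.sum
        rw [pb_sum, Finset.smul_sum, map_sum, map_sum]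
        refine Finset.sum_congr rfl fun n hn => ?_
        have := hK n hn
        rw [show (zz 1 : P3) = 1 by simp [zz], one_mul]
        exact pb_x_mono p (a n) K _ _ _ (by omega)
      have := J.smul_mem (-((K + 1 : ℕ) : ℂ))⁻¹ h3
      rwa [smul_smul, inv_mul_cancel₀ hK0, one_smul] at this
    refine lemA p J hJ a.support
      (a.support.sup fun n => (derivative (a n * p ^ (-n).toNat)).natDegree)
      (fun n : ℤ => (K + 1 + n).toNat) (fun n => derivative (a n * p ^ (-n).toNat)) ?_ ?_ ?_ hall h2
    · intro b hb c hc hbc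
      have := hK b hb
      have := hK c hc
      simp only at hbc
      omega
    · intro b hb
      have := hK b hb
      omega
    · intro b hb
      exact Finset.le_sup (f := fun n => (derivative (a n * p ^ (-n).toNat)).natDegree) hb

/-- the class map as a linear map -/
def clsL : P3 →ₗ[ℂ] QDan p :=
  (constSub p).mkQ ∘ₗ (Ideal.Quotient.mkₐ ℂ (relIdeal p)).toLinearMap

lemma clsL_apply (f : P3) : clsL p f = cls p f := rfl

lemma cls_gen (f : P3) (h : Ideal.Quotient.mk (relIdeal p) f ∈ Sgen p) : cls p f ∈ Vsub p :=
  Submodule.mem_map_of_mem (Submodule.subset_span h)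

lemma cls_zz_mul (g : P3) (h : ∀ j : ℕ, cls p (g * zP ^ j) ∈ Vsub p) (r : ℂ[X]) :
    cls p (zz r * g) ∈ Vsub p := by
  rw [← clsL_apply]
  change zz r * g ∈ (Vsub p).comap (clsL p)
  rw [zz, aeval_eq_sum_range, Finset.sum_mul]
  refine Submodule.sum_mem _ fun j _ => ?_
  rw [smul_mul_assoc, mul_comm]
  exact Submodule.smul_mem _ _ (h j)

end
end Dan

/-- Let `p` be squarefree of degree at least `2`, and let `{·,·}` denote the induced
bracket on `O(D_p)/ℂ·1`.  If `Ĩ ⊆ V` is a nonzero `ℂ`-subspace with `{g,f} ∈ Ĩ` for all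
`g ∈ V`, `f ∈ Ĩ`, then the class of `r(z)xⁿ` lies in `Ĩ` for every `r ∈ ℂ[z]` and
every `n ≥ 1`. -/
theorem ideal_contains_rzxn (p : ℂ[X])
    (hsp : Squarefree p) (hp2 : 2 ≤ p.natDegree)
    (B : QDan p →ₗ[ℂ] QDan p →ₗ[ℂ] QDan p)
    (hB : ∀ f g : P3, B (cls p f) (cls p g) = cls p (pb p f g))
    (I : Submodule ℂ (QDan p)) (hIV : I ≤ Vsub p) (hI0 : I ≠ ⊥)
    (hIdeal : ∀ g ∈ Vsub p, ∀ f ∈ I, B g f ∈ I) :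
    ∀ r : ℂ[X], ∀ n : ℕ, 1 ≤ n → cls p (Polynomial.aeval zP r * xP ^ n) ∈ I := by
  intro r n hn
  let J : Submodule ℂ P3 := I.comap (Dan.clsL p)
  have hJm : ∀ f, f ∈ J ↔ cls p f ∈ I := fun f => Iff.rfl
  have hgen : ∀ g : P3, cls p g ∈ Vsub p → ∀ f ∈ J, pb p g f ∈ J := by
    intro g hg f hf
    rw [hJm, ← hB]
    exact hIdeal _ hg _ hf
  have hJ : ∀ (r : ℂ[X]) (i : ℕ), ∀ f ∈ J, pb p (Dan.zz r * xP ^ (i+1)) f ∈ J := by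
    intro r i
    refine hgen _ (Dan.cls_zz_mul p _ (fun j => Dan.cls_gen p _ ?_) r)
    exact Or.inl ⟨i+1, j, by omega, rfl⟩
  have hJy : ∀ (r : ℂ[X]), ∀ f ∈ J, pb p (Dan.zz r * yP) f ∈ J := by
    intro r
    refine hgen _ (Dan.cls_zz_mul p _ (fun j => Dan.cls_gen p _ ?_) r)
    exact Or.inr (Or.inl ⟨1, j, le_rfl, by rw [pow_one]⟩)
  have hrel : ∀ f g : P3, Ideal.Quotient.mk (relIdeal p) f = Ideal.Quotient.mk (relIdeal p) g →
      f ∈ J → g ∈ J := by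
    intro f g h hf
    rw [hJm] at hf ⊢
    unfold cls at hf ⊢
    rwa [← h]
  obtain ⟨v, hvI, hv0⟩ := Submodule.exists_mem_ne_zero_of_ne_bot hI0
  obtain ⟨w, hw, rfl⟩ := hIV hvI
  obtain ⟨a, rfl⟩ := Dan.exists_rep p w hw
  have haJ : Dan.rep a ∈ J := hvI
  have ha : ∃ n, a n ≠ 0 ∧ (n = 0 → derivative (a n) ≠ 0) := by
    by_contra hcon
    push Not at hcon
    apply hv0
    have h1 : a = Finsupp.single 0 (a 0) := by
      ext1 m
      rcases eq_or_ne m 0 with rfl | hm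
      · simp
      · rw [Finsupp.single_apply, if_neg (Ne.symm hm)]
        by_contra h
        exact hm (hcon m h).1
    have h2 : derivative (a 0) = 0 := by
      by_cases h : a 0 = 0
      · rw [h]; simp
      · exact (hcon 0 h).2
    have h3 := Dan.const_of_der h2
    rw [h1, Dan.rep_single, h3, Submodule.mkQ_apply, Submodule.Quotient.mk_eq_zero, constSub,
      Submodule.mem_span_singleton]
    refine ⟨(a 0).coeff 0, ?_⟩
    change Ideal.Quotient.mk (relIdeal p) ((a 0).coeff 0 • (1 : P3)) = _
    congr 1
    simp [Dan.zz, Algebra.smul_def]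
  obtain ⟨M, hM, hx⟩ := Dan.lemD p J hp2 hJ hrel a ha haJ
  exact Dan.lemC p J hsp hJ hJy hrel M hM hx r n hn

end
end

section
/- Let p, q ∈ ℂ[z] be polynomials without multiple roots, each of degree at least 2. Let F₁, F₂ : ⟨LND(D_p)⟩ → ⟨LND(D_q)⟩ be isomorphisms of Lie algebras such that F₁(x^i ν_x) = F₂(x^i ν_x) and F₁(y^i ν_y) = F₂(y^i ν_y) for all integers i ≥ 0. Then F₁ = F₂. -/
open Polynomial

set_option synthInstance.maxHeartbeats 400000
set_option maxHeartbeats 800000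

noncomputable section

/-- A derivation is locally nilpotent if some power of it kills each element. -/
def IsLND {p : ℂ[X]} (δ : Derivation ℂ (ODan p) (ODan p)) : Prop :=
  ∀ f : ODan p, ∃ n : ℕ, 1 ≤ n ∧ (δ.toLinearMap ^ n) f = 0

/-- The Lie subalgebra `⟨LND(D_p)⟩` of `Der_ℂ(O(D_p))` generated by all locally
nilpotent derivations. -/
def lndSpan (p : ℂ[X]) : LieSubalgebra ℂ (Derivation ℂ (ODan p) (ODan p)) :=
  LieSubalgebra.lieSpan ℂ _ {δ | IsLND δ}

/-- The lift `p'(z)∂/∂y + x∂/∂z` of `ν_x` to a derivation of `ℂ[x,y,z]`. -/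
def nuxLift (p : ℂ[X]) : Derivation ℂ P3 P3 :=
  MvPolynomial.mkDerivation ℂ ![0, Polynomial.aeval zP (Polynomial.derivative p), xP]

/-- The lift `p'(z)∂/∂x + y∂/∂z` of `ν_y` to a derivation of `ℂ[x,y,z]`. -/
def nuyLift (p : ℂ[X]) : Derivation ℂ P3 P3 :=
  MvPolynomial.mkDerivation ℂ ![Polynomial.aeval zP (Polynomial.derivative p), 0, yP]

/-- Pure polynomial part. -/
theorem poly_part (p : ℂ[X]) (hp : 2 ≤ p.natDegree) (Q : ℕ → Submodule ℂ ℂ[X])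
    (ha : ∀ n, 1 ≤ n → (1 : ℂ[X]) ∈ Q n)
    (hb : ∀ n r, r ∈ Q n → derivative r ∈ Q (n + 1))
    (hc : ∀ n r, r ∈ Q (n + 1) →
      ((n : ℂ) + 1) • (derivative p * r) + p * derivative r ∈ Q n)
    (hd : ∀ i j a b, a ∈ Q j → b ∈ Q i →
      (j : ℂ) • (a * derivative b) - (i : ℂ) • (derivative a * b) ∈ Q (i + j)) (r : ℂ[X]) :
    ∃ N, ∀ n, N ≤ n → r ∈ Q n := by
  have hbi : ∀ k n r, r ∈ Q n → derivative^[k] r ∈ Q (n + k) := by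
    intro k
    induction k with
    | zero => intro n r h; simpa using h
    | succ k ih =>
      intro n r h
      rw [Function.iterate_succ_apply']
      exact hb _ _ (ih n r h)
  obtain ⟨e, he⟩ : ∃ e, p.natDegree = e + 2 := ⟨p.natDegree - 2, by omega⟩
  have hlead : p.coeff (e + 2) ≠ 0 := by
    rw [← he]
    have : p ≠ 0 := by rintro rfl; simp at hp
    simpa using this
  have hbig : ∀ m, e + 2 < m → p.coeff m = 0 := fun m hm =>
    coeff_eq_zero_of_natDegree_lt (by omega)
  have hp1 : ∀ n, derivative p ∈ Q n := by
    intro n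
    have := hc n 1 (ha _ (by omega))
    simp only [derivative_one, mul_zero, add_zero, mul_one] at this
    have hne : (n : ℂ) + 1 ≠ 0 := by exact_mod_cast Nat.succ_ne_zero n
    exact (Submodule.smul_mem_iff _ hne).1 this
  have hX : ∀ n, e + 1 ≤ n → (X : ℂ[X]) ∈ Q n := by
    intro n hn
    obtain ⟨m, rfl⟩ := Nat.exists_eq_add_of_le hn
    have h1 := hbi e (m + 1) _ (hp1 (m + 1))
    have h2 : derivative^[e] (derivative p) =
        ((derivative^[e] (derivative p)).coeff 1) • (X : ℂ[X]) +
        ((derivative^[e] (derivative p)).coeff 0) • (1 : ℂ[X]) := by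
      ext k
      rcases k with _ | _ | k
      · simp
      · simp [coeff_one]
      · simp only [coeff_add, coeff_smul, coeff_X, coeff_one]
        simp [coeff_iterate_derivative, coeff_derivative, hbig (k + 1 + 1 + e + 1) (by omega)]
    have h3 : (derivative^[e] (derivative p)).coeff 1 ≠ 0 := by
      rw [coeff_iterate_derivative, coeff_derivative]
      rw [show 1 + e + 1 = e + 2 by ring]
      have : ((1 + e : ℕ) : ℂ) + 1 ≠ 0 := by exact_mod_cast Nat.succ_ne_zero (1 + e)
      have h4 : (1 + e).descFactorial e ≠ 0 := by
        rw [Ne, Nat.descFactorial_eq_zero_iff_lt]; omega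
      exact smul_ne_zero h4 (mul_ne_zero hlead this)
    rw [h2] at h1
    rw [show m + 1 + e = e + 1 + m by ring] at h1
    have h5 := (Submodule.add_mem_iff_left _ ((Q (e + 1 + m)).smul_mem _ (ha _ (by omega)))).1 h1
    exact (Submodule.smul_mem_iff _ h3).1 h5
  have hX2 : ∀ n, 2 * e + 1 ≤ n → (X ^ 2 : ℂ[X]) ∈ Q n := by
    intro n hn
    obtain ⟨m, rfl⟩ := Nat.exists_eq_add_of_le hn
    set s : ℂ[X] := (((e + 1 + m : ℕ) : ℂ) + 1) • (derivative p * X) + p * derivative X with hs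
    have hsQ : s ∈ Q (e + 1 + m) := hc _ _ (hX _ (by omega))
    have h1 := hbi e _ _ hsQ
    have hsc : ∀ k, s.coeff (k + 1) =
        (((e + 1 + m : ℕ) : ℂ) + 1) * (p.coeff (k + 1) * (k + 1)) + p.coeff (k + 1) := by
      intro k
      simp [hs, coeff_derivative]
    have h2 : derivative^[e] s = ((derivative^[e] s).coeff 2) • (X ^ 2 : ℂ[X]) +
        (((derivative^[e] s).coeff 1) • (X : ℂ[X]) +
        ((derivative^[e] s).coeff 0) • (1 : ℂ[X])) := by
      ext k
      rcases k with _ | _ | _ | k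
      · simp
      · simp [coeff_one, coeff_X_pow]
      · simp [coeff_one, coeff_X]
      · simp only [coeff_add, coeff_smul, coeff_X, coeff_one, coeff_X_pow]
        rw [coeff_iterate_derivative, show k + 1 + 1 + 1 + e = (k + 2 + e) + 1 by ring, hsc,
          hbig (k + 2 + e + 1) (by omega)]
        simp
    have h3 : (derivative^[e] s).coeff 2 ≠ 0 := by
      rw [coeff_iterate_derivative, show 2 + e = (e + 1) + 1 by ring, hsc]
      have h4 : (e + 1 + 1).descFactorial e ≠ 0 := by
        rw [Ne, Nat.descFactorial_eq_zero_iff_lt]; omega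
      refine smul_ne_zero h4 ?_
      have h6 : (((e + 1 + m : ℕ) : ℂ) + 1) * (((e + 1 : ℕ) : ℂ) + 1) + 1 ≠ 0 := by
        exact_mod_cast Nat.succ_ne_zero ((e + 1 + m + 1) * (e + 1 + 1))
      have := mul_ne_zero hlead h6
      intro h
      apply this
      rw [← h]; ring
    rw [h2, show e + 1 + m + e = 2 * e + 1 + m by ring] at h1
    have h5 := (Submodule.add_mem_iff_left _ ((Q (2 * e + 1 + m)).add_mem
      ((Q (2 * e + 1 + m)).smul_mem _ (hX _ (by omega)))
      ((Q (2 * e + 1 + m)).smul_mem _ (ha _ (by omega))))).1 h1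
    exact (Submodule.smul_mem_iff _ h3).1 h5
  have hXk : ∀ k, ∃ N, ∀ n, N ≤ n → (X ^ k : ℂ[X]) ∈ Q n := by
    intro k
    induction k with
    | zero => exact ⟨1, fun n hn => by simpa using ha n hn⟩
    | succ k ih =>
      obtain ⟨N, hN⟩ := ih
      refine ⟨N + (2 * e + 1) * (k + 1) + (2 * e + 1) + 1, fun n hn => ?_⟩
      obtain ⟨i, rfl⟩ := Nat.exists_eq_add_of_le' (show 2 * e + 1 ≤ n by omega)
      have hi : N + (2 * e + 1) * (k + 1) + 1 ≤ i := by omega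
      have h1 := hd i (2 * e + 1) _ _ (hX2 _ le_rfl)
        (hN i (by nlinarith))
      have h2 : ((2 * e + 1 : ℕ) : ℂ) • ((X ^ 2 : ℂ[X]) * derivative (X ^ k)) -
          (i : ℂ) • (derivative (X ^ 2) * (X ^ k : ℂ[X])) =
          (((2 * e + 1 : ℕ) : ℂ) * k - i * 2) • (X ^ (k + 1) : ℂ[X]) := by
        rcases k with _ | k
        · simp [smul_eq_C_mul, map_ofNat C 2]; ring
        · simp only [smul_eq_C_mul, derivative_X_pow]
          simp
          ring
      rw [h2] at h1
      refine (Submodule.smul_mem_iff _ ?_).1 h1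
      rw [sub_ne_zero]
      have : (2 * e + 1) * k ≠ i * 2 := by nlinarith
      exact_mod_cast this
  induction r using Polynomial.induction_on' with
  | add f g hf hg =>
    obtain ⟨N, hN⟩ := hf
    obtain ⟨M, hM⟩ := hg
    exact ⟨N + M, fun n hn => (Q n).add_mem (hN n (by omega)) (hM n (by omega))⟩
  | monomial k c =>
    obtain ⟨N, hN⟩ := hXk k
    refine ⟨N, fun n hn => ?_⟩
    rw [← C_mul_X_pow_eq_monomial, ← smul_eq_C_mul]
    exact (Q n).smul_mem _ (hN n hn)

section abstract_part

variable {A : Type*} [CommRing A] [Algebra ℂ A]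

theorem neg_aux (c : ℂ) (a b : A) : c • (a * -b) = (-c) • (a * b) := by
  rw [mul_neg, smul_neg, neg_smul]

theorem skew_self [IsDomain A] (H : A →ₗ[ℂ] Derivation ℂ A A)
    (hsk : ∀ f g, H f g = - H g f) (f : A) : H f f = 0 := by
  have h := hsk f f
  have h2 : (2 : ℂ) • H f f = 0 := by rw [two_smul]; exact eq_neg_iff_add_eq_zero.1 h
  exact (smul_eq_zero.1 h2).resolve_left two_ne_zero

theorem H_mul (H : A →ₗ[ℂ] Derivation ℂ A A)
    (hsk : ∀ f g, H f g = - H g f) (f g k : A) : H (f * g) k = f * H g k + g * H f k := by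
  rw [hsk, Derivation.leibniz, hsk k f, hsk k g]; simp only [smul_eq_mul]; ring

theorem H_pow (H : A →ₗ[ℂ] Derivation ℂ A A)
    (hsk : ∀ f g, H f g = - H g f) (f k : A) (n : ℕ) :
    H (f ^ n) k = (n : ℂ) • (f ^ (n - 1) * H f k) := by
  rw [hsk, Derivation.leibniz_pow, hsk k f]
  rw [← Nat.cast_smul_eq_nsmul ℂ]
  simp

theorem H_aeval (H : A →ₗ[ℂ] Derivation ℂ A A)
    (hsk : ∀ f g, H f g = - H g f) (z k : A) (r : ℂ[X]) :
    H (aeval z r) k = aeval z (derivative r) * H z k := by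
  rw [hsk, Derivation.map_aeval, hsk k z]
  simp

theorem mem_eventually_poly [IsDomain A] (H : A →ₗ[ℂ] Derivation ℂ A A)
    (hsk : ∀ f g, H f g = - H g f) (x y z : A) (p : ℂ[X]) (hp : 2 ≤ p.natDegree)
    (hrel : x * y = aeval z p) (hxz : H x z = x) (hyz : H y z = - y)
    (hxy : H x y = aeval z (derivative p))
    (S : Submodule ℂ A) (hS : ∀ f g, f ∈ S → g ∈ S → H f g ∈ S)
    (hxS : ∀ n, 1 ≤ n → x ^ n ∈ S) (hyS : y ∈ S) (r : ℂ[X]) :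
    ∃ N, ∀ n, N ≤ n → x ^ n * aeval z r ∈ S := by
  let Q : ℕ → Submodule ℂ ℂ[X] := fun n =>
    S.comap ((LinearMap.mulLeft ℂ (x ^ n)).comp (aeval z).toLinearMap)
  have hQ : ∀ n r, r ∈ Q n ↔ x ^ n * aeval z r ∈ S := fun n r => Iff.rfl
  have hxx := skew_self H hsk x
  have hzz := skew_self H hsk z
  have hyx : H y x = - aeval z (derivative p) := by rw [hsk, hxy]
  have hzx : H z x = - x := by rw [hsk, hxz]
  refine poly_part p hp Q ?_ ?_ ?_ ?_ r
  · intro n hn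
    rw [hQ]; simpa using hxS n hn
  · intro n r hr
    rw [hQ] at hr ⊢
    have h := hS _ _ (by simpa using hxS 1 le_rfl) hr
    convert h using 1
    rw [Derivation.leibniz, Derivation.leibniz_pow, Derivation.map_aeval, hxx, hxz]
    simp; ring
  · intro n r hr
    rw [hQ] at hr ⊢
    have h := S.neg_mem (hS _ _ hyS hr)
    convert h using 1
    rw [Derivation.leibniz, Derivation.leibniz_pow, Derivation.map_aeval, hyx, hyz]
    rw [← Nat.cast_smul_eq_nsmul ℂ]
    simp only [map_add, map_mul, ← hrel, smul_eq_mul, Algebra.smul_def, add_tsub_cancel_right]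
    push_cast
    simp only [map_one, map_natCast]
    ring
  · intro i j a b ha hb
    rw [hQ] at ha hb ⊢
    have h := hS _ _ ha hb
    convert h using 1
    rw [H_mul H hsk, H_pow H hsk, H_aeval H hsk]
    simp only [Derivation.leibniz, Derivation.leibniz_pow, Derivation.map_aeval, hxx, hxz,
      hzx, hzz]
    simp only [← Nat.cast_smul_eq_nsmul ℂ]
    simp only [map_sub, map_mul, smul_eq_mul, Algebra.smul_def, map_natCast]
    rcases i with _ | i <;> rcases j with _ | j <;> simp [pow_succ, pow_add] <;> ring

theorem mem_eventually [IsDomain A] (H : A →ₗ[ℂ] Derivation ℂ A A)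
    (hsk : ∀ f g, H f g = - H g f) (x y z : A) (p : ℂ[X]) (hp : 2 ≤ p.natDegree)
    (hgen : Function.Surjective (MvPolynomial.aeval (R := ℂ) ![x, y, z]))
    (hrel : x * y = aeval z p) (hxz : H x z = x) (hyz : H y z = - y)
    (hxy : H x y = aeval z (derivative p))
    (S : Submodule ℂ A) (hS : ∀ f g, f ∈ S → g ∈ S → H f g ∈ S)
    (hxS : ∀ n, 1 ≤ n → x ^ n ∈ S) (hyS : y ∈ S) (f : A) :
    ∃ N, ∀ n, N ≤ n → x ^ n * f ∈ S := by
  obtain ⟨P, rfl⟩ := hgen f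
  induction P using MvPolynomial.induction_on' with
  | add f g hf hg =>
    obtain ⟨N, hN⟩ := hf
    obtain ⟨M, hM⟩ := hg
    refine ⟨N + M, fun n hn => ?_⟩
    rw [map_add, mul_add]
    exact S.add_mem (hN n (by omega)) (hM n (by omega))
  | monomial u c =>
    obtain ⟨N, hN⟩ := mem_eventually_poly H hsk x y z p hp hrel hxz hyz hxy S hS hxS hyS
      (p ^ (u 1) * X ^ (u 2))
    refine ⟨N + u 1, fun n hn => ?_⟩
    obtain ⟨m, rfl⟩ := Nat.exists_eq_add_of_le hn
    have h := S.smul_mem c (hN (N + m + u 0) (by omega))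
    convert h using 1
    rw [MvPolynomial.aeval_monomial, Finsupp.prod_fintype _ _ (by simp)]
    simp only [Fin.prod_univ_three, map_mul, map_pow, aeval_X, ← hrel, Algebra.smul_def]
    simp
    ring

theorem mem_eventually_swap [IsDomain A] (H : A →ₗ[ℂ] Derivation ℂ A A)
    (hsk : ∀ f g, H f g = - H g f) (x y z : A) (p : ℂ[X]) (hp : 2 ≤ p.natDegree)
    (hgen : Function.Surjective (MvPolynomial.aeval (R := ℂ) ![x, y, z]))
    (hrel : x * y = aeval z p) (hxz : H x z = x) (hyz : H y z = - y)
    (hxy : H x y = aeval z (derivative p))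
    (S : Submodule ℂ A) (hS : ∀ f g, f ∈ S → g ∈ S → H f g ∈ S)
    (hyS : ∀ n, 1 ≤ n → y ^ n ∈ S) (hxS : x ∈ S) (f : A) :
    ∃ N, ∀ n, N ≤ n → y ^ n * f ∈ S := by
  have hyx : H y x = - aeval z (derivative p) := by rw [hsk, hxy]
  have hgen' : Function.Surjective (MvPolynomial.aeval (R := ℂ) ![y, x, z]) := by
    intro f
    obtain ⟨P, rfl⟩ := hgen f
    refine ⟨MvPolynomial.rename (Equiv.swap 0 1) P, ?_⟩
    rw [MvPolynomial.aeval_rename]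
    congr 2
    funext i
    fin_cases i <;> rfl
  exact mem_eventually (-H) (fun f g => by
      rw [LinearMap.neg_apply, LinearMap.neg_apply, Derivation.neg_apply, Derivation.neg_apply,
        hsk f g]) y x z p hp hgen' (by rw [mul_comm, hrel])
    (by rw [LinearMap.neg_apply, Derivation.neg_apply, hyz, neg_neg])
    (by rw [LinearMap.neg_apply, Derivation.neg_apply, hxz])
    (by rw [LinearMap.neg_apply, Derivation.neg_apply, hyx, neg_neg]) S
    (fun f g hf hg => S.neg_mem (hS f g hf hg)) hyS hxS f

theorem der_ext (x y z : A) (hgen : Function.Surjective (MvPolynomial.aeval (R := ℂ) ![x, y, z]))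
    (D E : Derivation ℂ A A) (hx : D x = E x) (hy : D y = E y) (hz : D z = E z) : D = E := by
  apply Derivation.ext_of_adjoin_eq_top (Set.range ![x, y, z])
  · rw [Algebra.adjoin_range_eq_range_aeval]
    exact AlgHom.range_eq_top _ |>.2 hgen
  · rintro _ ⟨i, rfl⟩
    fin_cases i <;> simpa

/-- A derivation compatible with the bracket `H`. -/
def IsPois (H : A →ₗ[ℂ] Derivation ℂ A A) (D : Derivation ℂ A A) : Prop :=
  ∀ g, ⁅D, H g⁆ = H (D g)

theorem exists_div [IsDomain A] (H : A →ₗ[ℂ] Derivation ℂ A A)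
    (hsk : ∀ f g, H f g = - H g f) (x y z : A) (p : ℂ[X]) (hco : IsCoprime p (derivative p))
    (hgen : Function.Surjective (MvPolynomial.aeval (R := ℂ) ![x, y, z])) (hx0 : x ≠ 0)
    (hrel : x * y = aeval z p) (hxz : H x z = x) (hyz : H y z = - y)
    (hxy : H x y = aeval z (derivative p)) (D : Derivation ℂ A A) :
    ∃ h : A, ∀ g, ⁅D, H g⁆ - H (D g) = h • H g := by
  let B : A → Derivation ℂ A A := fun g => ⁅D, H g⁆ - H (D g)
  have hB : ∀ g k, B g k = D (H g k) - H g (D k) - H (D g) k := fun g k => rfl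
  have Bsk : ∀ g k, B g k = - B k g := by
    intro g k
    rw [hB, hB, hsk g k, hsk g (D k), hsk (D g) k, map_neg]; ring
  have Bself : ∀ g, B g g = 0 := by
    intro g
    rw [hB, skew_self H hsk, hsk (D g) g, map_zero]; ring
  have e : ∀ g, x * B g y + y * B g x = aeval z (derivative p) * B g z := by
    intro g
    have := congrArg (B g) hrel
    rwa [Derivation.leibniz, Derivation.map_aeval] at this
  have ex := e x
  have ey := e y
  have ez := e z
  rw [Bself, mul_zero, add_zero] at ex
  rw [Bself, mul_zero, zero_add, Bsk y x] at ey
  rw [Bself, mul_zero, Bsk z y, Bsk z x] at ez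
  obtain ⟨r, s, hrs⟩ := hco
  have hrs' : aeval z r * (x * y) + aeval z s * aeval z (derivative p) = 1 := by
    rw [hrel, ← map_mul, ← map_mul, ← map_add, hrs, map_one]
  set P' := aeval z (derivative p)
  obtain ⟨h, hh⟩ : ∃ h, B x z = x * h :=
    ⟨aeval z r * y * B x z + aeval z s * B x y, by linear_combination (-B x z) * hrs' - (aeval z s) * ex⟩
  have h2 : B x y = P' * h := by
    apply mul_left_cancel₀ hx0
    rw [ex, hh]; ring
  have h3 : B y z = - y * h := by
    apply mul_left_cancel₀ hx0
    linear_combination -ez - y * hh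
  refine ⟨h, ?_⟩
  change ∀ g, B g = h • H g
  have bx : B x = h • H x := by
    refine der_ext x y z hgen _ _ ?_ ?_ ?_
    · simp [Bself, skew_self H hsk]
    · simp [h2, hxy]; ring
    · simp [hh, hxz]; ring
  have bY : B y = h • H y := by
    refine der_ext x y z hgen _ _ ?_ ?_ ?_
    · simp [Bsk y x, h2, hsk y x, hxy]; ring
    · simp [Bself, skew_self H hsk]
    · simp [h3, hyz]; ring
  have bz : B z = h • H z := by
    refine der_ext x y z hgen _ _ ?_ ?_ ?_
    · simp [Bsk z x, hh, hsk z x, hxz]; ring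
    · simp [Bsk z y, h3, hsk z y, hyz]; ring
    · simp [Bself, skew_self H hsk]
  intro g
  refine der_ext x y z hgen _ _ ?_ ?_ ?_
  · rw [Bsk, bx, Derivation.smul_apply, Derivation.smul_apply, hsk g x]; simp
  · rw [Bsk, bY, Derivation.smul_apply, Derivation.smul_apply, hsk g y]; simp
  · rw [Bsk, bz, Derivation.smul_apply, Derivation.smul_apply, hsk g z]; simp

theorem iter_zero_add (D : Derivation ℂ A A) (f : A) (n m : ℕ) (h : D^[n] f = 0) :
    D^[m + n] f = 0 := by
  rw [Function.iterate_add_apply, h]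
  induction m with
  | zero => rfl
  | succ m ih => rw [Function.iterate_succ_apply', ih, map_zero]

theorem iter_add (D : Derivation ℂ A A) (f g : A) (n : ℕ) :
    D^[n] (f + g) = D^[n] f + D^[n] g := by
  induction n with
  | zero => rfl
  | succ n ih => simp only [Function.iterate_succ_apply', ih, map_add]

theorem iter_mul (D : Derivation ℂ A A) (s : ℕ) : ∀ (m k : ℕ) (f g : A), m + k = s →
    D^[m + 1] f = 0 → D^[k + 1] g = 0 →
    D^[m + k] (f * g) = ((m + k).choose m : ℂ) • (D^[m] f * D^[k] g) := by
  induction s with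
  | zero =>
    intro m k f g hs hf hg
    obtain ⟨rfl, rfl⟩ : m = 0 ∧ k = 0 := by omega
    simp
  | succ s ih =>
    intro m k f g hs hf hg
    rw [hs, Function.iterate_succ_apply, Derivation.leibniz, iter_add, smul_eq_mul, smul_eq_mul]
    rcases m with _ | m
    · rcases k with _ | k
      · omega
      · have hf' : D f = 0 := hf
        have h1 := ih 0 k f (D g) (by omega) hf (by rwa [← Function.iterate_succ_apply])
        rw [hf', mul_zero]
        have h0 : D^[s] 0 = 0 := by simp
        rw [h0, add_zero]
        simp only [zero_add] at h1
        obtain rfl : k = s := by omega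
        rw [h1]; simp
    · rcases k with _ | k
      · have hg' : D g = 0 := hg
        have h1 := ih m 0 (D f) g (by omega) (by rwa [← Function.iterate_succ_apply]) hg
        rw [hg', mul_zero]
        have h0 : D^[s] 0 = 0 := by simp
        rw [h0, zero_add]
        simp only [add_zero] at h1
        obtain rfl : m = s := by omega
        rw [mul_comm g, h1]; simp
      · have h1 := ih m (k + 1) (D f) g (by omega) (by rwa [← Function.iterate_succ_apply]) hg
        have h2 := ih (m + 1) k f (D g) (by omega) hf (by rwa [← Function.iterate_succ_apply])
        rw [show m + (k + 1) = s by omega] at h1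
        rw [show m + 1 + k = s by omega] at h2
        rw [mul_comm g, h1, h2, Nat.choose_succ_succ]
        simp only [← Function.iterate_succ_apply]
        push_cast
        rw [← add_smul, add_comm]

theorem exists_last (D : Derivation ℂ A A) (f : A) (hf : f ≠ 0) (h : ∃ n, D^[n] f = 0) :
    ∃ k, D^[k] f ≠ 0 ∧ D^[k + 1] f = 0 := by
  classical
  have h1 := Nat.find_spec h
  have h2 : Nat.find h ≠ 0 := by
    intro h3; rw [h3] at h1; exact hf h1
  obtain ⟨k, hk⟩ := Nat.exists_eq_succ_of_ne_zero h2
  refine ⟨k, Nat.find_min h (by omega), ?_⟩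
  rwa [hk] at h1

theorem lnd_mul_inj [IsDomain A] (D : Derivation ℂ A A) (hD : ∀ f, ∃ n, D^[n] f = 0)
    (h u : A) (hh : h ≠ 0) (hu : D u = h * u) : u = 0 := by
  by_contra hu0
  obtain ⟨k, hk, hk'⟩ := exists_last D u hu0 (hD u)
  obtain ⟨m, hm, hm'⟩ := exists_last D h hh (hD h)
  have h1 := iter_mul D _ m k h u rfl hm' hk'
  rw [← hu, ← Function.iterate_succ_apply, show (m + k).succ = m + (k + 1) by rfl,
    iter_zero_add D u (k + 1) m hk'] at h1
  have := smul_ne_zero (M := A) (r := ((m + k).choose m : ℂ)) (m := D^[m] h * D^[k] u)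
    (by exact_mod_cast (Nat.choose_pos (Nat.le_add_right m k)).ne') (mul_ne_zero hm hk)
  exact this h1.symm

theorem lnd_isPois [IsDomain A] (H : A →ₗ[ℂ] Derivation ℂ A A)
    (hsk : ∀ f g, H f g = - H g f) (x y z : A) (p : ℂ[X]) (hco : IsCoprime p (derivative p))
    (hgen : Function.Surjective (MvPolynomial.aeval (R := ℂ) ![x, y, z])) (hx0 : x ≠ 0)
    (hrel : x * y = aeval z p) (hxz : H x z = x) (hyz : H y z = - y)
    (hxy : H x y = aeval z (derivative p)) (D : Derivation ℂ A A)
    (hD : ∀ f, ∃ n, D^[n] f = 0) : IsPois H D := by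
  obtain ⟨h, hh⟩ := exists_div H hsk x y z p hco hgen hx0 hrel hxz hyz hxy D
  by_cases h0 : h = 0
  · intro g
    have := hh g
    rw [h0, zero_smul] at this
    exact sub_eq_zero.1 this
  exfalso
  let T : A →ₗ[ℂ] A := D.toLinearMap - LinearMap.mulLeft ℂ h
  have hTa : ∀ u, T u = D u - h * u := fun u => rfl
  have hTinj : ∀ u, T u = 0 → u = 0 := fun u hu =>
    lnd_mul_inj D hD h u h0 (sub_eq_zero.1 hu)
  have hT : ∀ g k, T (H g k) = H (D g) k + H g (D k) := by
    intro g k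
    have := congrArg (fun E : Derivation ℂ A A => E k) (hh g)
    simp only [Derivation.sub_apply, Derivation.commutator_apply, Derivation.smul_apply,
      smul_eq_mul] at this
    rw [hTa, ← this]; ring
  have key : ∀ s a b g k, a + b = s → D^[a] g = 0 → D^[b] k = 0 → ∃ n, (T ^ n) (H g k) = 0 := by
    intro s
    induction s with
    | zero =>
      intro a b g k hs hg hk
      obtain ⟨rfl, rfl⟩ : a = 0 ∧ b = 0 := by omega
      have : g = 0 := hg
      exact ⟨0, by simp [this]⟩
    | succ s ih =>
      intro a b g k hs hg hk
      rcases a with _ | a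
      · have : g = 0 := hg
        exact ⟨0, by simp [this]⟩
      rcases b with _ | b
      · have : k = 0 := hk
        exact ⟨0, by simp [this]⟩
      obtain ⟨n, hn⟩ := ih a (b + 1) (D g) k (by omega) hg hk
      obtain ⟨m, hm⟩ := ih (a + 1) b g (D k) (by omega) hg hk
      refine ⟨(n + m) + 1, ?_⟩
      rw [pow_succ, Module.End.mul_apply, hT, map_add]
      have e1 : (T ^ (n + m)) (H (D g) k) = 0 := by
        rw [add_comm, pow_add, Module.End.mul_apply, hn, map_zero]
      have e2 : (T ^ (n + m)) (H g (D k)) = 0 := by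
        rw [pow_add, Module.End.mul_apply, hm, map_zero]
      rw [e1, e2, add_zero]
  obtain ⟨a, ha⟩ := hD x
  obtain ⟨b, hb⟩ := hD z
  obtain ⟨n, hn⟩ := key _ a b x z rfl ha hb
  rw [hxz] at hn
  apply hx0
  clear ha hb
  induction n with
  | zero => simpa using hn
  | succ n ih =>
    rw [pow_succ', Module.End.mul_apply] at hn
    exact ih (hTinj _ hn)

/-- If a Poisson derivation commutes with all large `H (x ^ n)`, it kills `x`. -/
theorem pois_kill [IsDomain A] (H : A →ₗ[ℂ] Derivation ℂ A A)
    (hsk : ∀ f g, H f g = - H g f) (x z : A) (hx0 : x ≠ 0)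
    (hxz : H x z ≠ 0) (D : Derivation ℂ A A) (hD : IsPois H D) (N : ℕ)
    (hc : ∀ n, N ≤ n → ⁅D, H (x ^ n)⁆ = 0) : D x = 0 := by
  have key : ∀ n, N ≤ n + 1 → H (x ^ n * D x) = 0 := by
    intro n hn
    have h1 := hc (n + 1) hn
    rw [hD, Derivation.leibniz_pow, ← Nat.cast_smul_eq_nsmul ℂ, map_smul] at h1
    exact (smul_eq_zero.1 h1).resolve_left (by exact_mod_cast Nat.succ_ne_zero n)
  have h1 := key N (by omega)
  have h2 := congrArg (fun E : Derivation ℂ A A => E z) (key (N + 1) (by omega))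
  rw [pow_succ', mul_assoc, H_mul H hsk, h1] at h2
  simp only [Derivation.zero_apply, mul_zero, zero_add, mul_eq_zero, hxz, or_false] at h2
  exact h2.resolve_left (pow_ne_zero _ hx0)

theorem isPois_zero (H : A →ₗ[ℂ] Derivation ℂ A A) : IsPois H 0 := by
  intro g; rw [zero_lie, Derivation.zero_apply, map_zero]

theorem isPois_add (H : A →ₗ[ℂ] Derivation ℂ A A) (a b : Derivation ℂ A A)
    (ha : IsPois H a) (hb : IsPois H b) : IsPois H (a + b) := by
  intro g; rw [add_lie, ha, hb, Derivation.add_apply, map_add]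

theorem isPois_smul (H : A →ₗ[ℂ] Derivation ℂ A A) (c : ℂ) (a : Derivation ℂ A A)
    (ha : IsPois H a) : IsPois H (c • a) := by
  intro g; rw [smul_lie, ha, Derivation.smul_apply, map_smul]

theorem isPois_lie (H : A →ₗ[ℂ] Derivation ℂ A A) (a b : Derivation ℂ A A)
    (ha : IsPois H a) (hb : IsPois H b) : IsPois H ⁅a, b⁆ := by
  intro g
  rw [lie_lie, hb, ha, ha, hb, Derivation.commutator_apply, map_sub]

end abstract_part

theorem dan_prime (p : ℂ[X]) (hp2 : 2 ≤ p.natDegree) : (relIdeal p).IsPrime := by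
  have hp0 : p ≠ 0 := by rintro rfl; simp at hp2
  have hvars : (1 : Fin 3) ∉ (-(Polynomial.aeval zP p)).vars := by
    rw [MvPolynomial.vars_neg]
    have h1 : Polynomial.aeval zP p ∈ MvPolynomial.supported ℂ ({2} : Set (Fin 3)) := by
      have h2 : zP ∈ MvPolynomial.supported ℂ ({2} : Set (Fin 3)) :=
        MvPolynomial.X_mem_supported.2 rfl
      exact Algebra.adjoin_le (Set.singleton_subset_iff.2 h2)
        (Polynomial.aeval_mem_adjoin_singleton ℂ zP)
    rw [MvPolynomial.mem_supported] at h1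
    intro h
    have := h1 h
    simp at this
  have hirr : Irreducible (xP * yP - Polynomial.aeval zP p) := by
    rw [sub_eq_add_neg]
    refine MvPolynomial.irreducible_mul_X_add xP _ 1 (MvPolynomial.X_ne_zero _) ?_ hvars ?_
    · simp [xP, MvPolynomial.vars_X]
    · have hX : Irreducible xP := (MvPolynomial.X_prime).irreducible
      rw [hX.isRelPrime_iff_not_dvd, dvd_neg]
      rintro ⟨s, hs⟩
      obtain ⟨c, hc⟩ : ∃ c, p.eval c ≠ 0 := by
        by_contra! h
        exact hp0 (Polynomial.funext (by simpa using h))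
      apply hc
      have := congrArg (MvPolynomial.aeval (R := ℂ) ![(0 : ℂ), 0, c]) hs
      rw [← Polynomial.aeval_algHom_apply] at this
      simpa [xP, zP] using this
  have hpr : Prime (xP * yP - Polynomial.aeval zP p) := hirr.prime
  exact (Ideal.span_singleton_prime hpr.ne_zero).2 hpr

theorem dan_ne_zero (p : ℂ[X]) (f : P3) (a b c : ℂ) (hab : a * b = p.eval c)
    (hf : MvPolynomial.aeval (R := ℂ) ![a, b, c] f ≠ 0) : Ideal.Quotient.mk (relIdeal p) f ≠ 0 := by
  intro h
  rw [Ideal.Quotient.eq_zero_iff_mem, relIdeal, Ideal.mem_span_singleton] at h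
  obtain ⟨s, rfl⟩ := h
  apply hf
  rw [map_mul, map_sub, ← Polynomial.aeval_algHom_apply]
  simp [xP, yP, zP, hab]

/-- Lift a derivation given by its values on generators. -/
theorem dan_lift (p : ℂ[X]) (a b c : ODan p)
    (h : Ideal.Quotient.mk (relIdeal p) xP * b + Ideal.Quotient.mk (relIdeal p) yP * a =
      Ideal.Quotient.mk (relIdeal p) (Polynomial.aeval zP (derivative p)) * c) :
    ∃ D : Derivation ℂ (ODan p) (ODan p), D (Ideal.Quotient.mk (relIdeal p) xP) = a ∧
      D (Ideal.Quotient.mk (relIdeal p) yP) = b ∧ D (Ideal.Quotient.mk (relIdeal p) zP) = c := by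
  obtain ⟨a, rfl⟩ := Ideal.Quotient.mk_surjective a
  obtain ⟨b, rfl⟩ := Ideal.Quotient.mk_surjective b
  obtain ⟨c, rfl⟩ := Ideal.Quotient.mk_surjective c
  let d : Derivation ℂ P3 P3 := MvPolynomial.mkDerivation ℂ ![a, b, c]
  have dx : d xP = a := MvPolynomial.mkDerivation_X _ _ _
  have dy : d yP = b := MvPolynomial.mkDerivation_X _ _ _
  have dz : d zP = c := MvPolynomial.mkDerivation_X _ _ _
  have hd : ∀ f, Ideal.Quotient.mkₐ ℂ (relIdeal p) f = 0 →
      Ideal.Quotient.mkₐ ℂ (relIdeal p) (d f) = 0 := by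
    intro f hf
    rw [Ideal.Quotient.mkₐ_eq_mk, Ideal.Quotient.eq_zero_iff_mem, relIdeal,
      Ideal.mem_span_singleton] at hf
    obtain ⟨s, rfl⟩ := hf
    have h0 : Ideal.Quotient.mk (relIdeal p) (xP * yP - Polynomial.aeval zP p) = 0 := by
      rw [Ideal.Quotient.eq_zero_iff_mem, relIdeal]
      exact Ideal.mem_span_singleton_self _
    rw [Ideal.Quotient.mkₐ_eq_mk, Derivation.leibniz, smul_eq_mul, smul_eq_mul, map_add, map_mul,
      h0, zero_mul, zero_add, map_mul, map_sub, Derivation.leibniz, Derivation.map_aeval, dx, dy,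
      dz]
    simp only [smul_eq_mul, map_sub, map_add, map_mul]
    rw [h, sub_self, mul_zero]
  have hs : Function.Surjective (Ideal.Quotient.mkₐ ℂ (relIdeal p)) :=
    Ideal.Quotient.mkₐ_surjective _ _
  have happ := fun f => Derivation.liftOfSurjective_apply hs hd f
  refine ⟨Derivation.liftOfSurjective hs hd, ?_, ?_, ?_⟩
  · have := happ xP; rwa [dx] at this
  · have := happ yP; rwa [dy] at this
  · have := happ zP; rwa [dz] at this

theorem dan_gen (p : ℂ[X]) : Function.Surjective (MvPolynomial.aeval (R := ℂ)
    ![Ideal.Quotient.mk (relIdeal p) xP, Ideal.Quotient.mk (relIdeal p) yP,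
      Ideal.Quotient.mk (relIdeal p) zP]) := by
  have : MvPolynomial.aeval (R := ℂ)
    ![Ideal.Quotient.mk (relIdeal p) xP, Ideal.Quotient.mk (relIdeal p) yP,
      Ideal.Quotient.mk (relIdeal p) zP] = Ideal.Quotient.mkₐ ℂ (relIdeal p) := by
    apply MvPolynomial.algHom_ext
    intro i
    rw [MvPolynomial.aeval_X]
    fin_cases i <;> rfl
  rw [this]
  exact Ideal.Quotient.mkₐ_surjective _ _

/-- The Poisson bracket. -/
theorem dan_bracket (p : ℂ[X]) (νx νy : Derivation ℂ (ODan p) (ODan p)) (x y z P' : ODan p)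
    (hx : x = Ideal.Quotient.mk (relIdeal p) xP) (hy : y = Ideal.Quotient.mk (relIdeal p) yP)
    (hz : z = Ideal.Quotient.mk (relIdeal p) zP)
    (hP' : P' = Ideal.Quotient.mk (relIdeal p) (Polynomial.aeval zP (derivative p)))
    (xx : νx x = 0) (xy : νx y = P') (xz : νx z = x)
    (yx : νy x = P') (yy : νy y = 0) (yz : νy z = y) :
    ∃ H : ODan p →ₗ[ℂ] Derivation ℂ (ODan p) (ODan p), (∀ f g, H f g = - H g f) ∧
      H x = νx ∧ H y = - νy ∧ H x z = x ∧ H y z = - y ∧ H x y = P' := by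
  have hgen := dan_gen p
  rw [← hx, ← hy, ← hz] at hgen
  have lift := dan_lift p
  rw [← hx, ← hy, ← hz, ← hP'] at lift
  clear hx hy hz hP'
  have ext := der_ext x y z hgen
  obtain ⟨νz, zx, zy, zz⟩ := lift x (-y) 0 (by ring)
  have hid : x • νy = y • νx + P' • νz := by
    apply ext <;> simp [*] <;> ring
  have hid' : ∀ f, x * νy f + y * (- νx f) = P' * νz f := by
    intro f
    have := congrArg (fun E : Derivation ℂ (ODan p) (ODan p) => E f) hid
    simp only [Derivation.smul_apply, Derivation.add_apply, smul_eq_mul] at this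
    rw [this]; ring
  choose H h1 h2 h3 using fun f => lift (- νx f) (νy f) (νz f) (hid' f)
  have hadd : ∀ f g, H (f + g) = H f + H g := by
    intro f g
    apply ext <;> simp [h1, h2, h3] <;> ring
  have hsmul : ∀ (c : ℂ) f, H (c • f) = c • H f := by
    intro c f
    apply ext <;> simp [h1, h2, h3]
  have hmul : ∀ f g, H (f * g) = f • H g + g • H f := by
    intro f g
    apply ext <;> simp [h1, h2, h3] <;> ring
  have Hx : H x = νx := by apply ext <;> simp [*]
  have Hy : H y = - νy := by apply ext <;> simp [*]
  have Hz : H z = - νz := by apply ext <;> simp [*]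
  refine ⟨⟨⟨H, hadd⟩, hsmul⟩, ?_, Hx, Hy, ?_, ?_, ?_⟩
  · intro f g
    change H f g = - H g f
    let K : Derivation ℂ (ODan p) (ODan p) := Derivation.mk'
      { toFun := fun f => H f g
        map_add' := fun a b => by rw [hadd]; rfl
        map_smul' := fun c a => by rw [hsmul]; rfl }
      (fun a b => by
        change H (a * b) g = a • H b g + b • H a g
        rw [hmul]; rfl)
    have hK : ∀ f, K f = H f g := fun f => rfl
    have : K = - H g := by
      apply ext <;> simp [hK, Hx, Hy, Hz, h1, h2, h3]
    rw [← hK, this]; rfl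
  · change H x z = x
    rw [Hx, xz]
  · change H y z = -y
    rw [Hy, Derivation.neg_apply, yz]
  · change H x y = P'
    rw [Hx, xy]

/-- Let `p, q` be squarefree of degree at least `2`, and let `ν_x`, `ν_y` be the
derivations of `O(D_p)` induced by `p'(z)∂/∂y + x∂/∂z` and `p'(z)∂/∂x + y∂/∂z` (the
derivations `xⁱν_x` and `yⁱν_y` are locally nilpotent, hence lie in `⟨LND(D_p)⟩`).
If two Lie algebra isomorphisms `F₁, F₂ : ⟨LND(D_p)⟩ → ⟨LND(D_q)⟩` satisfy
`F₁(xⁱν_x) = F₂(xⁱν_x)` and `F₁(yⁱν_y) = F₂(yⁱν_y)` for all `i ≥ 0`, then `F₁ = F₂`. -/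
theorem lnd_equiv_determined_by_generators (p q : ℂ[X])
    (hsp : Squarefree p) (hsq : Squarefree q)
    (hp2 : 2 ≤ p.natDegree) (hq2 : 2 ≤ q.natDegree)
    (νx νy : Derivation ℂ (ODan p) (ODan p))
    (hνx : ∀ f : P3, νx (Ideal.Quotient.mk (relIdeal p) f) =
      Ideal.Quotient.mk (relIdeal p) (nuxLift p f))
    (hνy : ∀ f : P3, νy (Ideal.Quotient.mk (relIdeal p) f) =
      Ideal.Quotient.mk (relIdeal p) (nuyLift p f))
    (hmx : ∀ i : ℕ, (Ideal.Quotient.mk (relIdeal p) (xP ^ i)) • νx ∈ lndSpan p)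
    (hmy : ∀ i : ℕ, (Ideal.Quotient.mk (relIdeal p) (yP ^ i)) • νy ∈ lndSpan p)
    (F₁ F₂ : lndSpan p ≃ₗ⁅ℂ⁆ lndSpan q)
    (hx : ∀ i : ℕ, F₁ ⟨(Ideal.Quotient.mk (relIdeal p) (xP ^ i)) • νx, hmx i⟩ =
      F₂ ⟨(Ideal.Quotient.mk (relIdeal p) (xP ^ i)) • νx, hmx i⟩)
    (hy : ∀ i : ℕ, F₁ ⟨(Ideal.Quotient.mk (relIdeal p) (yP ^ i)) • νy, hmy i⟩ =
      F₂ ⟨(Ideal.Quotient.mk (relIdeal p) (yP ^ i)) • νy, hmy i⟩) :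
    F₁ = F₂ := by
  have hprime := dan_prime p hp2
  have : IsDomain (ODan p) := Ideal.Quotient.isDomain _
  set x : ODan p := Ideal.Quotient.mk (relIdeal p) xP with hxd
  set y : ODan p := Ideal.Quotient.mk (relIdeal p) yP with hyd
  set z : ODan p := Ideal.Quotient.mk (relIdeal p) zP with hzd
  have hae : ∀ r : ℂ[X], Ideal.Quotient.mk (relIdeal p) (Polynomial.aeval zP r) =
      Polynomial.aeval z r := fun r =>
    (Polynomial.aeval_algHom_apply (Ideal.Quotient.mkₐ ℂ (relIdeal p)) zP r).symm
  have hgen : Function.Surjective (MvPolynomial.aeval (R := ℂ) ![x, y, z]) := dan_gen p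
  have hrel : x * y = Polynomial.aeval z p := by
    rw [← hae, hxd, hyd, ← map_mul, Ideal.Quotient.eq, relIdeal]
    exact Ideal.mem_span_singleton_self _
  have xx : νx x = 0 := by
    rw [hxd, hνx, nuxLift, xP, MvPolynomial.mkDerivation_X]; simp
  have xy : νx y = Polynomial.aeval z (derivative p) := by
    rw [hyd, hνx, nuxLift, yP, MvPolynomial.mkDerivation_X, ← hae]; rfl
  have xz : νx z = x := by
    rw [hzd, hνx, nuxLift, zP, MvPolynomial.mkDerivation_X]; rfl
  have yx : νy x = Polynomial.aeval z (derivative p) := by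
    rw [hxd, hνy, nuyLift, xP, MvPolynomial.mkDerivation_X, ← hae]; rfl
  have yy : νy y = 0 := by
    rw [hyd, hνy, nuyLift, yP, MvPolynomial.mkDerivation_X]; simp
  have yz : νy z = y := by
    rw [hzd, hνy, nuyLift, zP, MvPolynomial.mkDerivation_X]; rfl
  obtain ⟨H, hsk, Hx, Hy, hxz, hyz, hxy⟩ := dan_bracket p νx νy x y z _ hxd hyd hzd
    (hae _).symm xx xy xz yx yy yz
  have hx0 : x ≠ 0 := dan_ne_zero p xP 1 (p.eval 0) 0 (by simp) (by simp [xP])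
  have hy0 : y ≠ 0 := dan_ne_zero p yP (p.eval 0) 1 0 (by simp) (by simp [yP])
  have hdp0 : derivative p ≠ 0 := by
    intro h
    have := Polynomial.derivative_eq_zero.1 h
    omega
  have hP0 : Polynomial.aeval z (derivative p) ≠ 0 := by
    obtain ⟨c, hc⟩ : ∃ c, (derivative p).eval c ≠ 0 := by
      by_contra! h
      exact hdp0 (Polynomial.funext (by simpa using h))
    rw [← hae]
    refine dan_ne_zero p _ 1 (p.eval c) c (by simp) ?_
    rw [← Polynomial.aeval_algHom_apply]
    simpa [zP] using hc
  have hco : IsCoprime p (derivative p) := PerfectField.separable_iff_squarefree.2 hsp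
  -- everything in the span is Poisson
  have hpois : ∀ D ∈ lndSpan p, IsPois H D := by
    intro D hD
    induction hD using LieSubalgebra.lieSpan_induction with
    | mem D hD =>
      refine lnd_isPois H hsk x y z p hco hgen hx0 hrel hxz hyz hxy D (fun f => ?_)
      obtain ⟨n, -, hn⟩ := hD f
      refine ⟨n, ?_⟩
      rw [Module.End.pow_apply] at hn
      exact hn
    | zero => exact isPois_zero H
    | add a b _ _ ha hb => exact isPois_add H a b ha hb
    | smul c a _ ha => exact isPois_smul H c a ha
    | lie a b _ _ ha hb => exact isPois_lie H a b ha hb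
  -- the equalizer
  let S : Submodule ℂ (ODan p) :=
    { carrier := {f | ∃ h : H f ∈ lndSpan p, F₁ ⟨H f, h⟩ = F₂ ⟨H f, h⟩}
      zero_mem' := by
        have h0 : H 0 ∈ lndSpan p := by rw [map_zero]; exact (lndSpan p).zero_mem
        refine ⟨h0, ?_⟩
        have : (⟨H 0, h0⟩ : lndSpan p) = 0 := Subtype.ext (map_zero H)
        rw [this, map_zero, map_zero]
      add_mem' := by
        rintro a b ⟨ha, ea⟩ ⟨hb, eb⟩
        have h0 : H (a + b) ∈ lndSpan p := by rw [map_add]; exact (lndSpan p).add_mem ha hb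
        refine ⟨h0, ?_⟩
        have : (⟨H (a + b), h0⟩ : lndSpan p) = ⟨H a, ha⟩ + ⟨H b, hb⟩ := Subtype.ext (map_add H a b)
        rw [this, map_add, map_add, ea, eb]
      smul_mem' := by
        rintro c a ⟨ha, ea⟩
        have h0 : H (c • a) ∈ lndSpan p := by rw [map_smul]; exact (lndSpan p).smul_mem c ha
        refine ⟨h0, ?_⟩
        have : (⟨H (c • a), h0⟩ : lndSpan p) = c • ⟨H a, ha⟩ := Subtype.ext (map_smul H c a)
        rw [this, map_smul, map_smul, ea] }
  have hSm : ∀ f, f ∈ S ↔ ∃ h : H f ∈ lndSpan p, F₁ ⟨H f, h⟩ = F₂ ⟨H f, h⟩ := fun f => Iff.rfl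
  have hSb : ∀ f g, f ∈ S → g ∈ S → H f g ∈ S := by
    rintro f g ⟨hf, ef⟩ ⟨hg, eg⟩
    have h1 : H (H f g) = ⁅H f, H g⁆ := (hpois _ hf g).symm
    have h0 : H (H f g) ∈ lndSpan p := by rw [h1]; exact (lndSpan p).lie_mem hf hg
    refine ⟨h0, ?_⟩
    have : (⟨H (H f g), h0⟩ : lndSpan p) = ⁅(⟨H f, hf⟩ : lndSpan p), (⟨H g, hg⟩ : lndSpan p)⁆ :=
      Subtype.ext h1
    rw [this, LieEquiv.map_lie, LieEquiv.map_lie, ef, eg]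
  have hSof : ∀ (f : ODan p) (c : ℂ) (D : lndSpan p), F₁ D = F₂ D → H f = c • D.1 → f ∈ S := by
    intro f c D hD hf
    have h0 : H f ∈ lndSpan p := by rw [hf]; exact (lndSpan p).smul_mem c D.2
    refine ⟨h0, ?_⟩
    have : (⟨H f, h0⟩ : lndSpan p) = c • D := Subtype.ext hf
    rw [this, map_smul, map_smul, hD]
  have hxS : ∀ n, 1 ≤ n → x ^ n ∈ S := by
    intro n hn
    refine hSof _ (n : ℂ) _ (hx (n - 1)) ?_
    ext g
    rw [H_pow H hsk, Hx]
    change _ = (n : ℂ) • (Ideal.Quotient.mk (relIdeal p) (xP ^ (n - 1)) * νx g)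
    rw [map_pow]
  have hyS : ∀ n, 1 ≤ n → y ^ n ∈ S := by
    intro n hn
    refine hSof _ (-(n : ℂ)) _ (hy (n - 1)) ?_
    ext g
    rw [H_pow H hsk, Hy]
    change _ = (-(n : ℂ)) • (Ideal.Quotient.mk (relIdeal p) (yP ^ (n - 1)) * νy g)
    rw [map_pow, Derivation.neg_apply]
    exact neg_aux _ _ _
  have hyx : H y x = - Polynomial.aeval z (derivative p) := by rw [hsk, hxy]
  have evx := mem_eventually H hsk x y z p hp2 hgen hrel hxz hyz hxy S hSb hxS
    (by simpa using hyS 1 le_rfl)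
  have evy := mem_eventually_swap H hsk x y z p hp2 hgen hrel hxz hyz hxy S hSb hyS
    (by simpa using hxS 1 le_rfl)
  -- conclude
  have main : ∀ v : lndSpan p, F₁ v = F₂ v := by
    intro v
    set w : lndSpan p := F₁.symm (F₁ v - F₂ v) with hw
    have hwp : IsPois H w.1 := hpois _ w.2
    have hvp : IsPois H v.1 := hpois _ v.2
    have comm : ∀ f, f ∈ S → v.1 f ∈ S → ⁅w.1, H f⁆ = 0 := by
      rintro f ⟨hf, ef⟩ ⟨hg, eg⟩
      have e1 : (⟨H (v.1 f), hg⟩ : lndSpan p) = ⁅v, (⟨H f, hf⟩ : lndSpan p)⁆ :=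
        Subtype.ext (hvp f).symm
      rw [e1, LieEquiv.map_lie, LieEquiv.map_lie, ← ef] at eg
      have e2 : ⁅w, (⟨H f, hf⟩ : lndSpan p)⁆ = 0 := by
        apply F₁.injective
        change F₁ ⁅w, (⟨H f, hf⟩ : lndSpan p)⁆ = F₁ 0
        rw [LieEquiv.map_lie, map_zero, hw, LieEquiv.apply_symm_apply, sub_lie, eg, sub_self]
      exact congrArg Subtype.val e2
    have evcomm : ∀ t : ODan p, (∀ n, 1 ≤ n → t ^ n ∈ S) →
        (∀ f, ∃ N, ∀ n, N ≤ n → t ^ n * f ∈ S) →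
        ∃ N, ∀ n, N ≤ n → ⁅w.1, H (t ^ n)⁆ = 0 := by
      intro t ht ev
      obtain ⟨N, hN⟩ := ev (v.1 t)
      refine ⟨N + 1, fun n hn => comm _ (ht n (by omega)) ?_⟩
      rw [Derivation.leibniz_pow, ← Nat.cast_smul_eq_nsmul ℂ]
      exact S.smul_mem _ (hN (n - 1) (by omega))
    obtain ⟨N, hN⟩ := evcomm x hxS evx
    obtain ⟨M, hM⟩ := evcomm y hyS evy
    have wx := pois_kill H hsk x z hx0 (by rw [hxz]; exact hx0) w.1 hwp N hN
    have wy := pois_kill H hsk y z hy0 (by rw [hyz]; exact neg_ne_zero.2 hy0) w.1 hwp M hM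
    have wz : w.1 z = 0 := by
      have := congrArg w.1 hrel
      rw [Derivation.leibniz, Derivation.map_aeval, wx, wy, smul_zero, smul_zero, add_zero,
        smul_eq_mul] at this
      exact (mul_eq_zero.1 this.symm).resolve_left hP0
    have w0 : w = 0 := Subtype.ext (der_ext x y z hgen _ _ wx wy wz)
    rw [hw] at w0
    have := congrArg F₁ w0
    rw [LieEquiv.apply_symm_apply, map_zero] at this
    exact sub_eq_zero.1 this
  exact DFunLike.ext _ _ main

end
end

section
/- Let p, q ∈ ℂ[z] be polynomials without multiple roots with 2 ≤ deg p ≤ deg q and deg q ≥ 3. Let F₁, F₂ : Ve⁰(D_p) → Ve⁰(D_q) be isomorphisms of Lie algebras whose restrictions to ⟨LND(D_p)⟩ coincide. Then F₁ = F₂. -/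
open Polynomial

set_option synthInstance.maxHeartbeats 400000
set_option maxHeartbeats 800000

noncomputable section

/-- `Ve⁰(D_p)`: the divergence-zero vector fields on `D_p`, i.e. those derivations of
`O(D_p)` admitting a lift `δ' = ã∂/∂x + b̃∂/∂y + c̃∂/∂z ∈ Der_ℂ(ℂ[x,y,z])` with
`δ'(xy - p(z)) = 0` and `∂ã/∂x + ∂b̃/∂y + ∂c̃/∂z ∈ (xy - p(z))`. -/
def VeZero (p : ℂ[X]) : Set (Derivation ℂ (ODan p) (ODan p)) :=
  {δ | ∃ δ' : Derivation ℂ P3 P3,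
    δ' (xP * yP - Polynomial.aeval zP p) = 0 ∧
    (∀ f : P3, δ (Ideal.Quotient.mk (relIdeal p) f) = Ideal.Quotient.mk (relIdeal p) (δ' f)) ∧
    MvPolynomial.pderiv (0 : Fin 3) (δ' xP) + MvPolynomial.pderiv (1 : Fin 3) (δ' yP) +
      MvPolynomial.pderiv (2 : Fin 3) (δ' zP) ∈ relIdeal p}

open MvPolynomial in
theorem pd_comm (i j : Fin 3) (f : P3) : pderiv i (pderiv j f) = pderiv j (pderiv i f) := by
  have h : ⁅(pderiv i : Derivation ℂ P3 P3), (pderiv j : Derivation ℂ P3 P3)⁆ = 0 := by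
    apply MvPolynomial.derivation_ext
    intro k
    simp only [Derivation.commutator_apply, pderiv_X, Pi.single_apply, Derivation.coe_zero,
      Pi.zero_apply]
    split_ifs <;> simp
  have := congrArg (fun D => D f) h
  simpa [Derivation.commutator_apply, sub_eq_zero] using this

theorem der_formula (D : Derivation ℂ P3 P3) (f : P3) :
    D f = D xP * MvPolynomial.pderiv 0 f + D yP * MvPolynomial.pderiv 1 f
      + D zP * MvPolynomial.pderiv 2 f := by
  have h : D = D xP • (MvPolynomial.pderiv 0 : Derivation ℂ P3 P3)
      + D yP • (MvPolynomial.pderiv 1 : Derivation ℂ P3 P3)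
      + D zP • (MvPolynomial.pderiv 2 : Derivation ℂ P3 P3) := by
    apply MvPolynomial.derivation_ext
    intro k
    fin_cases k <;> simp [xP, yP, zP, MvPolynomial.pderiv_X]
  have := congrArg (fun D => D f) h
  simpa using this

/-- The defining polynomial. -/
def relP (p : ℂ[X]) : P3 := xP * yP - Polynomial.aeval zP p

theorem pd_aeval (i : Fin 3) (g : ℂ[X]) : MvPolynomial.pderiv i (Polynomial.aeval zP g) =
    Polynomial.aeval zP (Polynomial.derivative g) * MvPolynomial.pderiv i zP := by
  rw [Derivation.map_aeval, smul_eq_mul]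

theorem pd0x : MvPolynomial.pderiv (0 : Fin 3) xP = 1 := by simp [xP]
theorem pd1x : MvPolynomial.pderiv (1 : Fin 3) xP = 0 := by simp [xP, MvPolynomial.pderiv_X]
theorem pd2x : MvPolynomial.pderiv (2 : Fin 3) xP = 0 := by simp [xP, MvPolynomial.pderiv_X]
theorem pd0y : MvPolynomial.pderiv (0 : Fin 3) yP = 0 := by simp [yP, MvPolynomial.pderiv_X]
theorem pd1y : MvPolynomial.pderiv (1 : Fin 3) yP = 1 := by simp [yP]
theorem pd2y : MvPolynomial.pderiv (2 : Fin 3) yP = 0 := by simp [yP, MvPolynomial.pderiv_X]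
theorem pd0z : MvPolynomial.pderiv (0 : Fin 3) zP = 0 := by simp [zP, MvPolynomial.pderiv_X]
theorem pd1z : MvPolynomial.pderiv (1 : Fin 3) zP = 0 := by simp [zP, MvPolynomial.pderiv_X]
theorem pd2z : MvPolynomial.pderiv (2 : Fin 3) zP = 1 := by simp [zP]

theorem pd0P (p : ℂ[X]) : MvPolynomial.pderiv (0 : Fin 3) (relP p) = yP := by
  simp [relP, pd0x, pd0y, pd0z]
theorem pd1P (p : ℂ[X]) : MvPolynomial.pderiv (1 : Fin 3) (relP p) = xP := by
  simp [relP, pd1x, pd1y, pd1z]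
theorem pd2P (p : ℂ[X]) : MvPolynomial.pderiv (2 : Fin 3) (relP p) =
    - Polynomial.aeval zP (Polynomial.derivative p) := by
  simp [relP, pd2x, pd2y, pd2z]

/-- Hamiltonian derivation of `ℂ[x,y,z]`, `g ↦ det ∂(f,g,P)/∂(x,y,z)`. -/
def HamP (p : ℂ[X]) (f : P3) : Derivation ℂ P3 P3 :=
  (MvPolynomial.pderiv 2 f * MvPolynomial.pderiv 1 (relP p)
    - MvPolynomial.pderiv 1 f * MvPolynomial.pderiv 2 (relP p)) •
      (MvPolynomial.pderiv 0 : Derivation ℂ P3 P3)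
  + (MvPolynomial.pderiv 0 f * MvPolynomial.pderiv 2 (relP p)
    - MvPolynomial.pderiv 2 f * MvPolynomial.pderiv 0 (relP p)) •
      (MvPolynomial.pderiv 1 : Derivation ℂ P3 P3)
  + (MvPolynomial.pderiv 1 f * MvPolynomial.pderiv 0 (relP p)
    - MvPolynomial.pderiv 0 f * MvPolynomial.pderiv 1 (relP p)) •
      (MvPolynomial.pderiv 2 : Derivation ℂ P3 P3)

theorem HamP_apply (p : ℂ[X]) (f g : P3) : HamP p f g =
  (MvPolynomial.pderiv 2 f * MvPolynomial.pderiv 1 (relP p)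
    - MvPolynomial.pderiv 1 f * MvPolynomial.pderiv 2 (relP p)) * MvPolynomial.pderiv 0 g
  + (MvPolynomial.pderiv 0 f * MvPolynomial.pderiv 2 (relP p)
    - MvPolynomial.pderiv 2 f * MvPolynomial.pderiv 0 (relP p)) * MvPolynomial.pderiv 1 g
  + (MvPolynomial.pderiv 1 f * MvPolynomial.pderiv 0 (relP p)
    - MvPolynomial.pderiv 0 f * MvPolynomial.pderiv 1 (relP p)) * MvPolynomial.pderiv 2 g := by
  simp [HamP]

theorem HamP_relP (p : ℂ[X]) (f : P3) : HamP p f (relP p) = 0 := by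
  rw [HamP_apply]; ring

theorem HamP_x (p : ℂ[X]) (f : P3) : HamP p f xP =
  (MvPolynomial.pderiv 2 f * MvPolynomial.pderiv 1 (relP p)
    - MvPolynomial.pderiv 1 f * MvPolynomial.pderiv 2 (relP p)) := by
  rw [HamP_apply, pd0x, pd1x, pd2x]; ring
theorem HamP_y (p : ℂ[X]) (f : P3) : HamP p f yP =
  (MvPolynomial.pderiv 0 f * MvPolynomial.pderiv 2 (relP p)
    - MvPolynomial.pderiv 2 f * MvPolynomial.pderiv 0 (relP p)) := by
  rw [HamP_apply, pd0y, pd1y, pd2y]; ring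
theorem HamP_z (p : ℂ[X]) (f : P3) : HamP p f zP =
  (MvPolynomial.pderiv 1 f * MvPolynomial.pderiv 0 (relP p)
    - MvPolynomial.pderiv 0 f * MvPolynomial.pderiv 1 (relP p)) := by
  rw [HamP_apply, pd0z, pd1z, pd2z]; ring

theorem HamP_div (p : ℂ[X]) (f : P3) :
    MvPolynomial.pderiv (0 : Fin 3) (HamP p f xP) + MvPolynomial.pderiv (1 : Fin 3) (HamP p f yP) +
      MvPolynomial.pderiv (2 : Fin 3) (HamP p f zP) = 0 := by
  rw [HamP_x, HamP_y, HamP_z]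
  simp only [map_sub, MvPolynomial.pderiv_mul]
  rw [pd_comm 1 0 f, pd_comm 2 0 f, pd_comm 2 1 f, pd_comm 1 0 (relP p), pd_comm 2 0 (relP p),
    pd_comm 2 1 (relP p)]
  ring

theorem HamP_poisson (p : ℂ[X]) (D : Derivation ℂ P3 P3) (hD : D (relP p) = 0) (f g : P3) :
    D (HamP p f g) = HamP p (D f) g + HamP p f (D g)
      - (MvPolynomial.pderiv (0 : Fin 3) (D xP) + MvPolynomial.pderiv (1 : Fin 3) (D yP) +
      MvPolynomial.pderiv (2 : Fin 3) (D zP)) * HamP p f g := by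
  have h0 := congrArg (MvPolynomial.pderiv (0 : Fin 3)) hD
  have h1 := congrArg (MvPolynomial.pderiv (1 : Fin 3)) hD
  have h2 := congrArg (MvPolynomial.pderiv (2 : Fin 3)) hD
  rw [der_formula D (relP p)] at h0 h1 h2
  rw [der_formula D (HamP p f g), der_formula D f, der_formula D g]
  simp only [HamP_apply]
  simp only [map_sub, map_add, MvPolynomial.pderiv_mul, map_zero] at h0 h1 h2 ⊢
  rw [pd_comm 1 0 (relP p)] at h1
  rw [pd_comm 2 0 (relP p), pd_comm 2 1 (relP p)] at h2
  rw [pd_comm 1 0 f, pd_comm 2 0 f, pd_comm 2 1 f, pd_comm 1 0 (relP p), pd_comm 2 0 (relP p),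
    pd_comm 2 1 (relP p), pd_comm 1 0 g, pd_comm 2 0 g, pd_comm 2 1 g]
  linear_combination
    (MvPolynomial.pderiv 1 f * MvPolynomial.pderiv 2 g
      - MvPolynomial.pderiv 2 f * MvPolynomial.pderiv 1 g) * h0
    + (MvPolynomial.pderiv 2 f * MvPolynomial.pderiv 0 g
      - MvPolynomial.pderiv 0 f * MvPolynomial.pderiv 2 g) * h1
    + (MvPolynomial.pderiv 0 f * MvPolynomial.pderiv 1 g
      - MvPolynomial.pderiv 1 f * MvPolynomial.pderiv 0 g) * h2

theorem relP_mem (p : ℂ[X]) : relP p ∈ relIdeal p := Ideal.subset_span rfl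

theorem mem_relIdeal {p : ℂ[X]} {f : P3} (h : f ∈ relIdeal p) : ∃ a, f = a * relP p := by
  obtain ⟨a, ha⟩ := Ideal.mem_span_singleton'.1 h
  exact ⟨a, ha.symm⟩

theorem der_mem {p : ℂ[X]} (D : Derivation ℂ P3 P3) (hD : D (relP p) = 0) {f : P3}
    (h : f ∈ relIdeal p) : D f ∈ relIdeal p := by
  obtain ⟨a, rfl⟩ := mem_relIdeal h
  rw [Derivation.leibniz, hD]
  rw [smul_eq_mul, smul_eq_mul, mul_zero, zero_add]
  exact Ideal.mul_mem_right _ _ (relP_mem p)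

theorem Ham_aux (p : ℂ[X]) (f : P3) (x : P3) (hx : Ideal.Quotient.mkₐ ℂ (relIdeal p) x = 0) :
    Ideal.Quotient.mkₐ ℂ (relIdeal p) (HamP p f x) = 0 := by
  have hx' : x ∈ relIdeal p := Ideal.Quotient.eq_zero_iff_mem.1 hx
  exact Ideal.Quotient.eq_zero_iff_mem.2 (der_mem _ (HamP_relP p f) hx')

/-- The Hamiltonian derivation on `O(D_p)`. -/
def Ham (p : ℂ[X]) (f : P3) : Derivation ℂ (ODan p) (ODan p) :=
  Derivation.liftOfSurjective (f := Ideal.Quotient.mkₐ ℂ (relIdeal p))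
    (Ideal.Quotient.mkₐ_surjective ℂ (relIdeal p)) (d := HamP p f) (Ham_aux p f)

theorem Ham_mk (p : ℂ[X]) (f g : P3) : Ham p f (Ideal.Quotient.mk (relIdeal p) g) =
    Ideal.Quotient.mk (relIdeal p) (HamP p f g) :=
  Derivation.liftOfSurjective_apply (f := Ideal.Quotient.mkₐ ℂ (relIdeal p))
    (Ideal.Quotient.mkₐ_surjective ℂ (relIdeal p)) (Ham_aux p f) g

theorem Ham_mem (p : ℂ[X]) (f : P3) : Ham p f ∈ VeZero p :=
  ⟨HamP p f, HamP_relP p f, Ham_mk p f, by rw [HamP_div]; exact zero_mem _⟩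

theorem der_ext_mk {p : ℂ[X]} {D E : Derivation ℂ (ODan p) (ODan p)}
    (h : ∀ g : P3, D (Ideal.Quotient.mk (relIdeal p) g) = E (Ideal.Quotient.mk (relIdeal p) g)) :
    D = E := by
  ext x
  obtain ⟨g, rfl⟩ := Ideal.Quotient.mk_surjective x
  exact h g

theorem Ham_add (p : ℂ[X]) (f g : P3) : Ham p (f + g) = Ham p f + Ham p g := by
  apply der_ext_mk
  intro h
  have : HamP p (f + g) h = HamP p f h + HamP p g h := by
    simp only [HamP_apply, map_add]; ring
  rw [Derivation.add_apply, Ham_mk, Ham_mk, Ham_mk, this, map_add]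

theorem Ham_smul (p : ℂ[X]) (c : ℂ) (f : P3) : Ham p (c • f) = c • Ham p f := by
  apply der_ext_mk
  intro h
  rw [Derivation.smul_apply, Ham_mk, Ham_mk]
  have : HamP p (c • f) h = c • HamP p f h := by
    simp only [HamP_apply, Derivation.map_smul]
    simp only [MvPolynomial.smul_eq_C_mul]; ring
  rw [this]
  rfl

theorem HamP_skew (p : ℂ[X]) (f g : P3) : HamP p f g = - HamP p g f := by
  simp only [HamP_apply]; ring

theorem Ham_of_mem (p : ℂ[X]) (f : P3) (hf : f ∈ relIdeal p) : Ham p f = 0 := by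
  apply der_ext_mk
  intro h
  rw [Ham_mk, HamP_skew, Derivation.zero_apply]
  exact Ideal.Quotient.eq_zero_iff_mem.2 (neg_mem (der_mem _ (HamP_relP p h) hf))

theorem Ham_bracket (p : ℂ[X]) (v : Derivation ℂ (ODan p) (ODan p)) (D : Derivation ℂ P3 P3)
    (h1 : D (relP p) = 0)
    (h2 : ∀ f : P3, v (Ideal.Quotient.mk (relIdeal p) f) = Ideal.Quotient.mk (relIdeal p) (D f))
    (h3 : MvPolynomial.pderiv (0 : Fin 3) (D xP) + MvPolynomial.pderiv (1 : Fin 3) (D yP) +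
      MvPolynomial.pderiv (2 : Fin 3) (D zP) ∈ relIdeal p) (f : P3) :
    ⁅v, Ham p f⁆ = Ham p (D f) := by
  apply der_ext_mk
  intro g
  rw [Derivation.commutator_apply, Ham_mk, h2, h2, Ham_mk, Ham_mk, HamP_poisson p D h1, ← map_sub,
    Ideal.Quotient.eq]
  have := (relIdeal p).mul_mem_right (HamP p f g) h3
  have h := neg_mem this
  convert h using 1
  ring

theorem Ham_Ham (p : ℂ[X]) (f g : P3) : ⁅Ham p f, Ham p g⁆ = Ham p (HamP p f g) :=
  Ham_bracket p _ (HamP p f) (HamP_relP p f) (Ham_mk p f) (by rw [HamP_div]; exact zero_mem _) g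

/-! Local nilpotency -/

theorem nil_add {A : Type*} [CommRing A] [Algebra ℂ A] (D : Derivation ℂ A A) {f g : A}
    (hf : ∃ n, (D.toLinearMap ^ n) f = 0) (hg : ∃ n, (D.toLinearMap ^ n) g = 0) :
    ∃ n, (D.toLinearMap ^ n) (f + g) = 0 := by
  obtain ⟨n, hn⟩ := hf
  obtain ⟨m, hm⟩ := hg
  refine ⟨n + m, ?_⟩
  rw [map_add]
  nth_rewrite 1 [add_comm n m]
  rw [pow_add, pow_add, Module.End.mul_apply, Module.End.mul_apply, hn, hm]
  simp

theorem nil_of_succ {A : Type*} [CommRing A] [Algebra ℂ A] (D : Derivation ℂ A A) {f : A}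
    (hf : ∃ n, (D.toLinearMap ^ n) (D f) = 0) : ∃ n, (D.toLinearMap ^ n) f = 0 := by
  obtain ⟨n, hn⟩ := hf
  exact ⟨n + 1, by rw [pow_succ, Module.End.mul_apply]; exact hn⟩

theorem nil_mul_aux {A : Type*} [CommRing A] [Algebra ℂ A] (D : Derivation ℂ A A) (N : ℕ) :
    ∀ (n m : ℕ) (f g : A), n + m = N → (D.toLinearMap ^ n) f = 0 → (D.toLinearMap ^ m) g = 0 →
    ∃ k, (D.toLinearMap ^ k) (f * g) = 0 := by
  induction N with
  | zero =>
    intro n m f g h hf hg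
    obtain rfl : n = 0 := by omega
    have : f = 0 := by simpa using hf
    exact ⟨0, by simp [this]⟩
  | succ N ih =>
    intro n m f g h hf hg
    rcases n with _ | n
    · have : f = 0 := by simpa using hf
      exact ⟨0, by simp [this]⟩
    rcases m with _ | m
    · have : g = 0 := by simpa using hg
      exact ⟨0, by simp [this]⟩
    apply nil_of_succ
    rw [Derivation.leibniz, smul_eq_mul, smul_eq_mul]
    have hf' : (D.toLinearMap ^ n) (D f) = 0 := by
      rw [pow_succ, Module.End.mul_apply] at hf; exact hf
    have hg' : (D.toLinearMap ^ m) (D g) = 0 := by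
      rw [pow_succ, Module.End.mul_apply] at hg; exact hg
    apply nil_add
    · exact ih (n + 1) m f (D g) (by omega) hf hg'
    · exact ih (m + 1) n g (D f) (by omega) hg hf'

theorem nil_mul {A : Type*} [CommRing A] [Algebra ℂ A] (D : Derivation ℂ A A) {f g : A}
    (hf : ∃ n, (D.toLinearMap ^ n) f = 0) (hg : ∃ n, (D.toLinearMap ^ n) g = 0) :
    ∃ n, (D.toLinearMap ^ n) (f * g) = 0 := by
  obtain ⟨n, hn⟩ := hf
  obtain ⟨m, hm⟩ := hg
  exact nil_mul_aux D (n + m) n m f g rfl hn hm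

/-- The subalgebra of elements on which a derivation is nilpotent. -/
def nilAlg {A : Type*} [CommRing A] [Algebra ℂ A] (D : Derivation ℂ A A) : Subalgebra ℂ A where
  carrier := {f | ∃ n, (D.toLinearMap ^ n) f = 0}
  mul_mem' := nil_mul D
  add_mem' := nil_add D
  algebraMap_mem' c := ⟨1, by simp⟩

theorem isLND_of {p : ℂ[X]} (D : Derivation ℂ (ODan p) (ODan p)) (E : Derivation ℂ P3 P3)
    (h : ∀ f, D (Ideal.Quotient.mk (relIdeal p) f) = Ideal.Quotient.mk (relIdeal p) (E f))
    (hE : ∀ f : P3, ∃ n, (E.toLinearMap ^ n) f = 0) : IsLND D := by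
  have key : ∀ n f, (D.toLinearMap ^ n) (Ideal.Quotient.mk (relIdeal p) f) =
      Ideal.Quotient.mk (relIdeal p) ((E.toLinearMap ^ n) f) := by
    intro n
    induction n with
    | zero => intro f; simp
    | succ n ih =>
      intro f
      rw [pow_succ, pow_succ, Module.End.mul_apply, Module.End.mul_apply, ← ih]
      exact congrArg _ (h f)
  intro x
  obtain ⟨f, rfl⟩ := Ideal.Quotient.mk_surjective x
  obtain ⟨n, hn⟩ := hE f
  refine ⟨n + 1, by omega, ?_⟩
  rw [key, pow_succ', Module.End.mul_apply, hn]
  simp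

theorem nilAlg_top (E : Derivation ℂ P3 P3) (hx : xP ∈ nilAlg E) (hy : yP ∈ nilAlg E)
    (hz : zP ∈ nilAlg E) (f : P3) : ∃ n, (E.toLinearMap ^ n) f = 0 := by
  have : (⊤ : Subalgebra ℂ P3) ≤ nilAlg E := by
    rw [← MvPolynomial.adjoin_range_X, Algebra.adjoin_le_iff]
    rintro _ ⟨i, rfl⟩
    fin_cases i
    · exact hx
    · exact hy
    · exact hz
  exact this (Algebra.mem_top (x := f))

theorem mem_nilAlg_of {A : Type*} [CommRing A] [Algebra ℂ A] (D : Derivation ℂ A A) {f : A}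
    (h : D f ∈ nilAlg D) : f ∈ nilAlg D := nil_of_succ D h

theorem aeval_mem_nilAlg (E : Derivation ℂ P3 P3) (hz : zP ∈ nilAlg E) (g : ℂ[X]) :
    Polynomial.aeval zP g ∈ nilAlg E := by
  exact (Algebra.adjoin_le (Set.singleton_subset_iff.2 hz)) (Polynomial.aeval_mem_adjoin_singleton ℂ zP)

theorem pd_xpow (i : Fin 3) (k : ℕ) : MvPolynomial.pderiv i (xP ^ k) =
    (k : P3) * xP ^ (k - 1) * MvPolynomial.pderiv i xP := by
  rw [Derivation.leibniz_pow]; simp [mul_assoc]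
theorem pd_ypow (i : Fin 3) (k : ℕ) : MvPolynomial.pderiv i (yP ^ k) =
    (k : P3) * yP ^ (k - 1) * MvPolynomial.pderiv i yP := by
  rw [Derivation.leibniz_pow]; simp [mul_assoc]

theorem lnd_x (p : ℂ[X]) (k : ℕ) : IsLND (Ham p (xP ^ k)) := by
  apply isLND_of _ _ (Ham_mk p _)
  have hx : xP ∈ nilAlg (HamP p (xP ^ k)) := by
    apply mem_nilAlg_of
    rw [HamP_x, pd_xpow, pd_xpow, pd1x, pd2x]
    simp
  have hz : zP ∈ nilAlg (HamP p (xP ^ k)) := by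
    apply mem_nilAlg_of
    rw [HamP_z, pd_xpow, pd_xpow, pd1x, pd0x, pd1P]
    have := mul_mem (mul_mem (natCast_mem (nilAlg (HamP p (xP ^ k))) k) (pow_mem hx (k - 1))) hx
    have := neg_mem this
    convert this using 1
    ring
  have hy : yP ∈ nilAlg (HamP p (xP ^ k)) := by
    apply mem_nilAlg_of
    rw [HamP_y, pd_xpow, pd_xpow, pd2x, pd0x, pd2P]
    have := mul_mem (mul_mem (natCast_mem (nilAlg (HamP p (xP ^ k))) k) (pow_mem hx (k - 1)))
      (aeval_mem_nilAlg _ hz (Polynomial.derivative p))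
    have := neg_mem this
    convert this using 1
    ring
  exact nilAlg_top _ hx hy hz

theorem lnd_y (p : ℂ[X]) (k : ℕ) : IsLND (Ham p (yP ^ k)) := by
  apply isLND_of _ _ (Ham_mk p _)
  have hy : yP ∈ nilAlg (HamP p (yP ^ k)) := by
    apply mem_nilAlg_of
    rw [HamP_y, pd_ypow, pd_ypow, pd0y, pd2y]
    simp
  have hz : zP ∈ nilAlg (HamP p (yP ^ k)) := by
    apply mem_nilAlg_of
    rw [HamP_z, pd_ypow, pd_ypow, pd1y, pd0y, pd0P]
    have := mul_mem (mul_mem (natCast_mem (nilAlg (HamP p (yP ^ k))) k) (pow_mem hy (k - 1))) hy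
    convert this using 1
    ring
  have hx : xP ∈ nilAlg (HamP p (yP ^ k)) := by
    apply mem_nilAlg_of
    rw [HamP_x, pd_ypow, pd_ypow, pd2y, pd1y, pd2P]
    have := mul_mem (mul_mem (natCast_mem (nilAlg (HamP p (yP ^ k))) k) (pow_mem hy (k - 1)))
      (aeval_mem_nilAlg _ hz (Polynomial.derivative p))
    convert this using 1
    ring
  exact nilAlg_top _ hx hy hz

/-! The degree argument -/

theorem poly_fill (p : ℂ[X]) (hp : 2 ≤ p.natDegree) (A : ℕ → Submodule ℂ ℂ[X])
    (h1 : ∀ k, 1 ∈ A k)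
    (hD : ∀ k g, g ∈ A k → Polynomial.derivative g ∈ A (k + 1))
    (hT : ∀ k g, g ∈ A (k + 1) →
      ((k + 1 : ℕ) : ℂ) • (Polynomial.derivative p * g) + p * Polynomial.derivative g ∈ A k) :
    ∀ n : ℕ, ∃ K, ∀ k, K ≤ k → ∀ g : ℂ[X], g.natDegree ≤ n → g ∈ A k := by
  set d := p.natDegree with hd
  have hp0 : p.leadingCoeff ≠ 0 := by
    rw [Polynomial.leadingCoeff_ne_zero]; rintro rfl; simp at hd; omega
  -- an element of degree exactly `N * (d - 1)`
  have step1 : ∀ N k, ∃ g ∈ A k, g.natDegree = N * (d - 1) ∧ g ≠ 0 := by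
    intro N
    induction N with
    | zero => intro k; exact ⟨1, h1 k, by simp, one_ne_zero⟩
    | succ N ih =>
      intro k
      obtain ⟨g, hg, hgd, hg0⟩ := ih (k + 1)
      refine ⟨_, hT k g hg, ?_⟩
      set r := ((k + 1 : ℕ) : ℂ) • (Polynomial.derivative p * g) + p * Polynomial.derivative g
        with hr
      have hdeg : r.natDegree ≤ (N + 1) * (d - 1) := by
        rw [hr]
        refine (Polynomial.natDegree_add_le _ _).trans (max_le ?_ ?_)
        · refine (Polynomial.natDegree_smul_le _ _).trans (Polynomial.natDegree_mul_le.trans ?_)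
          have := Polynomial.natDegree_derivative_le p
          rw [hgd, add_mul]; omega
        · by_cases hg1 : g.natDegree = 0
          · rw [Polynomial.derivative_of_natDegree_zero hg1]; simp
          · refine Polynomial.natDegree_mul_le.trans ?_
            have := Polynomial.natDegree_derivative_le g
            rw [hgd] at this hg1
            rw [add_mul]; omega
      have hcoef : r.coeff ((N + 1) * (d - 1)) =
          (((k + 1) * d + g.natDegree : ℕ) : ℂ) * (p.leadingCoeff * g.leadingCoeff) := by
        have e1 : (N + 1) * (d - 1) = (d - 1) + g.natDegree := by rw [hgd]; ring
        have c1 : (Polynomial.derivative p * g).coeff ((d - 1) + g.natDegree) =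
            d * p.leadingCoeff * g.leadingCoeff := by
          rw [Polynomial.coeff_mul_add_eq_of_natDegree_le (Polynomial.natDegree_derivative_le p)
            le_rfl, Polynomial.coeff_derivative, Polynomial.coeff_natDegree]
          have : d - 1 + 1 = p.natDegree := by omega
          rw [this, Polynomial.coeff_natDegree]
          have : ((d - 1 : ℕ) : ℂ) + 1 = d := by
            have : d - 1 + 1 = d := by omega
            exact_mod_cast congrArg (Nat.cast : ℕ → ℂ) this
          rw [this]; ring
        have c2 : (p * Polynomial.derivative g).coeff ((d - 1) + g.natDegree) =
            g.natDegree * p.leadingCoeff * g.leadingCoeff := by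
          by_cases hg1 : g.natDegree = 0
          · rw [Polynomial.derivative_of_natDegree_zero hg1]; simp [hg1]
          · have : (d - 1) + g.natDegree = d + (g.natDegree - 1) := by omega
            rw [this, Polynomial.coeff_mul_add_eq_of_natDegree_le le_rfl
              (Polynomial.natDegree_derivative_le g), Polynomial.coeff_derivative]
            have e : g.natDegree - 1 + 1 = g.natDegree := by omega
            have e' : ((g.natDegree - 1 : ℕ) : ℂ) + 1 = g.natDegree := by
              exact_mod_cast congrArg (Nat.cast : ℕ → ℂ) e
            rw [e, e', Polynomial.coeff_natDegree, Polynomial.coeff_natDegree]; ring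
        rw [e1, hr, Polynomial.coeff_add, Polynomial.coeff_smul, c1, c2, smul_eq_mul]
        push_cast; ring
      have hne : r.coeff ((N + 1) * (d - 1)) ≠ 0 := by
        rw [hcoef]
        refine mul_ne_zero ?_ (mul_ne_zero hp0 (Polynomial.leadingCoeff_ne_zero.2 hg0))
        rw [Nat.cast_ne_zero]
        have : 0 < (k + 1) * d := by positivity
        omega
      refine ⟨le_antisymm hdeg (Polynomial.le_natDegree_of_ne_zero hne), ?_⟩
      intro h0; rw [h0] at hne; simp at hne
  have step2 : ∀ m j k, ∃ g ∈ A (k + j), g.natDegree = m * (d - 1) - j ∧ 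
      (j ≤ m * (d - 1) → g ≠ 0) := by
    intro m j
    induction j with
    | zero => intro k; obtain ⟨g, a, b, c⟩ := step1 m k; exact ⟨g, a, by simpa using b, fun _ => c⟩
    | succ j ih =>
      intro k
      obtain ⟨g, a, b, c⟩ := ih k
      refine ⟨Polynomial.derivative g, hD _ _ a, ?_, ?_⟩
      · rw [Polynomial.natDegree_derivative, b]; omega
      · intro hj h0
        have := Polynomial.derivative_eq_zero.1 h0
        omega
  intro n
  induction n with
  | zero =>
    refine ⟨0, fun k _ g hg => ?_⟩
    rw [Polynomial.eq_C_of_natDegree_le_zero hg, ← mul_one (Polynomial.C _), 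
      ← Polynomial.smul_eq_C_mul]
    exact (A k).smul_mem _ (h1 k)
  | succ n ih =>
    obtain ⟨K, hK⟩ := ih
    have hle : n + 1 ≤ (n + 1) * (d - 1) := Nat.le_mul_of_pos_right _ (by omega)
    refine ⟨K + ((n + 1) * (d - 1) - (n + 1)), fun k hk g hg => ?_⟩
    obtain ⟨h, ha, hb, hc⟩ := step2 (n + 1) ((n + 1) * (d - 1) - (n + 1))
      (k - ((n + 1) * (d - 1) - (n + 1)))
    rw [Nat.sub_add_cancel (by omega)] at ha
    have hb' : h.natDegree = n + 1 := by omega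
    have h0 : h.leadingCoeff ≠ 0 := Polynomial.leadingCoeff_ne_zero.2 (hc (by omega))
    have hsub : g - (g.coeff (n + 1) / h.leadingCoeff) • h ∈ A k := by
      apply hK k (by omega)
      rw [Polynomial.natDegree_le_iff_coeff_eq_zero]
      intro N hN
      rw [Polynomial.coeff_sub, Polynomial.coeff_smul, smul_eq_mul]
      rcases Nat.lt_or_ge (n + 1) N with h' | h'
      · rw [Polynomial.coeff_eq_zero_of_natDegree_lt (p := g) (by omega),
          Polynomial.coeff_eq_zero_of_natDegree_lt (p := h) (by omega)]; simp
      · obtain rfl : N = n + 1 := by omega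
        rw [Polynomial.leadingCoeff, hb'] at *
        field_simp
        simp
    have := (A k).add_mem hsub ((A k).smul_mem (g.coeff (n + 1) / h.leadingCoeff) ha)
    simpa using this

/-- Vector space of `g` with `x^k g(z) ∈ S`. -/
def coefSp (S : Submodule ℂ P3) (w : P3) : Submodule ℂ ℂ[X] :=
  S.comap ((LinearMap.mulLeft ℂ w) ∘ₗ (Polynomial.aeval zP : ℂ[X] →ₐ[ℂ] P3).toLinearMap)

theorem mem_coefSp (S : Submodule ℂ P3) (w : P3) (g : ℂ[X]) :
    g ∈ coefSp S w ↔ w * Polynomial.aeval zP g ∈ S := Iff.rfl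

theorem xy_pow_sub_mem (p : ℂ[X]) (b : ℕ) :
    (xP * yP) ^ b - (Polynomial.aeval zP p) ^ b ∈ relIdeal p :=
  Ideal.mem_span_singleton.2 (sub_dvd_pow_sub_pow _ _ b)

theorem HamP_xx (p g : ℂ[X]) (k : ℕ) : HamP p xP (xP ^ k * Polynomial.aeval zP g) =
    - (xP ^ (k + 1) * Polynomial.aeval zP (Polynomial.derivative g)) := by
  rw [HamP_apply]
  simp only [MvPolynomial.pderiv_mul, pd_xpow, pd_aeval, pd0x, pd1x, pd2x, pd0z, pd1z, pd2z,
    pd0P, pd1P, pd2P]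
  ring

theorem HamP_yy (p g : ℂ[X]) (k : ℕ) : HamP p yP (yP ^ k * Polynomial.aeval zP g) =
    yP ^ (k + 1) * Polynomial.aeval zP (Polynomial.derivative g) := by
  rw [HamP_apply]
  simp only [MvPolynomial.pderiv_mul, pd_ypow, pd_aeval, pd0y, pd1y, pd2y, pd0z, pd1z, pd2z,
    pd0P, pd1P, pd2P]
  ring

theorem HamP_yx (p g : ℂ[X]) (k : ℕ) : HamP p yP (xP ^ (k + 1) * Polynomial.aeval zP g) =
    xP ^ k * Polynomial.aeval zP (((k + 1 : ℕ) : ℂ) • (Polynomial.derivative p * g)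
      + p * Polynomial.derivative g)
    + xP ^ k * Polynomial.aeval zP (Polynomial.derivative g) * relP p := by
  rw [HamP_apply]
  simp only [MvPolynomial.pderiv_mul, pd_xpow, pd_aeval, pd0x, pd1x, pd2x, pd0z, pd1z, pd2z,
    pd0P, pd1P, pd2P, pd0y, pd1y, pd2y, map_add, map_mul, Nat.add_sub_cancel, Nat.cast_smul_eq_nsmul,
    nsmul_eq_mul, map_natCast]
  rw [relP]
  ring

theorem HamP_xy (p g : ℂ[X]) (k : ℕ) : HamP p xP (yP ^ (k + 1) * Polynomial.aeval zP g) =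
    -(yP ^ k * Polynomial.aeval zP (((k + 1 : ℕ) : ℂ) • (Polynomial.derivative p * g)
      + p * Polynomial.derivative g)
    + yP ^ k * Polynomial.aeval zP (Polynomial.derivative g) * relP p) := by
  rw [HamP_apply]
  simp only [MvPolynomial.pderiv_mul, pd_ypow, pd_aeval, pd0x, pd1x, pd2x, pd0z, pd1z, pd2z,
    pd0P, pd1P, pd2P, pd0y, pd1y, pd2y, map_add, map_mul, Nat.add_sub_cancel, Nat.cast_smul_eq_nsmul,
    nsmul_eq_mul, map_natCast]
  rw [relP]
  ring

theorem core (p : ℂ[X]) (hp : 2 ≤ p.natDegree) (S : Submodule ℂ P3)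
    (hI : ∀ f ∈ relIdeal p, f ∈ S) (hx : ∀ k, xP ^ k ∈ S) (hy : ∀ k, yP ^ k ∈ S)
    (hJ : ∀ f g, f ∈ S → g ∈ S → HamP p f g ∈ S) (r : P3) :
    ∃ K, ∀ k, K ≤ k → xP ^ k * r ∈ S ∧ yP ^ k * r ∈ S := by
  have hx1 : xP ∈ S := by simpa using hx 1
  have hy1 : yP ∈ S := by simpa using hy 1
  have fx := poly_fill p hp (fun k => coefSp S (xP ^ k))
    (by intro k; rw [mem_coefSp]; simpa using hx k)
    (by
      intro k g hg
      rw [mem_coefSp] at hg ⊢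
      have := hJ _ _ hx1 hg
      rw [HamP_xx] at this
      exact neg_mem_iff.1 this)
    (by
      intro k g hg
      rw [mem_coefSp] at hg ⊢
      have := hJ _ _ hy1 hg
      rw [HamP_yx] at this
      exact (S.add_mem_iff_left (hI _ (Ideal.mul_mem_left _ _ (relP_mem p)))).1 this)
  have fy := poly_fill p hp (fun k => coefSp S (yP ^ k))
    (by intro k; rw [mem_coefSp]; simpa using hy k)
    (by
      intro k g hg
      rw [mem_coefSp] at hg ⊢
      have := hJ _ _ hy1 hg
      rw [HamP_yy] at this
      exact this)
    (by
      intro k g hg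
      rw [mem_coefSp] at hg ⊢
      have := hJ _ _ hx1 hg
      rw [HamP_xy] at this
      exact (S.add_mem_iff_left (hI _ (Ideal.mul_mem_left _ _ (relP_mem p)))).1
        (neg_mem_iff.1 this))
  have mono : ∀ a b c : ℕ, ∃ K, ∀ k, K ≤ k →
      xP ^ k * (xP ^ a * yP ^ b * zP ^ c) ∈ S ∧ yP ^ k * (xP ^ a * yP ^ b * zP ^ c) ∈ S := by
    intro a b c
    obtain ⟨K1, h1⟩ := fx (p ^ b * Polynomial.X ^ c).natDegree
    obtain ⟨K2, h2⟩ := fy (p ^ a * Polynomial.X ^ c).natDegree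
    refine ⟨K1 + K2 + a + b, fun k hk => ⟨?_, ?_⟩⟩
    · have e := h1 (k - b + a) (by omega) _ le_rfl
      rw [mem_coefSp] at e
      have i := (relIdeal p).mul_mem_left (xP ^ (k - b + a) * zP ^ c) (xy_pow_sub_mem p b)
      have := S.add_mem e (hI _ i)
      convert this using 1
      obtain ⟨m, rfl⟩ : ∃ m, k = b + m := ⟨k - b, by omega⟩
      simp only [map_mul, map_pow, Polynomial.aeval_X, Nat.add_sub_cancel_left]
      ring
    · have e := h2 (k - a + b) (by omega) _ le_rfl
      rw [mem_coefSp] at e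
      have i := (relIdeal p).mul_mem_left (yP ^ (k - a + b) * zP ^ c) (xy_pow_sub_mem p a)
      have := S.add_mem e (hI _ i)
      convert this using 1
      obtain ⟨m, rfl⟩ : ∃ m, k = a + m := ⟨k - a, by omega⟩
      simp only [map_mul, map_pow, Polynomial.aeval_X, Nat.add_sub_cancel_left]
      ring
  have add : ∀ f g : P3, (∃ K, ∀ k, K ≤ k → xP ^ k * f ∈ S ∧ yP ^ k * f ∈ S) →
      (∃ K, ∀ k, K ≤ k → xP ^ k * g ∈ S ∧ yP ^ k * g ∈ S) →
      (∃ K, ∀ k, K ≤ k → xP ^ k * (f + g) ∈ S ∧ yP ^ k * (f + g) ∈ S) := by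
    rintro f g ⟨K, h⟩ ⟨L, h'⟩
    refine ⟨K + L, fun k hk => ?_⟩
    obtain ⟨a, b⟩ := h k (by omega)
    obtain ⟨a', b'⟩ := h' k (by omega)
    rw [mul_add, mul_add]
    exact ⟨S.add_mem a a', S.add_mem b b'⟩
  induction r using MvPolynomial.induction_on' with
  | monomial s c =>
    obtain ⟨K, h⟩ := mono (s 0) (s 1) (s 2)
    refine ⟨K, fun k hk => ?_⟩
    have e : MvPolynomial.monomial s c = c • (xP ^ (s 0) * yP ^ (s 1) * zP ^ (s 2)) := by
      rw [MvPolynomial.monomial_eq, Finsupp.prod_fintype _ _ (by simp), Fin.prod_univ_three,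
        MvPolynomial.smul_eq_C_mul]
      rfl
    obtain ⟨a, b⟩ := h k hk
    rw [e, mul_smul_comm, mul_smul_comm]
    exact ⟨S.smul_mem _ a, S.smul_mem _ b⟩
  | add f g hf hg => exact add _ _ hf hg

/-! The coordinate ring is a domain -/

/-- evaluation at a point -/
def evPt (a b c : ℂ) : P3 →+* ℂ := MvPolynomial.eval ![a, b, c]

theorem evPt_x (a b c : ℂ) : evPt a b c xP = a := by simp [evPt, xP]
theorem evPt_y (a b c : ℂ) : evPt a b c yP = b := by simp [evPt, yP]
theorem evPt_z (a b c : ℂ) : evPt a b c zP = c := by simp [evPt, zP]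
theorem evPt_aeval (a b c : ℂ) (g : ℂ[X]) : evPt a b c (Polynomial.aeval zP g) = g.eval c := by
  have : (MvPolynomial.aeval ![a, b, c] : P3 →ₐ[ℂ] ℂ) (Polynomial.aeval zP g) = g.eval c := by
    rw [← Polynomial.aeval_algHom_apply]
    have : (MvPolynomial.aeval ![a, b, c] : P3 →ₐ[ℂ] ℂ) zP = c := by simp [zP]
    rw [this, Polynomial.coe_aeval_eq_eval]
  rw [← this, evPt]
  rfl

theorem mk_ne_zero {p : ℂ[X]} {f : P3} (c : ℂ) (b : ℂ)
    (h : evPt (p.eval c / b) b c f ≠ 0) (hb : b ≠ 0) : Ideal.Quotient.mk (relIdeal p) f ≠ 0 := by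
  intro h0
  obtain ⟨a, rfl⟩ := mem_relIdeal (Ideal.Quotient.eq_zero_iff_mem.1 h0)
  apply h
  rw [map_mul, relP, map_sub, map_mul, evPt_x, evPt_y, evPt_aeval]
  field_simp
  simp

theorem exists_eval_ne (g : ℂ[X]) (h : g ≠ 0) : ∃ c, g.eval c ≠ 0 := by
  by_contra! hc
  exact h (Polynomial.funext (by simpa using hc))

theorem relP_prime (p : ℂ[X]) (hp : p ≠ 0) : Prime (relP p) := by
  rw [← UniqueFactorizationMonoid.irreducible_iff_prime]
  have := MvPolynomial.irreducible_mul_X_add (xP) (-(Polynomial.aeval zP p)) (1 : Fin 3)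
    (by simp [xP]) (by simp [xP]) (by
      rw [MvPolynomial.vars_neg]
      have h : Polynomial.aeval zP p ∈ MvPolynomial.supported ℂ ({2} : Set (Fin 3)) := by
        have hz : zP ∈ MvPolynomial.supported ℂ ({2} : Set (Fin 3)) :=
          MvPolynomial.X_mem_supported.2 rfl
        exact (Algebra.adjoin_le (Set.singleton_subset_iff.2 hz))
          (Polynomial.aeval_mem_adjoin_singleton ℂ zP)
      intro h1
      have := (MvPolynomial.mem_supported.1 h) h1
      simp at this) (by
      have hx : Irreducible xP := (MvPolynomial.X_prime (R := ℂ) (i := (0 : Fin 3))).irreducible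
      rw [hx.isRelPrime_iff_not_dvd]
      rintro ⟨a, ha⟩
      obtain ⟨c, hc⟩ := exists_eval_ne p hp
      have := congrArg (evPt 0 0 c) ha
      rw [map_neg, map_mul, evPt_x, evPt_aeval] at this
      simp at this
      exact hc this)
  rw [relP, sub_eq_add_neg]
  exact this

theorem dan_isDomain (p : ℂ[X]) (hp : p ≠ 0) : IsDomain (ODan p) := by
  have h := relP_prime p hp
  have : (relIdeal p).IsPrime := (Ideal.span_singleton_prime h.ne_zero).2 h
  exact Ideal.Quotient.isDomain _

theorem HamP_xpow (p : ℂ[X]) (k : ℕ) (f : P3) :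
    HamP p (xP ^ (k + 1)) f = ((k + 1 : ℕ) : P3) * xP ^ k * HamP p xP f := by
  simp only [HamP_apply, pd_xpow, pd1x, pd0x, pd2x, Nat.add_sub_cancel]
  ring

theorem HamP_ypow (p : ℂ[X]) (k : ℕ) (f : P3) :
    HamP p (yP ^ (k + 1)) f = ((k + 1 : ℕ) : P3) * yP ^ k * HamP p yP f := by
  simp only [HamP_apply, pd_ypow, pd1y, pd0y, pd2y, Nat.add_sub_cancel]
  ring

theorem Ham_xpow (p : ℂ[X]) (k : ℕ) (u : ODan p) :
    Ham p (xP ^ (k + 1)) u =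
      ((k + 1 : ℕ) : ODan p) * Ideal.Quotient.mk (relIdeal p) xP ^ k * Ham p xP u := by
  obtain ⟨f, rfl⟩ := Ideal.Quotient.mk_surjective u
  rw [Ham_mk, HamP_xpow, Ham_mk, map_mul, map_mul, map_pow, map_natCast]

theorem Ham_ypow (p : ℂ[X]) (k : ℕ) (u : ODan p) :
    Ham p (yP ^ (k + 1)) u =
      ((k + 1 : ℕ) : ODan p) * Ideal.Quotient.mk (relIdeal p) yP ^ k * Ham p yP u := by
  obtain ⟨f, rfl⟩ := Ideal.Quotient.mk_surjective u
  rw [Ham_mk, HamP_ypow, Ham_mk, map_mul, map_mul, map_pow, map_natCast]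

/-- Abstract form of the centralizer argument. -/
theorem cent_aux {A : Type*} [CommRing A] [IsDomain A] [Algebra ℂ A] (w d d1 d2 : Derivation ℂ A A)
    (X z ε : A) (hX : X ≠ 0) (hz : d z = ε * X) (he : ε ≠ 0) (hew : w ε = 0) (k : ℕ)
    (h1 : ∀ u, d1 u = ((k + 1 : ℕ) : A) * X ^ k * d u)
    (h2 : ∀ u, d2 u = ((k + 1 + 1 : ℕ) : A) * X ^ (k + 1) * d u)
    (c1 : ⁅w, d1⁆ = 0) (c2 : ⁅w, d2⁆ = 0) : w X = 0 := by
  have hinj : CharZero A := charZero_of_injective_algebraMap (algebraMap ℂ A).injective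
  have e1 := congrArg (fun D => D z) c1
  have e2 := congrArg (fun D => D z) c2
  have hw : ∀ m : ℕ, w (((m + 1 : ℕ) : A) * X ^ m * (ε * X)) =
      ((m + 1 : ℕ) : A) * (((m + 1 : ℕ) : A) * (ε * X ^ m * w X)) := by
    intro m
    have : ((m + 1 : ℕ) : A) * X ^ m * (ε * X) = (m + 1 : ℕ) • (ε * X ^ (m + 1)) := by
      rw [nsmul_eq_mul]; ring
    rw [this, map_nsmul, Derivation.leibniz, Derivation.leibniz_pow, hew, nsmul_eq_mul,
      nsmul_eq_mul, smul_eq_mul, smul_eq_mul, smul_eq_mul, Nat.add_sub_cancel]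
    ring
  simp only [Derivation.commutator_apply, h1, h2, hz, Derivation.zero_apply, hw] at e1 e2
  have n1 : ((k + 1 : ℕ) : A) ≠ 0 := Nat.cast_ne_zero.2 (by omega)
  have n2 : ((k + 1 + 1 : ℕ) : A) ≠ 0 := Nat.cast_ne_zero.2 (by omega)
  have g1 : ((k + 1 : ℕ) : A) * (ε * X ^ k * w X) = X ^ k * d (w z) := by
    apply mul_left_cancel₀ n1; linear_combination e1
  have g2 : ((k + 1 + 1 : ℕ) : A) * (ε * X ^ (k + 1) * w X) = X ^ (k + 1) * d (w z) := by
    apply mul_left_cancel₀ n2; linear_combination e2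
  have g3 : ε * X ^ (k + 1) * w X = 0 := by
    push_cast at g1 g2
    linear_combination g2 - X * g1
  exact (mul_eq_zero.1 g3).resolve_left (mul_ne_zero he (pow_ne_zero _ hX))

theorem cent_zero (p : ℂ[X]) (hp : 2 ≤ p.natDegree) (w : Derivation ℂ (ODan p) (ODan p)) (k : ℕ)
    (x1 : ⁅w, Ham p (xP ^ (k + 1))⁆ = 0) (x2 : ⁅w, Ham p (xP ^ (k + 1 + 1))⁆ = 0)
    (y1 : ⁅w, Ham p (yP ^ (k + 1))⁆ = 0) (y2 : ⁅w, Ham p (yP ^ (k + 1 + 1))⁆ = 0) : w = 0 := by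
  have hp0 : p ≠ 0 := by rintro rfl; simp at hp
  have hdp : Polynomial.derivative p ≠ 0 := by
    intro h; rw [Polynomial.derivative_eq_zero] at h; omega
  have := dan_isDomain p hp0
  obtain ⟨c, hc⟩ := exists_eval_ne p hp0
  have hx0 : Ideal.Quotient.mk (relIdeal p) xP ≠ 0 :=
    mk_ne_zero c 1 (by rw [evPt_x]; simpa using hc) one_ne_zero
  have hy0 : Ideal.Quotient.mk (relIdeal p) yP ≠ 0 :=
    mk_ne_zero c 1 (by rw [evPt_y]; simp) one_ne_zero
  obtain ⟨c', hc'⟩ := exists_eval_ne _ hdp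
  have hd0 : Ideal.Quotient.mk (relIdeal p) (Polynomial.aeval zP (Polynomial.derivative p)) ≠ 0 :=
    mk_ne_zero c' 1 (by rwa [evPt_aeval]) one_ne_zero
  have wx : w (Ideal.Quotient.mk (relIdeal p) xP) = 0 := by
    refine cent_aux w (Ham p xP) _ _ _ (Ideal.Quotient.mk (relIdeal p) zP) (-1) hx0 ?_ (by simp)
      (by simp) k (Ham_xpow p k) (Ham_xpow p (k + 1)) x1 x2
    rw [Ham_mk, HamP_z, pd1x, pd0x, pd1P, zero_mul, one_mul, zero_sub, map_neg]
    exact (neg_one_mul (Ideal.Quotient.mk (relIdeal p) xP : ODan p)).symm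
  have wy : w (Ideal.Quotient.mk (relIdeal p) yP) = 0 := by
    refine cent_aux w (Ham p yP) _ _ _ (Ideal.Quotient.mk (relIdeal p) zP) 1 hy0 ?_ (by simp)
      (by simp) k (Ham_ypow p k) (Ham_ypow p (k + 1)) y1 y2
    rw [Ham_mk, HamP_z, pd1y, pd0y, pd0P, zero_mul, one_mul, sub_zero, one_mul]
  have hrel : Ideal.Quotient.mk (relIdeal p) xP * Ideal.Quotient.mk (relIdeal p) yP =
      Polynomial.aeval (Ideal.Quotient.mk (relIdeal p) zP) p := by
    have h1 : Ideal.Quotient.mk (relIdeal p) (xP * yP) =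
        Ideal.Quotient.mk (relIdeal p) (Polynomial.aeval zP p) :=
      Ideal.Quotient.eq.2 (relP_mem p)
    rw [map_mul] at h1
    rw [h1]
    exact (Polynomial.aeval_algHom_apply (Ideal.Quotient.mkₐ ℂ (relIdeal p)) zP p).symm
  have wz : w (Ideal.Quotient.mk (relIdeal p) zP) = 0 := by
    have h := congrArg w hrel
    rw [Derivation.leibniz, wx, wy, Derivation.map_aeval, smul_zero, smul_zero, add_zero,
      smul_eq_mul] at h
    have h2 : Polynomial.aeval (Ideal.Quotient.mk (relIdeal p) zP) (Polynomial.derivative p) ≠ 0 := by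
      have e := Polynomial.aeval_algHom_apply (Ideal.Quotient.mkₐ ℂ (relIdeal p)) zP
        (Polynomial.derivative p)
      intro h3
      exact hd0 (e.symm.trans h3)
    exact (mul_eq_zero.1 h.symm).resolve_left h2
  apply der_ext_mk
  intro g
  rw [Derivation.zero_apply]
  induction g using MvPolynomial.induction_on with
  | C a =>
    exact w.map_algebraMap a
  | add f g hf hg => rw [map_add, map_add, hf, hg, add_zero]
  | mul_X f i hf =>
    have hi : w (Ideal.Quotient.mk (relIdeal p) (MvPolynomial.X i)) = 0 := by
      fin_cases i
      · exact wx
      · exact wy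
      · exact wz
    rw [map_mul, Derivation.leibniz, hf, hi, smul_zero, smul_zero, add_zero]

/-- Functions whose Hamiltonian derivation is fixed. -/
def fixSub (p : ℂ[X]) (V : LieSubalgebra ℂ (Derivation ℂ (ODan p) (ODan p)))
    {L : Type*} [LieRing L] [LieAlgebra ℂ L] (F₁ F₂ : V ≃ₗ⁅ℂ⁆ L) : Submodule ℂ P3 where
  carrier := {f | ∃ h : Ham p f ∈ V, F₁ ⟨Ham p f, h⟩ = F₂ ⟨Ham p f, h⟩}
  add_mem' := by
    rintro f g ⟨h1, e1⟩ ⟨h2, e2⟩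
    have e : Ham p (f + g) = Ham p f + Ham p g := Ham_add p f g
    have h : Ham p (f + g) ∈ V := e ▸ V.add_mem h1 h2
    refine ⟨h, ?_⟩
    have : (⟨Ham p (f + g), h⟩ : V) = ⟨Ham p f, h1⟩ + ⟨Ham p g, h2⟩ := Subtype.ext e
    rw [this, map_add, map_add, e1, e2]
  zero_mem' := by
    have e : Ham p 0 = 0 := Ham_of_mem p 0 (zero_mem _)
    have h : Ham p 0 ∈ V := e ▸ V.zero_mem
    refine ⟨h, ?_⟩
    have : (⟨Ham p 0, h⟩ : V) = 0 := Subtype.ext e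
    rw [this, map_zero, map_zero]
  smul_mem' := by
    rintro c f ⟨h1, e1⟩
    have e : Ham p (c • f) = c • Ham p f := Ham_smul p c f
    have h : Ham p (c • f) ∈ V := e ▸ V.smul_mem c h1
    refine ⟨h, ?_⟩
    have : (⟨Ham p (c • f), h⟩ : V) = c • ⟨Ham p f, h1⟩ := Subtype.ext e
    rw [this, map_smul, map_smul, e1]

theorem main_aux (p : ℂ[X]) (hp : 2 ≤ p.natDegree)
    (V : LieSubalgebra ℂ (Derivation ℂ (ODan p) (ODan p))) (hV : (V : Set _) = VeZero p)
    {L : Type*} [LieRing L] [LieAlgebra ℂ L] (F₁ F₂ : V ≃ₗ⁅ℂ⁆ L)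
    (hagree : ∀ d : V, (d : Derivation ℂ (ODan p) (ODan p)) ∈ lndSpan p → F₁ d = F₂ d)
    (v : V) : F₁ v = F₂ v := by
  have hHam : ∀ f, Ham p f ∈ V := fun f => by
    have : Ham p f ∈ (V : Set _) := hV ▸ Ham_mem p f
    exact this
  have hLND : ∀ f, IsLND (Ham p f) → f ∈ fixSub p V F₁ F₂ := fun f hf =>
    ⟨hHam f, hagree ⟨Ham p f, hHam f⟩ (LieSubalgebra.subset_lieSpan hf)⟩
  have hcore := core p hp (fixSub p V F₁ F₂)
    (by
      intro f hf
      have e : Ham p f = 0 := Ham_of_mem p f hf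
      refine ⟨hHam f, ?_⟩
      have : (⟨Ham p f, hHam f⟩ : V) = 0 := Subtype.ext e
      rw [this, map_zero, map_zero])
    (fun k => hLND _ (lnd_x p k)) (fun k => hLND _ (lnd_y p k))
    (by
      rintro f g ⟨h1, e1⟩ ⟨h2, e2⟩
      refine ⟨hHam _, ?_⟩
      have : (⟨Ham p (HamP p f g), hHam _⟩ : V) = ⁅(⟨Ham p f, h1⟩ : V), (⟨Ham p g, h2⟩ : V)⁆ :=
        Subtype.ext (Ham_Ham p f g).symm
      rw [this, LieEquiv.map_lie, LieEquiv.map_lie, e1, e2])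
  have hv : (v : Derivation ℂ (ODan p) (ODan p)) ∈ VeZero p := hV ▸ v.2
  obtain ⟨D, hD1, hD2, hD3⟩ := hv
  obtain ⟨K, hK⟩ := hcore (D xP)
  obtain ⟨K', hK'⟩ := hcore (D yP)
  set w : V := F₂.symm (F₁ v) - v with hw
  have hF2w : F₂ w = F₁ v - F₂ v := by rw [hw, map_sub, LieEquiv.apply_symm_apply]
  -- the difference commutes with the fixed Hamiltonians whose bracket with `v` is fixed
  have comm : ∀ f, f ∈ fixSub p V F₁ F₂ → D f ∈ fixSub p V F₁ F₂ →
      ⁅(w : Derivation ℂ (ODan p) (ODan p)), Ham p f⁆ = 0 := by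
    rintro f ⟨h1, e1⟩ ⟨h2, e2⟩
    have hb : ⁅v, (⟨Ham p f, h1⟩ : V)⁆ = ⟨Ham p (D f), h2⟩ :=
      Subtype.ext (Ham_bracket p v D hD1 hD2 hD3 f)
    have : ⁅w, (⟨Ham p f, h1⟩ : V)⁆ = 0 := by
      have h3 : F₂ ⁅w, (⟨Ham p f, h1⟩ : V)⁆ = F₂ 0 := by
        rw [LieEquiv.map_lie, hF2w, sub_lie]
        nth_rewrite 1 [← e1]
        rw [← LieEquiv.map_lie, ← LieEquiv.map_lie, hb, e2, sub_self, map_zero]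
      exact F₂.injective h3
    exact congrArg Subtype.val this
  have cx : ∀ k, K ≤ k → ⁅(w : Derivation ℂ (ODan p) (ODan p)), Ham p (xP ^ (k + 1))⁆ = 0 := by
    intro k hk
    refine comm _ (hLND _ (lnd_x p _)) ?_
    rw [Derivation.leibniz_pow, Nat.add_sub_cancel, smul_eq_mul]
    exact nsmul_mem (hK k hk).1 _
  have cy : ∀ k, K' ≤ k → ⁅(w : Derivation ℂ (ODan p) (ODan p)), Ham p (yP ^ (k + 1))⁆ = 0 := by
    intro k hk
    refine comm _ (hLND _ (lnd_y p _)) ?_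
    rw [Derivation.leibniz_pow, Nat.add_sub_cancel, smul_eq_mul]
    exact nsmul_mem (hK' k hk).2 _
  have w0 : (w : Derivation ℂ (ODan p) (ODan p)) = 0 :=
    cent_zero p hp w (K + K') (cx _ (by omega)) (cx _ (by omega)) (cy _ (by omega))
      (cy _ (by omega))
  have w0' : w = 0 := Subtype.ext w0
  rw [w0', map_zero] at hF2w
  exact (sub_eq_zero.1 hF2w.symm)

/-- Let `p, q` be squarefree with `2 ≤ deg p ≤ deg q` and `3 ≤ deg q`.  If two Lie algebra
isomorphisms `F₁, F₂ : Ve⁰(D_p) → Ve⁰(D_q)` agree on `⟨LND(D_p)⟩`, then `F₁ = F₂`. -/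
theorem veZero_equiv_determined_by_lnd (p q : ℂ[X])
    (hsp : Squarefree p) (hsq : Squarefree q)
    (hp2 : 2 ≤ p.natDegree) (hpq : p.natDegree ≤ q.natDegree) (hq3 : 3 ≤ q.natDegree)
    (Vp : LieSubalgebra ℂ (Derivation ℂ (ODan p) (ODan p))) (hVp : (Vp : Set _) = VeZero p)
    (Vq : LieSubalgebra ℂ (Derivation ℂ (ODan q) (ODan q))) (hVq : (Vq : Set _) = VeZero q)
    (F₁ F₂ : Vp ≃ₗ⁅ℂ⁆ Vq)
    (hagree : ∀ d : Vp, ((d : Vp) : Derivation ℂ (ODan p) (ODan p)) ∈ lndSpan p →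
      F₁ d = F₂ d) :
    F₁ = F₂ := by
  have h := main_aux p hp2 Vp hVp F₁ F₂ hagree
  exact DFunLike.ext _ _ h

end
end

section
/- Let p ∈ ℂ[z] be a polynomial of degree at least 3 without multiple roots. Let G be the subgroup of the group of ℂ-algebra automorphisms of O(D_p) generated by U_x, U_y and T, and let U(D_p) be the subgroup generated by U_x and U_y. If φ : G → G is a group automorphism with φ(u) = u for every u ∈ U(D_p), then φ is the identity. -/
open Polynomial

set_option synthInstance.maxHeartbeats 400000
set_option maxHeartbeats 800000

noncomputable section

/-- The group of `ℂ`-algebra automorphisms of `O(D_p)`. -/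
abbrev AutD (p : ℂ[X]) : Type := ODan p ≃ₐ[ℂ] ODan p

/-- The set `U_x = {α_{x,f} : f ∈ ℂ[t], f(0) = 0}` of automorphisms of `O(D_p)`: those
fixing `x` and sending `z ↦ z + f(x)` for a polynomial `f` with `f(0) = 0` (the image
of `y` is then forced). -/
def UxSet (p : ℂ[X]) : Set (AutD p) :=
  {α | ∃ f : ℂ[X], f.coeff 0 = 0 ∧
    α (Ideal.Quotient.mk (relIdeal p) xP) = Ideal.Quotient.mk (relIdeal p) xP ∧
    α (Ideal.Quotient.mk (relIdeal p) zP) = Ideal.Quotient.mk (relIdeal p) zP +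
      Polynomial.aeval (Ideal.Quotient.mk (relIdeal p) xP) f}

/-- The set `U_y = {α_{y,f} : f ∈ ℂ[t], f(0) = 0}` of automorphisms of `O(D_p)`. -/
def UySet (p : ℂ[X]) : Set (AutD p) :=
  {α | ∃ f : ℂ[X], f.coeff 0 = 0 ∧
    α (Ideal.Quotient.mk (relIdeal p) yP) = Ideal.Quotient.mk (relIdeal p) yP ∧
    α (Ideal.Quotient.mk (relIdeal p) zP) = Ideal.Quotient.mk (relIdeal p) zP +
      Polynomial.aeval (Ideal.Quotient.mk (relIdeal p) yP) f}

/-- The torus `T = {τ_t : t ∈ ℂ*}`, where `τ_t : x ↦ tx, y ↦ t⁻¹y, z ↦ z`. -/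
def TSet (p : ℂ[X]) : Set (AutD p) :=
  {α | ∃ t : ℂˣ,
    α (Ideal.Quotient.mk (relIdeal p) xP) = (t : ℂ) • Ideal.Quotient.mk (relIdeal p) xP ∧
    α (Ideal.Quotient.mk (relIdeal p) yP) = ((t⁻¹ : ℂˣ) : ℂ) • Ideal.Quotient.mk (relIdeal p) yP ∧
    α (Ideal.Quotient.mk (relIdeal p) zP) = Ideal.Quotient.mk (relIdeal p) zP}

namespace Dan

variable (p : ℂ[X])

/-- class of `x` -/
def x : ODan p := Ideal.Quotient.mk (relIdeal p) xP
/-- class of `y` -/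
def y : ODan p := Ideal.Quotient.mk (relIdeal p) yP
/-- class of `z` -/
def z : ODan p := Ideal.Quotient.mk (relIdeal p) zP

lemma mk_aeval (q : ℂ[X]) (a : P3) :
    Ideal.Quotient.mk (relIdeal p) (Polynomial.aeval a q)
      = Polynomial.aeval (Ideal.Quotient.mk (relIdeal p) a) q := by
  have := Polynomial.aeval_algHom_apply (Ideal.Quotient.mkₐ ℂ (relIdeal p)) a q
  exact this.symm

lemma xy_eq : x p * y p = Polynomial.aeval (z p) p := by
  unfold x y z
  rw [← mk_aeval, ← map_mul, Ideal.Quotient.eq]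
  exact Ideal.subset_span rfl

/-- universal property -/
def lift {B : Type} [CommRing B] [Algebra ℂ B] (a b c : B)
    (h : a * b = Polynomial.aeval c p) : ODan p →ₐ[ℂ] B :=
  Ideal.Quotient.liftₐ (relIdeal p) (MvPolynomial.aeval ![a, b, c]) (by
    intro q hq
    have : relIdeal p ≤ RingHom.ker (MvPolynomial.aeval ![a, b, c] : P3 →ₐ[ℂ] B) := by
      unfold relIdeal
      rw [Ideal.span_le, Set.singleton_subset_iff]
      simp [RingHom.mem_ker, xP, yP, zP, ← Polynomial.aeval_algHom_apply, h]
    exact this hq)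

section
variable {B : Type} [CommRing B] [Algebra ℂ B] (a b c : B) (h : a * b = Polynomial.aeval c p)

lemma lift_x : lift p a b c h (x p) = a := by
  unfold lift x xP
  exact (Ideal.Quotient.lift_mk _ _ _).trans (by simp)
lemma lift_y : lift p a b c h (y p) = b := by
  unfold lift y yP
  exact (Ideal.Quotient.lift_mk _ _ _).trans (by simp)
lemma lift_z : lift p a b c h (z p) = c := by
  unfold lift z zP
  exact (Ideal.Quotient.lift_mk _ _ _).trans (by simp)
end

lemma hom_ext {B : Type} [CommRing B] [Algebra ℂ B] {f g : ODan p →ₐ[ℂ] B}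
    (hx : f (x p) = g (x p)) (hy : f (y p) = g (y p)) (hz : f (z p) = g (z p)) : f = g := by
  apply Ideal.Quotient.algHom_ext
  apply MvPolynomial.algHom_ext
  intro i
  fin_cases i
  · exact hx
  · exact hy
  · exact hz

variable {p}

lemma x_reg (hp : p ≠ 0) {a : ODan p} (h : x p * a = 0) : a = 0 := by
  obtain ⟨a, rfl⟩ := Ideal.Quotient.mk_surjective a
  unfold x at h
  rw [← map_mul, Ideal.Quotient.eq_zero_iff_mem, relIdeal, Ideal.mem_span_singleton] at h
  obtain ⟨b, hb⟩ := h
  have hpr : Prime xP := MvPolynomial.X_prime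
  have hd : xP ∣ (xP * yP - Polynomial.aeval zP p) * b := ⟨a, hb.symm⟩
  rcases hpr.dvd_or_dvd hd with h1 | ⟨b', rfl⟩
  · exfalso
    apply hp
    apply Polynomial.funext
    intro r
    obtain ⟨d, hd⟩ := h1
    have := congrArg (MvPolynomial.aeval ![0, 0, r] : P3 →ₐ[ℂ] ℂ) hd
    rw [map_mul, map_sub, map_mul, ← Polynomial.aeval_algHom_apply] at this
    simpa [xP, yP, zP] using this
  · rw [Ideal.Quotient.eq_zero_iff_mem, relIdeal, Ideal.mem_span_singleton]
    refine ⟨b', ?_⟩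
    apply mul_left_cancel₀ hpr.ne_zero
    rw [hb]; ring

lemma x_cancel (hp : p ≠ 0) {a b : ODan p} (h : x p * a = x p * b) : a = b := by
  rw [← sub_eq_zero]
  apply x_reg hp
  rw [mul_sub, h, sub_self]

/-- function field -/
abbrev K : Type := RatFunc ℂ

lemma KX : (RatFunc.X : K) ≠ 0 := RatFunc.X_ne_zero

variable (p) in
/-- embedding in `ℂ(x)[Z]` -/
def emb : ODan p →ₐ[ℂ] K[X] :=
  lift p (C RatFunc.X) (C (RatFunc.X)⁻¹ * Polynomial.aeval (X : K[X]) p) X (by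
    rw [← mul_assoc, ← C_mul, mul_inv_cancel₀ KX, C_1, one_mul])

lemma emb_x : emb p (x p) = C RatFunc.X := lift_x ..
lemma emb_z : emb p (z p) = X := lift_z ..

variable (p) in
/-- the map from `ℂ[x][z]` -/
def jj : ℂ[X][X] →+* ODan p := Polynomial.eval₂RingHom (Polynomial.aeval (x p)).toRingHom (z p)

lemma emb_jj (b : ℂ[X][X]) : emb p (jj p b) = b.map (algebraMap ℂ[X] K) := by
  have : (emb p).toRingHom.comp (jj p) = Polynomial.mapRingHom (algebraMap ℂ[X] K) := by
    apply Polynomial.ringHom_ext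
    · intro a
      simp [jj, ← Polynomial.aeval_algHom_apply, emb_x]
      have : (Polynomial.aeval (C RatFunc.X : K[X])) = (Polynomial.CAlgHom (R := ℂ) (A := K)).comp (IsScalarTower.toAlgHom ℂ ℂ[X] K) := by
        apply Polynomial.algHom_ext
        simp [RatFunc.algebraMap_X]
      rw [this]; simp
    · simp [jj, emb_z]
  exact DFunLike.congr_fun this b

lemma exists_pow (a : ODan p) : ∃ n b, x p ^ n * a = jj p b := by
  obtain ⟨a, rfl⟩ := Ideal.Quotient.mk_surjective a
  induction a using MvPolynomial.induction_on with
  | C a =>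
    refine ⟨0, C (C a), ?_⟩
    simp [jj]
    rfl
  | add f g hf hg =>
    obtain ⟨n, b, h⟩ := hf
    obtain ⟨m, c, h'⟩ := hg
    refine ⟨n + m, C X ^ m * b + C X ^ n * c, ?_⟩
    have : jj p (C X) = x p := by simp [jj]
    rw [map_add, map_add, map_mul, map_mul, ← h, ← h', map_pow, map_pow, this]
    ring
  | mul_X f i hf =>
    obtain ⟨n, b, h⟩ := hf
    have hx : jj p (C X) = x p := by simp [jj]
    have hz : jj p X = z p := by simp [jj]
    rw [map_mul]
    fin_cases i
    · refine ⟨n, b * C X, ?_⟩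
      rw [map_mul, hx, ← h]
      change _ * (_ * x p) = _
      ring
    · refine ⟨n + 1, b * Polynomial.aeval X p, ?_⟩
      have : jj p (Polynomial.aeval X p) = Polynomial.aeval (z p) p := by
        rw [Polynomial.aeval_def, Polynomial.hom_eval₂, hz, Polynomial.aeval_def]
        congr 1
        ext a
        simp [jj]
      rw [map_mul, this, ← h, ← xy_eq]
      change _ * (_ * y p) = _
      ring
    · refine ⟨n, b * X, ?_⟩
      rw [map_mul, hz, ← h]
      change _ * (_ * z p) = _
      ring

lemma emb_inj (hp : p ≠ 0) : Function.Injective (emb p) := by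
  rw [injective_iff_map_eq_zero]
  intro a ha
  obtain ⟨n, b, h⟩ := exists_pow a
  have h2 := congrArg (emb p) h
  rw [map_mul, ha, mul_zero, emb_jj] at h2
  have : b = 0 := by
    apply Polynomial.map_injective _ (RatFunc.algebraMap_injective ℂ)
    rw [← h2]; simp
  rw [this, map_zero] at h
  clear h2
  induction n with
  | zero => simpa using h
  | succ n ih =>
    apply ih
    apply x_reg hp
    rw [← h]; ring

lemma hom_ext' (hp : p ≠ 0) {f g : ODan p →ₐ[ℂ] ODan p}
    (hx : f (x p) = x p) (hx' : g (x p) = x p) (hz : f (z p) = g (z p)) : f = g := by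
  refine hom_ext p (hx.trans hx'.symm) ?_ hz
  apply x_cancel hp
  rw [← hx]
  conv_rhs => rw [hx, ← hx']
  rw [← map_mul, ← map_mul, xy_eq, ← Polynomial.aeval_algHom_apply, ← Polynomial.aeval_algHom_apply, hz]

/-- existence of the homomorphism `α_{x, t^(n+1)}` with coefficient -/
lemma exists_hom (n : ℕ) (s : ℂ) : ∃ f : ODan p →ₐ[ℂ] ODan p, f (x p) = x p ∧
    f (z p) = z p + s • x p ^ (n + 1) := by
  obtain ⟨d, hd⟩ : x p ∣ Polynomial.aeval (z p + s • x p ^ (n + 1)) p - Polynomial.aeval (z p) p := by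
    rw [← Polynomial.eval_map_algebraMap, ← Polynomial.eval_map_algebraMap]
    refine dvd_trans ?_ (Polynomial.sub_dvd_eval_sub _ _ _)
    refine ⟨s • x p ^ n, ?_⟩
    rw [add_sub_cancel_left, pow_succ']
    exact (mul_smul_comm s (x p) (x p ^ n)).symm
  refine ⟨lift p (x p) (y p + d) (z p + s • x p ^ (n + 1)) ?_, lift_x .., lift_z ..⟩
  rw [mul_add, ← hd, xy_eq]; ring

lemma exists_equiv (hp : p ≠ 0) (n : ℕ) : ∃ f : AutD p, f (x p) = x p ∧
    f (z p) = z p + x p ^ (n + 1) := by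
  obtain ⟨f, fx, fz⟩ := exists_hom (p := p) n 1
  obtain ⟨g, gx, gz⟩ := exists_hom (p := p) n (-1)
  refine ⟨AlgEquiv.ofAlgHom f g ?_ ?_, fx, by rw [one_smul] at fz; exact fz⟩
  · apply hom_ext' hp
    · simp [gx, fx]
    · simp
    · simp [gz, fz, fx]
  · apply hom_ext' hp
    · simp [gx, fx]
    · simp
    · simp [gz, fz, gx]

variable (p) in
/-- the swap -/
def swapHom : ODan p →ₐ[ℂ] ODan p := lift p (y p) (x p) (z p) (by rw [mul_comm, xy_eq])

variable (p) in
/-- the swap -/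
def swap : AutD p := AlgEquiv.ofAlgHom (swapHom p) (swapHom p)
  (by apply hom_ext <;> simp [swapHom, lift_x, lift_y, lift_z])
  (by apply hom_ext <;> simp [swapHom, lift_x, lift_y, lift_z])

lemma swap_x : swap p (x p) = y p := lift_x p _ _ _ (by rw [mul_comm, xy_eq])
lemma swap_y : swap p (y p) = x p := lift_y p _ _ _ (by rw [mul_comm, xy_eq])
lemma swap_z : swap p (z p) = z p := lift_z p _ _ _ (by rw [mul_comm, xy_eq])

lemma shift_const {F : Type} [Field F] [CharZero F] (u : F[X]) (a : F) (ha : a ≠ 0)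
    (h : taylor a u = u) : u = C (u.eval 0) := by
  have key : ∀ n : ℕ, u.eval (n * a) = u.eval 0 := by
    intro n
    induction n with
    | zero => simp
    | succ n ih =>
      rw [← ih]
      conv_rhs => rw [← h]
      rw [Polynomial.taylor_eval]
      congr 1; push_cast; ring
  apply Polynomial.eq_of_infinite_eval_eq
  refine Set.Infinite.mono (s := Set.range fun n : ℕ => (n : F) * a) ?_ ?_
  · rintro _ ⟨n, rfl⟩
    simp [key]
  · apply Set.infinite_range_of_injective
    intro m n hmn
    simpa [ha] using hmn

lemma shift_lin {F : Type} [Field F] [CharZero F] (w : F[X]) (a u : F) (ha : a ≠ 0)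
    (h : taylor a w = w + C u) : ∃ A B, w = C A * X + C B := by
  have h1 : taylor a (derivative w) = derivative w := by
    have := congrArg derivative h
    rw [taylor_apply, derivative_comp] at this
    rw [taylor_apply]
    simpa using this
  have h2 := shift_const _ a ha h1
  have h3 : derivative (w - C ((derivative w).eval 0) * X) = 0 := by
    rw [derivative_sub, derivative_C_mul, derivative_X, mul_one, ← h2, sub_self]
  have h4 := Polynomial.natDegree_eq_zero_of_derivative_eq_zero h3
  obtain ⟨B, hB⟩ := Polynomial.natDegree_eq_zero.1 h4
  exact ⟨(derivative w).eval 0, B, by rw [hB, add_sub_cancel]⟩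

lemma emb_shift (hp : p ≠ 0) (α : AutD p) (n : ℕ) (hx : α (x p) = x p)
    (hz : α (z p) = z p + x p ^ n) (a : ODan p) :
    emb p (α a) = taylor (RatFunc.X ^ n) (emb p a) := by
  let t : K[X] →ₐ[ℂ] K[X] := (taylorAlgHom (RatFunc.X ^ n : K)).restrictScalars ℂ
  have ht : ∀ q, t q = taylor (RatFunc.X ^ n : K) q := fun q => rfl
  have : (emb p).comp α.toAlgHom = t.comp (emb p) := by
    have e1 : emb p (α (x p)) = taylor (RatFunc.X ^ n) (emb p (x p)) := by
      rw [hx, emb_x, taylor_C]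
    have e3 : emb p (α (z p)) = taylor (RatFunc.X ^ n) (emb p (z p)) := by
      rw [hz, map_add, map_pow, emb_x, emb_z, taylor_X, C_pow]
    apply hom_ext
    · exact e1
    · have hne : (C RatFunc.X : K[X]) ≠ 0 := by simpa using KX
      apply mul_left_cancel₀ hne
      have hl : ((emb p).comp α.toAlgHom) (x p) = C RatFunc.X := by
        change emb p (α (x p)) = _
        rw [hx, emb_x]
      have hr : (t.comp (emb p)) (x p) = C RatFunc.X := by
        change t (emb p (x p)) = _
        rw [ht, emb_x, taylor_C]
      conv_lhs => rw [← hl]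
      conv_rhs => rw [← hr]
      rw [← map_mul, ← map_mul, xy_eq, ← Polynomial.aeval_algHom_apply,
        ← Polynomial.aeval_algHom_apply]
      congr 1
      congr 1
    · exact e3
  exact DFunLike.congr_fun this a

lemma main_lemma (hp : p ≠ 0) (c α β : AutD p)
    (hx : α (x p) = x p) (hz : α (z p) = z p + x p ^ 1)
    (hx' : β (x p) = x p) (hz' : β (z p) = z p + x p ^ 2)
    (h1 : ∀ a, α (c a) = c (α a)) (h2 : ∀ a, β (c a) = c (β a)) :
    c (x p) = x p ∧ ∃ B, emb p (c (z p)) = X + C B := by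
  have s1 := emb_shift hp α 1 hx hz
  have s2 := emb_shift hp β 2 hx' hz'
  obtain ⟨u, hu⟩ : ∃ u, emb p (c (x p)) = C u := by
    refine ⟨_, shift_const _ _ (pow_ne_zero 1 KX) ?_⟩
    rw [← s1, h1, hx]
  have w1 : taylor (RatFunc.X ^ 1) (emb p (c (z p))) = emb p (c (z p)) + C u := by
    rw [← s1, h1, hz, ← hu]; simp
  have w2 : taylor (RatFunc.X ^ 2) (emb p (c (z p))) = emb p (c (z p)) + C (u ^ 2) := by
    rw [← s2, h2, hz', C_pow, ← hu]; simp
  obtain ⟨A, B, hAB⟩ := shift_lin _ _ _ (pow_ne_zero 1 KX) w1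
  rw [hAB] at w1 w2
  have e1 : A * RatFunc.X = u := by
    have := congrArg (Polynomial.eval 0) w1
    simp [taylor_eval] at this
    linear_combination this
  have e2 : A * RatFunc.X ^ 2 = u ^ 2 := by
    have := congrArg (Polynomial.eval 0) w2
    simp [taylor_eval] at this
    linear_combination this
  have hu0 : u ≠ 0 := by
    rintro rfl
    have h3 : c (x p) = 0 := emb_inj hp (by rw [hu]; simp)
    have h4 : x p = 0 := by simpa using h3
    have h5 := emb_x (p := p)
    rw [h4, map_zero] at h5
    exact KX (by simpa using h5.symm)
  have e3 : u = RatFunc.X := by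
    apply mul_left_cancel₀ hu0
    rw [← pow_two, ← e2, ← e1]; ring
  refine ⟨emb_inj hp (by rw [hu, e3, emb_x]), B, ?_⟩
  have e4 : A = 1 := by
    apply mul_right_cancel₀ KX
    rw [e1, e3, one_mul]
  rw [hAB, e4]; simp

lemma centralizer_trivial (hp3 : 3 ≤ p.natDegree) (c : AutD p)
    (hcx : ∀ α ∈ UxSet p, ∀ a, α (c a) = c (α a))
    (hcy : ∀ α ∈ UySet p, ∀ a, α (c a) = c (α a)) : c = 1 := by
  have hp : p ≠ 0 := by rintro rfl; simp at hp3
  obtain ⟨α, ax, az⟩ := exists_equiv hp 0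
  obtain ⟨β, bx, bz⟩ := exists_equiv hp 1
  have ss : ∀ a, swap p (swap p a) = a := (swap p).apply_symm_apply
  obtain ⟨cx, B, hB⟩ := main_lemma hp c α β ax az bx bz
    (hcx α ⟨X ^ 1, by simp, ax, by rw [aeval_X_pow]; exact az⟩)
    (hcx β ⟨X ^ 2, by simp, bx, by rw [aeval_X_pow]; exact bz⟩)
  have conjmem : ∀ (α : AutD p) (n : ℕ), α (x p) = x p → α (z p) = z p + x p ^ (n + 1) →
      (swap p * α * swap p) ∈ UySet p := by
    intro α n ax az
    refine ⟨X ^ (n + 1), by simp, ?_, ?_⟩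
    · change swap p (α (swap p (y p))) = y p
      rw [swap_y, ax, swap_x]
    · change swap p (α (swap p (z p))) = z p + _
      rw [swap_z, az, map_add, map_pow, swap_z, swap_x]
      simp; rfl
  have hcomm : ∀ α : AutD p, (swap p * α * swap p) ∈ UySet p →
      ∀ a, α ((swap p * c * swap p) a) = (swap p * c * swap p) (α a) := by
    intro α hα a
    have := congrArg (swap p) (hcy _ hα (swap p a))
    simp only [AlgEquiv.mul_apply, ss] at this ⊢
    exact this
  obtain ⟨cy, -⟩ := main_lemma hp (swap p * c * swap p) α β ax az bx bz
    (hcomm _ (conjmem α 0 ax az)) (hcomm _ (conjmem β 1 bx bz))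
  have cy' : c (y p) = y p := by
    have := congrArg (swap p) cy
    simp only [AlgEquiv.mul_apply, ss, swap_x] at this
    exact this
  have e1 : Polynomial.aeval (X + C B : K[X]) p = Polynomial.aeval (X : K[X]) p := by
    rw [← hB, ← emb_z (p := p), Polynomial.aeval_algHom_apply, Polynomial.aeval_algHom_apply (emb p),
      Polynomial.aeval_algHom_apply c, ← xy_eq, map_mul, cx, cy']
  have e2 : ∀ q : K[X], Polynomial.aeval q p = (p.map (algebraMap ℂ K)).comp q := by
    intro q
    rw [Polynomial.comp, Polynomial.eval₂_map]
    rfl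
  have hB0 : B = 0 := by
    by_contra hne
    have h3 := shift_const (p.map (algebraMap ℂ K)) B hne (by
      rw [taylor_apply, ← e2, e1, e2, comp_X])
    have h4 := congrArg natDegree h3
    rw [natDegree_C, natDegree_map] at h4
    omega
  have cz : c (z p) = z p := emb_inj hp (by rw [hB, hB0, emb_z]; simp)
  have := hom_ext p (f := c.toAlgHom) (g := AlgHom.id ℂ _) cx cy' cz
  ext a
  exact DFunLike.congr_fun this a

lemma conj_Ux {t u : AutD p} (ht : t ∈ TSet p) (hu : u ∈ UxSet p) : t * u * t⁻¹ ∈ UxSet p := by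
  obtain ⟨s, tx, ty, tz⟩ := ht
  obtain ⟨f, f0, ux, uz⟩ := hu
  change t (x p) = (s : ℂ) • x p at tx
  change t (z p) = z p at tz
  change u (x p) = x p at ux
  change u (z p) = z p + aeval (x p) f at uz
  have ti : t⁻¹ (x p) = (s : ℂ)⁻¹ • x p := by
    apply t.injective
    rw [map_smul, tx, smul_smul, inv_mul_cancel₀ s.ne_zero, one_smul]
    exact t.apply_symm_apply _
  have tzi : t⁻¹ (z p) = z p := by
    apply t.injective
    rw [tz]
    exact t.apply_symm_apply _
  refine ⟨f.comp (C (s : ℂ) * X), ?_, ?_, ?_⟩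
  · rw [coeff_zero_eq_eval_zero] at f0 ⊢
    simp [f0]
  · change t (u (t⁻¹ (x p))) = x p
    rw [ti, map_smul, map_smul, ux, tx, smul_smul, inv_mul_cancel₀ s.ne_zero, one_smul]
  · change t (u (t⁻¹ (z p))) = z p + aeval (x p) _
    rw [tzi, uz, map_add, tz, ← Polynomial.aeval_algHom_apply, tx, aeval_comp]
    simp only [map_mul, aeval_C, aeval_X, ← Algebra.smul_def]

lemma conj_Uy {t u : AutD p} (ht : t ∈ TSet p) (hu : u ∈ UySet p) : t * u * t⁻¹ ∈ UySet p := by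
  obtain ⟨s', tx', ty, tz⟩ := ht
  obtain ⟨f, f0, ux, uz⟩ := hu
  generalize s'⁻¹ = s at ty
  change t (y p) = (s : ℂ) • y p at ty
  change t (z p) = z p at tz
  change u (y p) = y p at ux
  change u (z p) = z p + aeval (y p) f at uz
  have ti : t⁻¹ (y p) = (s : ℂ)⁻¹ • y p := by
    apply t.injective
    rw [map_smul, ty, smul_smul, inv_mul_cancel₀ s.ne_zero, one_smul]
    exact t.apply_symm_apply _
  have tzi : t⁻¹ (z p) = z p := by
    apply t.injective
    rw [tz]
    exact t.apply_symm_apply _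
  refine ⟨f.comp (C (s : ℂ) * X), ?_, ?_, ?_⟩
  · rw [coeff_zero_eq_eval_zero] at f0 ⊢
    simp [f0]
  · change t (u (t⁻¹ (y p))) = y p
    rw [ti, map_smul, map_smul, ux, ty, smul_smul, inv_mul_cancel₀ s.ne_zero, one_smul]
  · change t (u (t⁻¹ (z p))) = z p + aeval (y p) _
    rw [tzi, uz, map_add, tz, ← Polynomial.aeval_algHom_apply, ty, aeval_comp]
    simp only [map_mul, aeval_C, aeval_X, ← Algebra.smul_def]

end Dan

/-- Let `p` be squarefree of degree at least `3`, let `G = ⟨U_x, U_y, T⟩` and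
`U(D_p) = ⟨U_x, U_y⟩`.  Any group automorphism of `G` fixing `U(D_p)` pointwise is the
identity. -/
theorem aut_fixing_U_is_identity (p : ℂ[X])
    (hsp : Squarefree p) (hp3 : 3 ≤ p.natDegree)
    (Ux Uy T : Subgroup (AutD p))
    (hUx : (Ux : Set (AutD p)) = UxSet p)
    (hUy : (Uy : Set (AutD p)) = UySet p)
    (hT : (T : Set (AutD p)) = TSet p)
    (φ : ↥(Ux ⊔ Uy ⊔ T) ≃* ↥(Ux ⊔ Uy ⊔ T))
    (hφ : ∀ g : ↥(Ux ⊔ Uy ⊔ T), (g : AutD p) ∈ Ux ⊔ Uy → φ g = g) :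
    ∀ g : ↥(Ux ⊔ Uy ⊔ T), φ g = g := by
  have mx : ∀ {u}, u ∈ Ux ↔ u ∈ UxSet p := fun {u} => by rw [← hUx]; rfl
  have my : ∀ {u}, u ∈ Uy ↔ u ∈ UySet p := fun {u} => by rw [← hUy]; rfl
  have mt : ∀ {u}, u ∈ T ↔ u ∈ TSet p := fun {u} => by rw [← hT]; rfl
  have key : ∀ t : ↥(Ux ⊔ Uy ⊔ T), (t : AutD p) ∈ T → φ t = t := by
    intro t ht
    have comm : ∀ u : AutD p, u ∈ Ux ⊔ Uy → (t : AutD p) * u * (t : AutD p)⁻¹ ∈ Ux ⊔ Uy →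
        ∀ a, u (((t⁻¹ * φ t : ↥(Ux ⊔ Uy ⊔ T)) : AutD p) a)
          = ((t⁻¹ * φ t : ↥(Ux ⊔ Uy ⊔ T)) : AutD p) (u a) := by
      intro u hu hu' a
      let v : ↥(Ux ⊔ Uy ⊔ T) := ⟨u, le_sup_left (a := Ux ⊔ Uy) hu⟩
      have h1 : φ v = v := hφ v hu
      have h2 : φ (t * v * t⁻¹) = t * v * t⁻¹ := hφ _ hu'
      rw [map_mul, map_mul, map_inv, h1] at h2
      have h3 : v * (t⁻¹ * φ t) = (t⁻¹ * φ t) * v := by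
        have : φ t * v = t * v * t⁻¹ * φ t := by rw [← h2]; group
        rw [mul_assoc t⁻¹, this]; group
      exact DFunLike.congr_fun (congrArg Subtype.val h3) a
    have h := Dan.centralizer_trivial hp3 ((t⁻¹ * φ t : ↥(Ux ⊔ Uy ⊔ T)) : AutD p)
      (fun α hα => comm α (le_sup_left (a := Ux) (mx.2 hα))
        (le_sup_left (a := Ux) (mx.2 (Dan.conj_Ux (mt.1 ht) hα))))
      (fun α hα => comm α (le_sup_right (a := Ux) (my.2 hα))
        (le_sup_right (a := Ux) (my.2 (Dan.conj_Uy (mt.1 ht) hα))))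
    have h' : t⁻¹ * φ t = 1 := Subtype.ext h
    exact (inv_mul_eq_one.1 h').symm
  let E : Subgroup (AutD p) :=
    (MonoidHom.eqLocus φ.toMonoidHom (MonoidHom.id _)).map (Ux ⊔ Uy ⊔ T).subtype
  have hE : Ux ⊔ Uy ⊔ T ≤ E := by
    apply sup_le
    · intro u hu
      exact ⟨⟨u, le_sup_left (a := Ux ⊔ Uy) hu⟩, hφ _ hu, rfl⟩
    · intro u hu
      exact ⟨⟨u, le_sup_right (a := Ux ⊔ Uy) hu⟩, key _ hu, rfl⟩
  intro g
  obtain ⟨g', h1, h2⟩ := hE g.2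
  have : g' = g := Subtype.ext h2
  subst this
  exact h1

end
end

section
/- Let p ∈ ℂ[z] be a polynomial of degree at least 3 without multiple roots. Then the subgroup of Aut_ℂ(O(D_p)) generated by U_x and U_y is the free product of U_x and U_y: the canonical group homomorphism from the free product U_x ∗ U_y to Aut_ℂ(O(D_p)) is injective. -/
open Polynomial

set_option synthInstance.maxHeartbeats 400000
set_option maxHeartbeats 800000

noncomputable section

lemma deg_step (p f x y z y' : ℂ[X]) (hp3 : 3 ≤ p.natDegree) (hf : f ≠ 0) (hf0 : f.coeff 0 = 0)
    (hz : 0 < z.natDegree) (hxz : z.natDegree < x.natDegree)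
    (h' : x * y' = p.comp (z + f.comp x)) :
    0 < (z + f.comp x).natDegree ∧ (z + f.comp x).natDegree < y'.natDegree ∧
      x.natDegree ≤ (z + f.comp x).natDegree := by
  have hn : 1 ≤ f.natDegree := by
    by_contra hcon
    have h0 : f.natDegree = 0 := by omega
    rw [natDegree_eq_zero] at h0
    obtain ⟨c, rfl⟩ := h0
    simp at hf0
    simp [hf0] at hf
  have hge : x.natDegree ≤ f.natDegree * x.natDegree := Nat.le_mul_of_pos_left _ hn
  have hdeg : (z + f.comp x).natDegree = f.natDegree * x.natDegree := by
    rw [natDegree_add_eq_right_of_natDegree_lt] <;> rw [natDegree_comp]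
    omega
  have hR : (p.comp (z + f.comp x)).natDegree = p.natDegree * (f.natDegree * x.natDegree) := by
    rw [natDegree_comp, hdeg]
  have hmul : 3 * (f.natDegree * x.natDegree) ≤ p.natDegree * (f.natDegree * x.natDegree) :=
    Nat.mul_le_mul_right _ hp3
  have hne : x * y' ≠ 0 := by
    intro h0
    rw [← h', h0, natDegree_zero] at hR
    omega
  rw [← h', natDegree_mul (left_ne_zero_of_mul hne) (right_ne_zero_of_mul hne)] at hR
  omega

lemma exists_lin_factor (P : ℂ[X]) (h : 1 ≤ P.natDegree) :
    ∃ L Q : ℂ[X], P = L * Q ∧ L.natDegree = 1 ∧ P.natDegree = Q.natDegree + 1 := by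
  have hd : P.degree ≠ 0 := by
    intro h0
    have h00 : P.natDegree = 0 := natDegree_eq_zero_iff_degree_le_zero.mpr h0.le
    omega
  obtain ⟨s, hs⟩ := IsAlgClosed.exists_root P hd
  obtain ⟨Q, hQ⟩ := dvd_iff_isRoot.mpr hs
  have hQ0 : Q ≠ 0 := by
    rintro rfl
    simp [hQ] at h
  refine ⟨X - C s, Q, hQ, natDegree_X_sub_C s, ?_⟩
  rw [hQ, natDegree_mul (X_sub_C_ne_zero s) hQ0, natDegree_X_sub_C, add_comm]

/-- Polynomial points of the surface. -/
def Pt (p : ℂ[X]) : Type := ODan p →ₐ[ℂ] ℂ[X]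

instance (p : ℂ[X]) : MulAction (AutD p) (Pt p) where
  smul g P := AlgHom.comp P (g⁻¹ : AutD p).toAlgHom
  one_smul P := by
    apply AlgHom.ext
    intro u
    rfl
  mul_smul g h P := by
    apply AlgHom.ext
    intro u
    rfl

/-- Coordinates of points. -/
def Pt.ev {p : ℂ[X]} (P : Pt p) : ODan p →ₐ[ℂ] ℂ[X] := P

lemma Pt.smul_ev {p : ℂ[X]} (g : AutD p) (P : Pt p) (u : ODan p) :
    (g • P).ev u = P.ev (g⁻¹ u) := rfl

abbrev mkD (p : ℂ[X]) (u : P3) : ODan p := Ideal.Quotient.mk (relIdeal p) u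

lemma mkD_rel (p : ℂ[X]) : mkD p xP * mkD p yP = aeval (mkD p zP) p := by
  have h : mkD p (xP * yP - aeval zP p) = 0 :=
    Ideal.Quotient.eq_zero_iff_mem.mpr (Ideal.subset_span rfl)
  have h2 : mkD p (aeval zP p) = aeval (mkD p zP) p :=
    (Polynomial.aeval_algHom_apply (Ideal.Quotient.mkₐ ℂ (relIdeal p)) zP p).symm
  rw [← h2, ← sub_eq_zero, ← h]
  simp [mkD]

lemma Pt.rel {p : ℂ[X]} (P : Pt p) :
    P.ev (mkD p xP) * P.ev (mkD p yP) = p.comp (P.ev (mkD p zP)) := by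
  rw [← map_mul, mkD_rel, ← Polynomial.aeval_algHom_apply]
  rfl

lemma Pt.exists_mk {p : ℂ[X]} (x y z : ℂ[X]) (h : x * y = p.comp z) :
    ∃ P : Pt p, P.ev (mkD p xP) = x ∧ P.ev (mkD p yP) = y ∧ P.ev (mkD p zP) = z := by
  let φ : P3 →ₐ[ℂ] ℂ[X] := MvPolynomial.aeval ![x, y, z]
  have hx : φ xP = x := by simp [φ, xP]
  have hy : φ yP = y := by simp [φ, yP]
  have hz : φ zP = z := by simp [φ, zP]
  have hφ : ∀ a ∈ relIdeal p, φ a = 0 := by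
    intro a ha
    obtain ⟨b, rfl⟩ := Ideal.mem_span_singleton'.mp ha
    rw [map_mul, map_sub, map_mul, ← Polynomial.aeval_algHom_apply, hx, hy, hz, h]
    simp [Polynomial.comp, Polynomial.aeval_def]
  exact ⟨Ideal.Quotient.liftₐ (relIdeal p) φ hφ, hx, hy, hz⟩

lemma nzd_aux (p : ℂ[X]) (hp : p ≠ 0) (v w : P3) (i : Fin 3) (hi : i ≠ 2)
    (hv : v = MvPolynomial.X i) (hw : xP * yP = v * w)
    (u : ODan p) (h : mkD p v * u = 0) : u = 0 := by
  obtain ⟨g, rfl⟩ := Ideal.Quotient.mk_surjective u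
  rw [← map_mul, Ideal.Quotient.eq_zero_iff_mem] at h
  obtain ⟨b, hb⟩ := Ideal.mem_span_singleton'.mp h
  have hpr : Prime v := by
    rw [hv]
    exact MvPolynomial.X_prime
  have hdvd : v ∣ b * aeval zP p := by
    refine ⟨b * w - g, ?_⟩
    linear_combination (-1 : P3) * hb + b * hw
  have hnd : ¬ v ∣ aeval zP p := by
    rintro ⟨c, hc⟩
    have := congrArg (MvPolynomial.aeval (R := ℂ) (fun j : Fin 3 => if j = 2 then (X : ℂ[X]) else 0)) hc
    rw [← Polynomial.aeval_algHom_apply, map_mul, hv] at this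
    simp [zP, hi] at this
    exact hp this
  obtain ⟨c, rfl⟩ := (hpr.dvd_or_dvd hdvd).resolve_right hnd
  apply Ideal.Quotient.eq_zero_iff_mem.mpr
  refine Ideal.mem_span_singleton'.mpr ⟨c, ?_⟩
  apply mul_left_cancel₀ hpr.ne_zero
  linear_combination hb

lemma aut_eq_one (p : ℂ[X]) (g : AutD p) (hx : g (mkD p xP) = mkD p xP)
    (hy : g (mkD p yP) = mkD p yP) (hz : g (mkD p zP) = mkD p zP) : g = 1 := by
  have : g.toAlgHom.comp (Ideal.Quotient.mkₐ ℂ (relIdeal p)) = Ideal.Quotient.mkₐ ℂ (relIdeal p) := by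
    apply MvPolynomial.algHom_ext
    intro i
    fin_cases i
    · exact hx
    · exact hy
    · exact hz
  apply AlgEquiv.ext
  intro u
  obtain ⟨a, rfl⟩ := Ideal.Quotient.mk_surjective u
  exact congrArg (fun F => F a) this

lemma ux_one (p : ℂ[X]) (hp : p ≠ 0) (g : AutD p) (hx : g (mkD p xP) = mkD p xP)
    (hz : g (mkD p zP) = mkD p zP) : g = 1 := by
  refine aut_eq_one p g hx ?_ hz
  have h := congrArg g (mkD_rel p)
  rw [map_mul, ← Polynomial.aeval_algHom_apply, hx, hz, ← mkD_rel] at h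
  rw [← sub_eq_zero]
  apply nzd_aux p hp xP yP 0 (by decide) rfl rfl
  rw [mul_sub, h, sub_self]

lemma uy_one (p : ℂ[X]) (hp : p ≠ 0) (g : AutD p) (hy : g (mkD p yP) = mkD p yP)
    (hz : g (mkD p zP) = mkD p zP) : g = 1 := by
  refine aut_eq_one p g ?_ hy hz
  have h := congrArg g (mkD_rel p)
  rw [map_mul, ← Polynomial.aeval_algHom_apply, hy, hz, ← mkD_rel] at h
  rw [← sub_eq_zero]
  apply nzd_aux p hp yP xP 1 (by decide) rfl (mul_comm _ _)
  rw [mul_sub, mul_comm, h, mul_comm, sub_self]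

/-- Degrees of the coordinates. -/
def dx {p : ℂ[X]} (P : Pt p) : ℕ := (P.ev (mkD p xP)).natDegree
def dy {p : ℂ[X]} (P : Pt p) : ℕ := (P.ev (mkD p yP)).natDegree
def dz {p : ℂ[X]} (P : Pt p) : ℕ := (P.ev (mkD p zP)).natDegree

lemma ux_move (p : ℂ[X]) (hp3 : 3 ≤ p.natDegree) (g : AutD p) (hg : g⁻¹ ∈ UxSet p) (h1 : g ≠ 1)
    (P : Pt p) (hz : 0 < dz P) (hx : dz P < dx P) :
    0 < dz (g • P) ∧ dz (g • P) < dy (g • P) ∧ dx (g • P) ≤ dz (g • P) := by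
  obtain ⟨f, hf0, hgx, hgz⟩ := hg
  have hf : f ≠ 0 := by
    rintro rfl
    apply h1
    rw [← inv_eq_one]
    refine ux_one p ?_ _ hgx (by simpa using hgz)
    rintro rfl
    simp at hp3
  have ex : (g • P).ev (mkD p xP) = P.ev (mkD p xP) := by rw [Pt.smul_ev, hgx]
  have ez : (g • P).ev (mkD p zP) = P.ev (mkD p zP) + f.comp (P.ev (mkD p xP)) := by
    rw [Pt.smul_ev, hgz, map_add, ← Polynomial.aeval_algHom_apply]
    rfl
  have hr := (g • P).rel
  rw [ex, ez] at hr
  have := deg_step p f _ (P.ev (mkD p yP)) _ _ hp3 hf hf0 hz hx hr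
  unfold dz dx dy
  rw [ex, ez]
  exact this

lemma uy_move (p : ℂ[X]) (hp3 : 3 ≤ p.natDegree) (g : AutD p) (hg : g⁻¹ ∈ UySet p) (h1 : g ≠ 1)
    (P : Pt p) (hz : 0 < dz P) (hx : dz P < dy P) :
    0 < dz (g • P) ∧ dz (g • P) < dx (g • P) ∧ dy (g • P) ≤ dz (g • P) := by
  obtain ⟨f, hf0, hgx, hgz⟩ := hg
  have hf : f ≠ 0 := by
    rintro rfl
    apply h1
    rw [← inv_eq_one]
    refine uy_one p ?_ _ hgx (by simpa using hgz)
    rintro rfl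
    simp at hp3
  have ex : (g • P).ev (mkD p yP) = P.ev (mkD p yP) := by rw [Pt.smul_ev, hgx]
  have ez : (g • P).ev (mkD p zP) = P.ev (mkD p zP) + f.comp (P.ev (mkD p yP)) := by
    rw [Pt.smul_ev, hgz, map_add, ← Polynomial.aeval_algHom_apply]
    rfl
  have hr := (g • P).rel
  rw [ex, ez, mul_comm] at hr
  have := deg_step p f _ (P.ev (mkD p xP)) _ _ hp3 hf hf0 hz hx hr
  unfold dz dx dy
  rw [ex, ez]
  exact this

/-- The ping-pong sets. -/
def pingSet (p : ℂ[X]) : Fin 3 → Set (Pt p)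
  | 0 => {P | 0 < dz P ∧ dz P < dy P ∧ dx P ≤ dz P}
  | 1 => {P | 0 < dz P ∧ dz P < dx P ∧ dy P ≤ dz P}
  | 2 => {P | 0 < dz P ∧ dz P < dx P ∧ dz P < dy P}

lemma pingSet_nonempty (p : ℂ[X]) (hp3 : 3 ≤ p.natDegree) (i : Fin 3) :
    (pingSet p i).Nonempty := by
  fin_cases i
  · obtain ⟨P, h1, h2, h3⟩ := Pt.exists_mk (p := p) 1 p X (by simp)
    refine ⟨P, ?_⟩
    simp only [pingSet, dx, dy, dz, Set.mem_ofPred_eq, h1, h2, h3, natDegree_X, natDegree_one]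
    omega
  · obtain ⟨P, h1, h2, h3⟩ := Pt.exists_mk (p := p) p 1 X (by simp)
    refine ⟨P, ?_⟩
    simp only [pingSet, dx, dy, dz, Set.mem_ofPred_eq, h1, h2, h3, natDegree_X, natDegree_one]
    omega
  · have hd : (p.comp (X ^ 2)).natDegree = p.natDegree * 2 := by
      rw [natDegree_comp, natDegree_X_pow]
    obtain ⟨L1, Q1, e1, l1, d1⟩ := exists_lin_factor (p.comp (X ^ 2)) (by omega)
    obtain ⟨L2, Q2, e2, l2, d2⟩ := exists_lin_factor Q1 (by omega)
    obtain ⟨L3, Q3, e3, l3, d3⟩ := exists_lin_factor Q2 (by omega)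
    have n1 : L1 ≠ 0 := by rintro rfl; simp at l1
    have n2 : L2 ≠ 0 := by rintro rfl; simp at l2
    have n3 : L3 ≠ 0 := by rintro rfl; simp at l3
    obtain ⟨P, h1, h2, h3⟩ := Pt.exists_mk (p := p) (L1 * L2 * L3) Q3 (X ^ 2)
      (by rw [e1, e2, e3]; ring)
    refine ⟨P, ?_⟩
    simp only [pingSet, dx, dy, dz, Set.mem_ofPred_eq, h1, h2, h3, natDegree_X_pow,
      natDegree_mul (mul_ne_zero n1 n2) n3, natDegree_mul n1 n2]
    omega

lemma pingSet_disj (p : ℂ[X]) : Pairwise (Function.onFun Disjoint (pingSet p)) := by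
  intro i j hij
  rw [Function.onFun, Set.disjoint_left]
  intro P
  fin_cases i <;> fin_cases j <;>
    simp only [pingSet, Set.mem_ofPred_eq, ne_eq, not_true_eq_false] at hij ⊢ <;> omega

/-- The three groups. -/
def fam {p : ℂ[X]} (Ux Uy : Subgroup (AutD p)) : Fin 3 → Subgroup (AutD p)
  | 0 => Ux
  | 1 => Uy
  | 2 => ⊥

open scoped Pointwise in
lemma famlift_inj (p : ℂ[X]) (hp3 : 3 ≤ p.natDegree)
    (Ux Uy : Subgroup (AutD p))
    (hUx : (Ux : Set (AutD p)) = UxSet p)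
    (hUy : (Uy : Set (AutD p)) = UySet p) :
    Function.Injective (Monoid.CoprodI.lift (fun i => (fam Ux Uy i).subtype)) := by
  refine Monoid.CoprodI.lift_injective_of_ping_pong (fun i => (fam Ux Uy i).subtype)
    (Or.inl (by simp)) (pingSet p) (pingSet_nonempty p hp3) (pingSet_disj p) ?_
  intro i j hij h hne
  obtain ⟨g, hg⟩ := h
  have hg1 : g ≠ 1 := fun h => hne (Subtype.ext h)
  rintro _ ⟨P, hP, rfl⟩
  change g • P ∈ pingSet p i
  have hi : g⁻¹ ∈ fam Ux Uy i := inv_mem hg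
  fin_cases i
  · have hU : g⁻¹ ∈ UxSet p := hUx ▸ hi
    have key : 0 < dz P ∧ dz P < dx P := by
      fin_cases j
      · exact absurd rfl hij
      · exact ⟨hP.1, hP.2.1⟩
      · exact ⟨hP.1, hP.2.1⟩
    exact ux_move p hp3 g hU hg1 P key.1 key.2
  · have hU : g⁻¹ ∈ UySet p := hUy ▸ hi
    have key : 0 < dz P ∧ dz P < dy P := by
      fin_cases j
      · exact ⟨hP.1, hP.2.1⟩
      · exact absurd rfl hij
      · exact ⟨hP.1, hP.2.2⟩
    exact uy_move p hp3 g hU hg1 P key.1 key.2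
  · exact absurd (Subgroup.mem_bot.mp hg) hg1

/-- Let `p` be squarefree of degree at least `3`.  The subgroup of `Aut_ℂ(O(D_p))`
generated by `U_x` and `U_y` is their free product: the canonical homomorphism from
the free product `U_x ∗ U_y` to `Aut_ℂ(O(D_p))` is injective. -/
theorem free_product_injective (p : ℂ[X])
    (hsp : Squarefree p) (hp3 : 3 ≤ p.natDegree)
    (Ux Uy : Subgroup (AutD p))
    (hUx : (Ux : Set (AutD p)) = UxSet p)
    (hUy : (Uy : Set (AutD p)) = UySet p) :
    Function.Injective (Monoid.Coprod.lift Ux.subtype Uy.subtype) := by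
  let toI : Monoid.Coprod Ux Uy →* Monoid.CoprodI (fun i => fam Ux Uy i) :=
    Monoid.Coprod.lift (Monoid.CoprodI.of (M := fun i => fam Ux Uy i) (i := 0))
      (Monoid.CoprodI.of (M := fun i => fam Ux Uy i) (i := 1))
  let back : ∀ i, fam Ux Uy i →* Monoid.Coprod Ux Uy := fun i => match i with
    | 0 => (Monoid.Coprod.inl : Ux →* Monoid.Coprod Ux Uy)
    | 1 => (Monoid.Coprod.inr : Uy →* Monoid.Coprod Ux Uy)
    | 2 => 1
  have hleft : (Monoid.CoprodI.lift back).comp toI = MonoidHom.id _ := by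
    apply Monoid.Coprod.hom_ext
    · ext u
      exact Monoid.CoprodI.lift_of (M := fun i => fam Ux Uy i) (i := 0) back u
    · ext u
      exact Monoid.CoprodI.lift_of (M := fun i => fam Ux Uy i) (i := 1) back u
  have hcomp : Monoid.Coprod.lift Ux.subtype Uy.subtype =
      (Monoid.CoprodI.lift (fun i => (fam Ux Uy i).subtype)).comp toI := by
    apply Monoid.Coprod.hom_ext
    · apply MonoidHom.ext
      intro u
      exact (Monoid.CoprodI.lift_of (M := fun i => fam Ux Uy i) (i := 0)
        (fun i => (fam Ux Uy i).subtype) u).symm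
    · apply MonoidHom.ext
      intro u
      exact (Monoid.CoprodI.lift_of (M := fun i => fam Ux Uy i) (i := 1)
        (fun i => (fam Ux Uy i).subtype) u).symm
  have hinj : Function.Injective toI :=
    Function.LeftInverse.injective (g := Monoid.CoprodI.lift back)
      (fun u => DFunLike.congr_fun hleft u)
  rw [hcomp, MonoidHom.coe_comp]
  exact (famlift_inj p hp3 Ux Uy hUx hUy).comp hinj

end
end

section
/- Let p ∈ ℂ[z] be a polynomial of degree at least 2 without multiple roots and let R := O(D_p). Then the second exterior power ⋀²_R Ω_{R/ℂ} is a free R-module of rank 1; moreover it admits a generator ω_p satisfying p′(z)·ω_p = dx∧dy, x·ω_p = dx∧dz and y·ω_p = −dy∧dz. -/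
open Polynomial

set_option synthInstance.maxHeartbeats 400000
set_option maxHeartbeats 800000

noncomputable section

/-- The wedge `a ∧ b` of two elements of a module `M`, as an element of the second
exterior power `⋀[R]^2 M`. -/
def wedge2 (R : Type*) [CommRing R] {M : Type*} [AddCommGroup M] [Module R M]
    (a b : M) : ⋀[R]^2 M :=
  ⟨ExteriorAlgebra.ιMulti R 2 ![a, b],
    ExteriorAlgebra.ιMulti_range R 2 (Set.mem_range_self ![a, b])⟩

/-- `dx` as an element of `Ω_{O(D_p)/ℂ}`. -/
def dX (p : ℂ[X]) : Ω[(ODan p)⁄ℂ] :=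
  KaehlerDifferential.D ℂ (ODan p) (Ideal.Quotient.mk (relIdeal p) xP)
/-- `dy` as an element of `Ω_{O(D_p)/ℂ}`. -/
def dY (p : ℂ[X]) : Ω[(ODan p)⁄ℂ] :=
  KaehlerDifferential.D ℂ (ODan p) (Ideal.Quotient.mk (relIdeal p) yP)
/-- `dz` as an element of `Ω_{O(D_p)/ℂ}`. -/
def dZ (p : ℂ[X]) : Ω[(ODan p)⁄ℂ] :=
  KaehlerDifferential.D ℂ (ODan p) (Ideal.Quotient.mk (relIdeal p) zP)

section Generic

variable {R : Type*} [CommRing R] {M : Type*} [AddCommGroup M] [Module R M]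

lemma wedge2_eq (a b : M) : wedge2 R a b = exteriorPower.ιMulti R 2 ![a, b] := rfl

lemma wedge2_add_left (a a' b : M) : wedge2 R (a + a') b = wedge2 R a b + wedge2 R a' b := by
  simp only [wedge2_eq]
  exact (exteriorPower.ιMulti R 2 (M := M)).toMultilinearMap.cons_add ![b] a a'

lemma wedge2_smul_left (r : R) (a b : M) : wedge2 R (r • a) b = r • wedge2 R a b := by
  simp only [wedge2_eq]
  exact (exteriorPower.ιMulti R 2 (M := M)).toMultilinearMap.cons_smul ![b] r a

lemma wedge2_self (a : M) : wedge2 R a a = 0 := by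
  rw [wedge2_eq]
  exact (exteriorPower.ιMulti R 2 (M := M)).map_eq_zero_of_eq _
    (i := 0) (j := 1) (by simp) (by simp)

lemma wedge2_swap (a b : M) : wedge2 R a b = -wedge2 R b a := by
  rw [wedge2_eq, wedge2_eq]
  have h := (exteriorPower.ιMulti R 2 (M := M)).map_swap ![b, a] (i := 0) (j := 1) (by simp)
  rw [← h]
  congr 1
  ext i
  fin_cases i <;> simp

/-- The `2 × 2` determinant of two functionals, as a functional on the exterior square. -/
def detForm (f g : M →ₗ[R] R) : ⋀[R]^2 M →ₗ[R] R :=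
  exteriorPower.alternatingMapLinearEquiv
    ((Matrix.detRowAlternating (R := R) (n := Fin 2)).compLinearMap (LinearMap.pi ![f, g]))

lemma detForm_wedge2 (f g : M →ₗ[R] R) (a b : M) :
    detForm f g (wedge2 R a b) = f a * g b - g a * f b := by
  rw [wedge2_eq, detForm, exteriorPower.alternatingMapLinearEquiv_apply_ιMulti]
  simp only [AlternatingMap.compLinearMap_apply]
  exact (Matrix.det_fin_two _).trans (by simp)

lemma generic_main (u v w : M) (x y q α β : R) (hone : α * (x * y) + β * q = 1)
    (hspan : Submodule.span R (Set.range ![u, v, w]) = ⊤)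
    (hrel : x • v + y • u = q • w)
    (f g h : M →ₗ[R] R)
    (fu : f u = 0) (fv : f v = q) (fw : f w = x)
    (gu : g u = -q) (gv : g v = 0) (gw : g w = -y)
    (hu : h u = -x) (hv : h v = y) (hw : h w = 0) :
    Nonempty ((⋀[R]^2 M) ≃ₗ[R] R) ∧
    ∃ ω : ⋀[R]^2 M, Submodule.span R {ω} = ⊤ ∧ q • ω = wedge2 R u v ∧
      x • ω = wedge2 R u w ∧ y • ω = -(wedge2 R v w) := by
  have r1 : x • wedge2 R u v = q • wedge2 R u w := by
    have := congrArg (fun t => wedge2 R t u) hrel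
    simp only [wedge2_add_left, wedge2_smul_left, wedge2_self] at this
    rw [wedge2_swap v u, wedge2_swap w u] at this
    simpa using this
  have r2 : y • wedge2 R u v = -(q • wedge2 R v w) := by
    have := congrArg (fun t => wedge2 R t v) hrel
    simp only [wedge2_add_left, wedge2_smul_left, wedge2_self] at this
    rw [wedge2_swap w v] at this
    simpa using this
  have r3 : y • wedge2 R u w = -(x • wedge2 R v w) := by
    have := congrArg (fun t => wedge2 R t w) hrel
    simp only [wedge2_add_left, wedge2_smul_left, wedge2_self] at this
    rw [smul_zero, add_comm] at this
    exact eq_neg_of_add_eq_zero_left this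
  obtain ⟨ω, hω⟩ : ∃ ω, ω = (α * y) • wedge2 R u w + β • wedge2 R u v := ⟨_, rfl⟩
  have e1 : q • ω = wedge2 R u v := by
    calc q • ω = (α * y) • (q • wedge2 R u w) + (β * q) • wedge2 R u v := by rw [hω]; module
      _ = (α * (x * y) + β * q) • wedge2 R u v := by rw [← r1]; module
      _ = _ := by rw [hone, one_smul]
  have e2 : x • ω = wedge2 R u w := by
    calc x • ω = (α * (x * y)) • wedge2 R u w + β • (x • wedge2 R u v) := by rw [hω]; module
      _ = (α * (x * y) + β * q) • wedge2 R u w := by rw [r1]; module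
      _ = _ := by rw [hone, one_smul]
  have e3 : y • ω = -wedge2 R v w := by
    calc y • ω = (α * y) • (y • wedge2 R u w) + β • (y • wedge2 R u v) := by rw [hω]; module
      _ = (α * (x * y) + β * q) • (-wedge2 R v w) := by rw [r2, r3]; module
      _ = _ := by rw [hone, one_smul]
  have sp : Submodule.span R {ω} = ⊤ := by
    rw [eq_top_iff, ← exteriorPower.ιMulti_span_of_span (R := R) (n := 2) (M := M) hspan,
      Submodule.span_le]
    have m0 : ω ∈ Submodule.span R {ω} := Submodule.mem_span_singleton_self ω
    have m1 : wedge2 R u v ∈ Submodule.span R {ω} := e1 ▸ Submodule.smul_mem _ _ m0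
    have m2 : wedge2 R u w ∈ Submodule.span R {ω} := e2 ▸ Submodule.smul_mem _ _ m0
    have m3 : wedge2 R v w ∈ Submodule.span R {ω} := by
      have := Submodule.neg_mem _ (Submodule.smul_mem _ y m0)
      rwa [e3, neg_neg] at this
    have key : ∀ i j : Fin 3, wedge2 R (![u, v, w] i) (![u, v, w] j) ∈ Submodule.span R {ω} := by
      intro i j
      fin_cases i <;> fin_cases j
      · exact (wedge2_self (R := R) u) ▸ Submodule.zero_mem _
      · exact m1
      · exact m2
      · exact (wedge2_swap (R := R) v u) ▸ Submodule.neg_mem _ m1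
      · exact (wedge2_self (R := R) v) ▸ Submodule.zero_mem _
      · exact m3
      · exact (wedge2_swap (R := R) w u) ▸ Submodule.neg_mem _ m2
      · exact (wedge2_swap (R := R) w v) ▸ Submodule.neg_mem _ m3
      · exact (wedge2_self (R := R) w) ▸ Submodule.zero_mem _
    rintro _ ⟨a, ha, rfl⟩
    obtain ⟨i, hi⟩ := ha (Set.mem_range_self 0)
    obtain ⟨j, hj⟩ := ha (Set.mem_range_self 1)
    have ea : a = ![![u, v, w] i, ![u, v, w] j] := by
      ext k
      fin_cases k
      · exact hi.symm
      · exact hj.symm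
    rw [ea]
    exact key i j
  obtain ⟨φ, hφ⟩ : ∃ φ : ⋀[R]^2 M →ₗ[R] R, φ ω = 1 := by
    refine ⟨β • detForm f g + (α * y) • detForm f h, ?_⟩
    rw [hω]
    simp only [map_add, map_smul, LinearMap.add_apply, LinearMap.smul_apply, detForm_wedge2,
      fu, fv, fw, gu, gv, gw, hu, hv, hw, smul_eq_mul]
    linear_combination (α * (x * y) + β * q + 1) * hone
  refine ⟨⟨LinearEquiv.ofBijective φ ⟨?_, ?_⟩⟩, ω, sp, e1, e2, e3⟩
  · rw [← LinearMap.ker_eq_bot, LinearMap.ker_eq_bot']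
    intro m hm
    have : m ∈ Submodule.span R {ω} := sp ▸ Submodule.mem_top
    obtain ⟨r, rfl⟩ := Submodule.mem_span_singleton.1 this
    rw [map_smul, hφ, smul_eq_mul, mul_one] at hm
    rw [hm, zero_smul]
  · intro r
    exact ⟨r • ω, by rw [map_smul, hφ, smul_eq_mul, mul_one]⟩

end Generic

/-- A functional on the differentials with prescribed values on `dx, dy, dz`. -/
lemma exists_functional (p : ℂ[X]) (a b c : P3)
    (hrel : xP * b + yP * a - Polynomial.aeval zP (Polynomial.derivative p) * c = 0) :
    ∃ f : Ω[(ODan p)⁄ℂ] →ₗ[ODan p] ODan p,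
      f (dX p) = Ideal.Quotient.mk (relIdeal p) a ∧
      f (dY p) = Ideal.Quotient.mk (relIdeal p) b ∧
      f (dZ p) = Ideal.Quotient.mk (relIdeal p) c := by
  obtain ⟨d, hd⟩ : ∃ d : Derivation ℂ P3 P3, d = MvPolynomial.mkDerivation ℂ ![a, b, c] := ⟨_, rfl⟩
  have hx : d xP = a := by rw [hd, xP, MvPolynomial.mkDerivation_X]; rfl
  have hy : d yP = b := by rw [hd, yP, MvPolynomial.mkDerivation_X]; rfl
  have hz : d zP = c := by rw [hd, zP, MvPolynomial.mkDerivation_X]; rfl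
  have hgen : d (xP * yP - Polynomial.aeval zP p) = 0 := by
    rw [map_sub, Derivation.leibniz, Derivation.map_aeval, hx, hy, hz]
    simpa only [smul_eq_mul] using hrel
  have hker : ∀ t, Ideal.Quotient.mkₐ ℂ (relIdeal p) t = 0 →
      Ideal.Quotient.mkₐ ℂ (relIdeal p) (d t) = 0 := by
    intro t ht
    rw [Ideal.Quotient.mkₐ_eq_mk, Ideal.Quotient.eq_zero_iff_mem] at ht ⊢
    obtain ⟨s, rfl⟩ := Ideal.mem_span_singleton'.1 ht
    rw [Derivation.leibniz, hgen, smul_zero, zero_add, smul_eq_mul]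
    exact Ideal.mul_mem_right _ _ (Ideal.subset_span rfl)
  have hs : Function.Surjective (Ideal.Quotient.mkₐ ℂ (relIdeal p)) :=
    Ideal.Quotient.mkₐ_surjective ℂ _
  have happ := Derivation.liftOfSurjective_apply hs hker
  obtain ⟨D, hD⟩ : ∃ D : Derivation ℂ (ODan p) (ODan p), ∀ t,
      D (Ideal.Quotient.mk (relIdeal p) t) = Ideal.Quotient.mk (relIdeal p) (d t) :=
    ⟨_, happ⟩
  refine ⟨D.liftKaehlerDifferential, ?_, ?_, ?_⟩
  · rw [dX, Derivation.liftKaehlerDifferential_comp_D, hD, hx]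
  · rw [dY, Derivation.liftKaehlerDifferential_comp_D, hD, hy]
  · rw [dZ, Derivation.liftKaehlerDifferential_comp_D, hD, hz]

lemma span_dXYZ (p : ℂ[X]) :
    Submodule.span (ODan p) (Set.range ![dX p, dY p, dZ p]) = ⊤ := by
  rw [eq_top_iff, ← KaehlerDifferential.span_range_derivation ℂ (ODan p), Submodule.span_le]
  rintro _ ⟨t, rfl⟩
  obtain ⟨t, rfl⟩ := Ideal.Quotient.mk_surjective t
  induction t using MvPolynomial.induction_on with
  | C c =>
    have : Ideal.Quotient.mk (relIdeal p) (MvPolynomial.C c) = algebraMap ℂ (ODan p) c := rfl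
    rw [this, Derivation.map_algebraMap]
    exact Submodule.zero_mem _
  | add s t hs ht =>
    rw [map_add, map_add]
    exact Submodule.add_mem _ hs ht
  | mul_X s i hs =>
    rw [map_mul, Derivation.leibniz]
    refine Submodule.add_mem _ (Submodule.smul_mem _ _ (Submodule.subset_span ⟨i, ?_⟩))
      (Submodule.smul_mem _ _ hs)
    fin_cases i <;> rfl

/-- Let `p` be squarefree of degree at least `2` and `R = O(D_p)`.  Then
`⋀²_R Ω_{R/ℂ}` is a free `R`-module of rank `1`, and it admits a generator `ω_p` with
`p'(z)·ω_p = dx∧dy`, `x·ω_p = dx∧dz` and `y·ω_p = -dy∧dz`. -/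
theorem exterior_square_free_rank_one (p : ℂ[X])
    (hsp : Squarefree p) (hp2 : 2 ≤ p.natDegree) :
    Nonempty ((⋀[ODan p]^2 (Ω[(ODan p)⁄ℂ])) ≃ₗ[ODan p] ODan p) ∧
    ∃ ω : ⋀[ODan p]^2 (Ω[(ODan p)⁄ℂ]),
      Submodule.span (ODan p) {ω} = ⊤ ∧
      (Ideal.Quotient.mk (relIdeal p) (Polynomial.aeval zP (Polynomial.derivative p))) • ω =
        wedge2 (ODan p) (dX p) (dY p) ∧
      (Ideal.Quotient.mk (relIdeal p) xP) • ω = wedge2 (ODan p) (dX p) (dZ p) ∧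
      (Ideal.Quotient.mk (relIdeal p) yP) • ω = -(wedge2 (ODan p) (dY p) (dZ p)) := by
  have hcop : IsCoprime p (Polynomial.derivative p) :=
    (PerfectField.separable_iff_squarefree.2 hsp)
  obtain ⟨A, B, hAB⟩ := hcop
  have hrel0 : Ideal.Quotient.mk (relIdeal p) xP * Ideal.Quotient.mk (relIdeal p) yP =
      Ideal.Quotient.mk (relIdeal p) (Polynomial.aeval zP p) := by
    rw [← map_mul, Ideal.Quotient.eq]
    exact Ideal.subset_span rfl
  obtain ⟨f, fu, fv, fw⟩ := exists_functional p 0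
    (Polynomial.aeval zP (Polynomial.derivative p)) xP (by ring)
  obtain ⟨g, gu, gv, gw⟩ := exists_functional p
    (-Polynomial.aeval zP (Polynomial.derivative p)) 0 (-yP) (by ring)
  obtain ⟨h, hu, hv, hw⟩ := exists_functional p (-xP) yP 0 (by ring)
  refine generic_main (dX p) (dY p) (dZ p) _ _ _
    (Ideal.Quotient.mk (relIdeal p) (Polynomial.aeval zP A))
    (Ideal.Quotient.mk (relIdeal p) (Polynomial.aeval zP B)) ?_ (span_dXYZ p) ?_ f g h
    (by rw [fu, map_zero]) fv fw (by rw [gu, map_neg]) (by rw [gv, map_zero])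
    (by rw [gw, map_neg]) (by rw [hu, map_neg]) hv (by rw [hw, map_zero])
  · rw [hrel0, ← map_mul, ← map_mul, ← map_mul, ← map_mul, ← map_add, ← map_add, hAB, map_one,
      map_one]
  · have e := congrArg (KaehlerDifferential.D ℂ (ODan p)) hrel0
    have ea : ∀ r : ℂ[X], Ideal.Quotient.mk (relIdeal p) (Polynomial.aeval zP r) =
        Polynomial.aeval (Ideal.Quotient.mk (relIdeal p) zP) r := fun r =>
      (Polynomial.aeval_algHom_apply (Ideal.Quotient.mkₐ ℂ (relIdeal p)) zP r).symm
    rw [ea p, Derivation.leibniz, Derivation.map_aeval, ← ea] at e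
    exact e

end
end
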